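/- arXiv:2004.08721 — 5 statements merged into one kernel-verified Lean document; each statement's English description precedes it below -/
import Mathlib

section
/- For integers ℓ ≥ 1, k > ℓ+1 and n ≥ 5k², one has g(n+1,k,ℓ) − g(n,k,ℓ) = C(n,k+ℓ−1)·C(k+ℓ−1,ℓ−1). -/
/-- `v` is a `{0,1,-1}`-vector of length `n` with exactly `k` coordinates equal to `+1`
and exactly `l` coordinates equal to `-1`, i.e. `v ∈ V(n,k,l)`. -/
def IsPMVec (n k l : ℕ) (v : Fin n → ℤ) : Prop :=
  (∀ i, v i = 0 ∨ v i = 1 ∨ v i = -1) ∧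
  (Finset.univ.filter fun i => v i = 1).card = k ∧
  (Finset.univ.filter fun i => v i = -1).card = l

/-- the standard scalar product -/
def dotZ {n : ℕ} (v w : Fin n → ℤ) : ℤ := ∑ i, v i * w i

/-- `g(n,k,l)`: the maximum size of a family `V ⊆ V(n,k,l)` with
`⟨v,w⟩ > -2l` for all `v, w ∈ V`. -/
noncomputable def gVal (n k l : ℕ) : ℕ :=
  sSup {m | ∃ F : Finset (Fin n → ℤ),
    (∀ v ∈ F, IsPMVec n k l v) ∧
    (∀ v ∈ F, ∀ w ∈ F, -2 * (l : ℤ) < dotZ v w) ∧ F.card = m}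

namespace SignedVec

open Finset

/-- Signed vectors of length `n`, encoded by the positions of their `+1`s and `-1`s. -/
def vecs (n k l : ℕ) : Finset (Finset ℕ × Finset ℕ) :=
  ((range n).powersetCard k ×ˢ (range n).powersetCard l).filter fun v => Disjoint v.1 v.2

/-- The scalar product of `v` and `w` attains its minimum. -/
def Anti (v w : Finset ℕ × Finset ℕ) : Prop :=
  Disjoint v.1 w.1 ∧ v.2 ⊆ w.1 ∧ w.2 ⊆ v.1

def AntiFree (F : Finset (Finset ℕ × Finset ℕ)) : Prop :=
  ∀ v ∈ F, ∀ w ∈ F, ¬ Anti v w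

lemma mem_vecs {n k l : ℕ} {v : Finset ℕ × Finset ℕ} :
    v ∈ vecs n k l ↔
      v.1 ⊆ range n ∧ #v.1 = k ∧ v.2 ⊆ range n ∧ #v.2 = l ∧ Disjoint v.1 v.2 := by
  simp only [vecs, mem_filter, mem_product, mem_powersetCard]
  tauto

lemma Anti.symm {v w : Finset ℕ × Finset ℕ} (h : Anti v w) : Anti w v :=
  ⟨h.1.symm, h.2.2, h.2.1⟩

lemma anti_iff {v w : Finset ℕ × Finset ℕ} :
    Anti v w ↔ ∀ x, ¬ (x ∈ v.1 ∧ x ∈ w.1) ∧ (x ∈ v.2 → x ∈ w.1) ∧ (x ∈ w.2 → x ∈ v.1) := by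
  simp only [Anti, Finset.disjoint_left, Finset.subset_iff]
  grind

/-- The positions of the `+1`s and the `-1`s of a function. -/
def toPair {n : ℕ} (x : Fin n → ℤ) : Finset ℕ × Finset ℕ :=
  ((univ.filter fun i => x i = 1).map Fin.valEmbedding,
    (univ.filter fun i => x i = -1).map Fin.valEmbedding)

/-- The function with `+1` on `v.1` and `-1` on `v.2`. -/
def ofPair (n : ℕ) (v : Finset ℕ × Finset ℕ) (i : Fin n) : ℤ :=
  if (i : ℕ) ∈ v.1 then 1 else if (i : ℕ) ∈ v.2 then -1 else 0

lemma val_mem_toPair_fst {n : ℕ} {x : Fin n → ℤ} {i : Fin n} :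
    (i : ℕ) ∈ (toPair x).1 ↔ x i = 1 := by
  simp [toPair, Fin.val_inj]

lemma val_mem_toPair_snd {n : ℕ} {x : Fin n → ℤ} {i : Fin n} :
    (i : ℕ) ∈ (toPair x).2 ↔ x i = -1 := by
  simp [toPair, Fin.val_inj]

lemma lt_of_mem_toPair {n : ℕ} {x : Fin n → ℤ} {a : ℕ}
    (h : a ∈ (toPair x).1 ∨ a ∈ (toPair x).2) : a < n := by
  simp only [toPair, mem_map, mem_filter] at h
  rcases h with ⟨i, -, rfl⟩ | ⟨i, -, rfl⟩ <;> exact i.2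

lemma toPair_mem {n k l : ℕ} {x : Fin n → ℤ} (hx : IsPMVec n k l x) :
    toPair x ∈ vecs n k l := by
  refine mem_vecs.2 ⟨fun a ha => mem_range.2 (lt_of_mem_toPair (.inl ha)), ?_,
    fun a ha => mem_range.2 (lt_of_mem_toPair (.inr ha)), ?_, ?_⟩
  · simpa [toPair] using hx.2.1
  · simpa [toPair] using hx.2.2
  · rw [Finset.disjoint_left]
    intro a h1 h2
    obtain ⟨i, rfl⟩ : ∃ i : Fin n, (i : ℕ) = a := ⟨⟨a, lt_of_mem_toPair (.inl h1)⟩, rfl⟩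
    rw [val_mem_toPair_fst] at h1
    rw [val_mem_toPair_snd] at h2
    omega

lemma toPair_ofPair {n k l : ℕ} {v : Finset ℕ × Finset ℕ} (hv : v ∈ vecs n k l) :
    toPair (ofPair n v) = v := by
  obtain ⟨h1, -, h2, -, hd⟩ := mem_vecs.1 hv
  rw [Finset.disjoint_left] at hd
  ext a
  · constructor
    · intro ha
      obtain ⟨i, rfl⟩ : ∃ i : Fin n, (i : ℕ) = a := ⟨⟨a, lt_of_mem_toPair (.inl ha)⟩, rfl⟩
      rw [val_mem_toPair_fst] at ha
      unfold ofPair at ha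
      split_ifs at ha with h <;> first | exact h | omega
    · intro ha
      obtain ⟨i, rfl⟩ : ∃ i : Fin n, (i : ℕ) = a := ⟨⟨a, mem_range.1 (h1 ha)⟩, rfl⟩
      rw [val_mem_toPair_fst]
      simp [ofPair, ha]
  · constructor
    · intro ha
      obtain ⟨i, rfl⟩ : ∃ i : Fin n, (i : ℕ) = a := ⟨⟨a, lt_of_mem_toPair (.inr ha)⟩, rfl⟩
      rw [val_mem_toPair_snd] at ha
      unfold ofPair at ha
      split_ifs at ha with h h'
      exact h'
    · intro ha
      obtain ⟨i, rfl⟩ : ∃ i : Fin n, (i : ℕ) = a := ⟨⟨a, mem_range.1 (h2 ha)⟩, rfl⟩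
      rw [val_mem_toPair_snd]
      have : (i : ℕ) ∉ v.1 := fun h => hd h ha
      simp [ofPair, ha, this]

lemma isPMVec_ofPair {n k l : ℕ} {v : Finset ℕ × Finset ℕ} (hv : v ∈ vecs n k l) :
    IsPMVec n k l (ofPair n v) := by
  have e := toPair_ofPair hv
  obtain ⟨-, c1, -, c2, -⟩ := mem_vecs.1 hv
  rw [← e] at c1 c2
  refine ⟨fun i => ?_, by simpa [toPair] using c1, by simpa [toPair] using c2⟩
  unfold ofPair
  split_ifs <;> simp

lemma toPair_injOn {n k l : ℕ} {x y : Fin n → ℤ} (hx : IsPMVec n k l x)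
    (hy : IsPMVec n k l y) (h : toPair x = toPair y) : x = y := by
  funext i
  have h1 := val_mem_toPair_fst (x := x) (i := i)
  have h2 := val_mem_toPair_snd (x := x) (i := i)
  rw [h, val_mem_toPair_fst] at h1
  rw [h, val_mem_toPair_snd] at h2
  have := hx.1 i
  have := hy.1 i
  omega

lemma lt_dotZ_iff {n k l : ℕ} {x y : Fin n → ℤ} (hx : IsPMVec n k l x)
    (hy : IsPMVec n k l y) : -2 * (l : ℤ) < dotZ x y ↔ ¬ Anti (toPair x) (toPair y) := by
  have hs : ∑ i, (x i * y i + ((if x i = -1 then 1 else 0) + if y i = -1 then 1 else 0))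
      = dotZ x y + 2 * l := by
    rw [sum_add_distrib, sum_add_distrib, sum_boole, sum_boole, hx.2.2, hy.2.2, dotZ]
    ring
  have hnn : ∀ i ∈ univ,
      0 ≤ x i * y i + ((if x i = -1 then 1 else 0) + if y i = -1 then 1 else 0) := by
    intro i _
    rcases hx.1 i with h | h | h <;> rcases hy.1 i with h' | h' | h' <;> simp [h, h']
  have h0 := sum_eq_zero_iff_of_nonneg hnn
  have h1 := sum_nonneg hnn
  rw [hs] at h0 h1
  have hA : Anti (toPair x) (toPair y) ↔
      ∀ i ∈ univ, x i * y i + ((if x i = -1 then 1 else 0) + if y i = -1 then 1 else 0) = 0 := by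
    rw [anti_iff]
    constructor
    · intro h i _
      have := h i
      simp only [val_mem_toPair_fst, val_mem_toPair_snd] at this
      rcases hx.1 i with h | h | h <;> rcases hy.1 i with h' | h' | h' <;> simp_all
    · intro h a
      by_cases ha : a < n
      · have := h ⟨a, ha⟩ (mem_univ _)
        have e1 := val_mem_toPair_fst (x := x) (i := ⟨a, ha⟩)
        have e2 := val_mem_toPair_fst (x := y) (i := ⟨a, ha⟩)
        have e3 := val_mem_toPair_snd (x := x) (i := ⟨a, ha⟩)
        have e4 := val_mem_toPair_snd (x := y) (i := ⟨a, ha⟩)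
        simp only at e1 e2 e3 e4
        clear h0 h1 hs hnn
        rw [e1, e2, e3, e4]
        rcases hx.1 ⟨a, ha⟩ with h | h | h <;> rcases hy.1 ⟨a, ha⟩ with h' | h' | h' <;>
          simp_all
      · have e1 := mt (lt_of_mem_toPair (x := x)) ha
        have e2 := mt (lt_of_mem_toPair (x := y)) ha
        tauto
  rw [hA, ← h0]
  omega

lemma card_le_card_vecs {n k l : ℕ} {F : Finset (Fin n → ℤ)}
    (hF : ∀ v ∈ F, IsPMVec n k l v) : #F ≤ #(vecs n k l) := by
  refine card_le_card_of_injOn toPair (fun x hx => toPair_mem (hF x hx)) ?_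
  intro x hx y hy h
  exact toPair_injOn (hF x hx) (hF y hy) h

lemma card_le_gVal {n k l : ℕ} {F : Finset (Finset ℕ × Finset ℕ)} (hF : F ⊆ vecs n k l)
    (ha : AntiFree F) : #F ≤ gVal n k l := by
  refine le_csSup ⟨#(vecs n k l), ?_⟩ ⟨F.image (ofPair n), ?_, ?_, ?_⟩
  · rintro m ⟨G, hG, -, rfl⟩
    exact card_le_card_vecs hG
  · intro x hx
    obtain ⟨v, hv, rfl⟩ := mem_image.1 hx
    exact isPMVec_ofPair (hF hv)
  · intro x hx y hy
    obtain ⟨v, hv, rfl⟩ := mem_image.1 hx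
    obtain ⟨w, hw, rfl⟩ := mem_image.1 hy
    rw [lt_dotZ_iff (isPMVec_ofPair (hF hv)) (isPMVec_ofPair (hF hw)), toPair_ofPair (hF hv),
      toPair_ofPair (hF hw)]
    exact ha v hv w hw
  · refine card_image_of_injOn fun v hv w hw h => ?_
    rw [← toPair_ofPair (hF hv), ← toPair_ofPair (hF hw), h]

lemma exists_card_eq_gVal (n k l : ℕ) :
    ∃ F ⊆ vecs n k l, AntiFree F ∧ #F = gVal n k l := by
  obtain ⟨G, hG, hd, hc⟩ := Nat.sSup_mem (s := {m | ∃ F : Finset (Fin n → ℤ),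
    (∀ v ∈ F, IsPMVec n k l v) ∧
    (∀ v ∈ F, ∀ w ∈ F, -2 * (l : ℤ) < dotZ v w) ∧ F.card = m}) ⟨0, ∅, by simp⟩
    ⟨#(vecs n k l), by rintro m ⟨G, hG, -, rfl⟩; exact card_le_card_vecs hG⟩
  refine ⟨G.image toPair, ?_, ?_, ?_⟩
  · intro v hv
    obtain ⟨x, hx, rfl⟩ := mem_image.1 hv
    exact toPair_mem (hG x hx)
  · intro v hv w hw
    obtain ⟨x, hx, rfl⟩ := mem_image.1 hv
    obtain ⟨y, hy, rfl⟩ := mem_image.1 hw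
    exact (lt_dotZ_iff (hG x hx) (hG y hy)).1 (hd x hx y hy)
  · rw [card_image_of_injOn fun x hx y hy h => toPair_injOn (hG x hx) (hG y hy) h]
    exact hc

lemma card_vecs (n k l : ℕ) :
    #(vecs n k l) = n.choose (k + l) * (k + l).choose l := by
  have h : #(vecs n k l) = #(((range n).powersetCard l).sigma
      fun N => (range n \ N).powersetCard k) := by
    refine card_bij (fun v _ => ⟨v.2, v.1⟩) ?_ ?_ ?_
    · intro v hv
      obtain ⟨h1, c1, h2, c2, hd⟩ := mem_vecs.1 hv
      simp only [mem_sigma, mem_powersetCard, subset_sdiff]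
      exact ⟨⟨h2, c2⟩, ⟨h1, hd⟩, c1⟩
    · rintro ⟨a, b⟩ _ ⟨c, d⟩ _ h
      simp_all
    · rintro ⟨N, P⟩ h
      simp only [mem_sigma, mem_powersetCard, subset_sdiff] at h
      exact ⟨(P, N), mem_vecs.2 ⟨h.2.1.1, h.2.2, h.1.1, h.1.2, h.2.1.2⟩, rfl⟩
  rw [h, card_sigma, sum_congr rfl (g := fun _ => (n - l).choose k), sum_const,
    card_powersetCard, card_range, smul_eq_mul]
  · rw [Nat.choose_mul (Nat.le_add_left l k)]
    simp
  · intro N hN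
    rw [mem_powersetCard] at hN
    rw [card_powersetCard, card_sdiff_of_subset hN.1, card_range, hN.2]

lemma gVal_succ_ge (k l n : ℕ) (hl : 1 ≤ l) :
    gVal n k l + #(vecs n k (l - 1)) ≤ gVal (n + 1) k l := by
  obtain ⟨F, hF, ha, hc⟩ := exists_card_eq_gVal n k l
  set G := (vecs n k (l - 1)).image fun v => (v.1, insert n v.2) with hG
  have hn1 : ∀ v ∈ F ∪ G, v.1 ⊆ range n := by
    intro v hv
    rcases mem_union.1 hv with h | h
    · exact (mem_vecs.1 (hF h)).1
    · obtain ⟨w, hw, rfl⟩ := mem_image.1 h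
      exact (mem_vecs.1 hw).1
  have hGn : ∀ v ∈ G, n ∈ v.2 := by
    intro v hv
    obtain ⟨w, hw, rfl⟩ := mem_image.1 hv
    simp
  have hdisj : Disjoint F G := by
    rw [Finset.disjoint_left]
    intro v hv hv'
    exact absurd ((mem_vecs.1 (hF hv)).2.2.1 (hGn v hv')) (by simp)
  have hcG : #G = #(vecs n k (l - 1)) := by
    refine card_image_of_injOn ?_
    rintro ⟨a, b⟩ h ⟨c, d⟩ h' e
    have hb : n ∉ b := fun hh => absurd ((mem_vecs.1 h).2.2.1 hh) (by simp)
    have hd : n ∉ d := fun hh => absurd ((mem_vecs.1 h').2.2.1 hh) (by simp)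
    simp only [Prod.mk.injEq] at e ⊢
    refine ⟨e.1, ?_⟩
    rw [← erase_insert hb, e.2, erase_insert hd]
  rw [← hc, ← hcG, ← card_union_of_disjoint hdisj]
  refine card_le_gVal ?_ ?_
  · have hr : range n ⊆ range (n + 1) := range_mono (Nat.le_succ n)
    intro v hv
    rcases mem_union.1 hv with h | h
    · obtain ⟨h1, c1, h2, c2, hd⟩ := mem_vecs.1 (hF h)
      exact mem_vecs.2 ⟨h1.trans hr, c1, h2.trans hr, c2, hd⟩
    · obtain ⟨w, hw, rfl⟩ := mem_image.1 h
      obtain ⟨h1, c1, h2, c2, hd⟩ := mem_vecs.1 hw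
      have hn2 : n ∉ w.2 := fun hh => absurd (h2 hh) (by simp)
      have hn1 : n ∉ w.1 := fun hh => absurd (h1 hh) (by simp)
      refine mem_vecs.2 ⟨h1.trans hr, c1, ?_, ?_, ?_⟩
      · exact insert_subset (by simp) (h2.trans hr)
      · rw [card_insert_of_notMem hn2]
        omega
      · rw [disjoint_insert_right]
        exact ⟨hn1, hd⟩
  · intro v hv w hw hA
    have hv1 := hn1 v hv
    have hw1 := hn1 w hw
    rcases mem_union.1 hv with h | h
    · rcases mem_union.1 hw with h' | h'
      · exact ha v h w h' hA
      · exact absurd (hv1 (hA.2.2 (hGn w h'))) (by simp)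
    · exact absurd (hw1 (hA.2.1 (hGn v h))) (by simp)

/-- Interchange the coordinates `i` and `j`. -/
def swp (i j : ℕ) (v : Finset ℕ × Finset ℕ) : Finset ℕ × Finset ℕ :=
  (v.1.image (Equiv.swap i j), v.2.image (Equiv.swap i j))

/-- The coordinate at `i` is smaller than the one at `j`. -/
def Movable (i j : ℕ) (v : Finset ℕ × Finset ℕ) : Prop :=
  (i ∈ v.2 ∧ j ∉ v.2) ∨ (i ∉ v.1 ∧ j ∈ v.1)

/-- Moving larger coordinates to the front does not leave `F`. -/
def Stable (n : ℕ) (F : Finset (Finset ℕ × Finset ℕ)) : Prop :=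
  ∀ i j, i < j → j < n → ∀ v ∈ F, Movable i j v → swp i j v ∈ F

lemma mem_image_swap {i j x : ℕ} {s : Finset ℕ} :
    x ∈ s.image (Equiv.swap i j) ↔ Equiv.swap i j x ∈ s := by
  constructor
  · intro h
    obtain ⟨y, hy, rfl⟩ := mem_image.1 h
    simpa using hy
  · intro h
    exact mem_image.2 ⟨_, h, by simp⟩

lemma mem_swp_fst {i j x : ℕ} {v : Finset ℕ × Finset ℕ} :
    x ∈ (swp i j v).1 ↔ Equiv.swap i j x ∈ v.1 := mem_image_swap

lemma mem_swp_snd {i j x : ℕ} {v : Finset ℕ × Finset ℕ} :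
    x ∈ (swp i j v).2 ↔ Equiv.swap i j x ∈ v.2 := mem_image_swap

lemma swp_swp (i j : ℕ) (v : Finset ℕ × Finset ℕ) : swp i j (swp i j v) = v := by
  ext x <;> simp [mem_swp_fst, mem_swp_snd]

lemma swp_mem_vecs {n k l i j : ℕ} (hi : i < n) (hj : j < n) {v : Finset ℕ × Finset ℕ}
    (hv : v ∈ vecs n k l) : swp i j v ∈ vecs n k l := by
  obtain ⟨h1, c1, h2, c2, hd⟩ := mem_vecs.1 hv
  have key : ∀ s : Finset ℕ, s ⊆ range n → s.image (Equiv.swap i j) ⊆ range n := by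
    intro s hs x hx
    obtain ⟨y, hy, rfl⟩ := mem_image.1 hx
    have := mem_range.1 (hs hy)
    rw [mem_range, Equiv.swap_apply_def]
    split_ifs <;> assumption
  refine mem_vecs.2 ⟨key _ h1, ?_, key _ h2, ?_, ?_⟩
  · rw [swp, card_image_of_injective _ (Equiv.injective _), c1]
  · rw [swp, card_image_of_injective _ (Equiv.injective _), c2]
  · exact (disjoint_image (Equiv.injective _)).2 hd

lemma anti_swp_swp {i j : ℕ} {v w : Finset ℕ × Finset ℕ} :
    Anti (swp i j v) w ↔ Anti v (swp i j w) := by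
  rw [anti_iff, anti_iff]
  simp only [mem_swp_fst, mem_swp_snd]
  constructor <;> intro h x <;> simpa using h (Equiv.swap i j x)

lemma anti_of_anti_swp {n k l i j : ℕ} {v w : Finset ℕ × Finset ℕ} (hv : v ∈ vecs n k l)
    (hw : w ∈ vecs n k l) (hmv : Movable i j v) (hmw : ¬ Movable i j w)
    (h : Anti (swp i j v) w) : Anti v w := by
  have dv := (mem_vecs.1 hv).2.2.2.2
  have dw := (mem_vecs.1 hw).2.2.2.2
  rw [Finset.disjoint_left] at dv dw
  rw [anti_iff] at h ⊢
  simp only [mem_swp_fst, mem_swp_snd] at h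
  have hi := h i
  have hj := h j
  rw [Equiv.swap_apply_left] at hi
  rw [Equiv.swap_apply_right] at hj
  unfold Movable at hmv hmw
  have d1 := @dv i
  have d2 := @dv j
  have d3 := @dw i
  have d4 := @dw j
  intro x
  by_cases hxi : x = i
  · subst hxi
    grind
  by_cases hxj : x = j
  · subst hxj
    grind
  simpa [Equiv.swap_apply_of_ne_of_ne hxi hxj] using h x

/-- A weight which grows when larger coordinates move to the front. -/
def potential (v : Finset ℕ × Finset ℕ) : ℤ := ∑ x ∈ v.2, (x : ℤ) - ∑ x ∈ v.1, (x : ℤ)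

lemma sum_image_swap {i j : ℕ} (hij : i ≠ j) (s : Finset ℕ) :
    ∑ x ∈ s.image (Equiv.swap i j), (x : ℤ) = ∑ x ∈ s, (x : ℤ) +
      ((if i ∈ s then ((j : ℤ) - i) else 0) - if j ∈ s then ((j : ℤ) - i) else 0) := by
  rw [sum_image fun a _ b _ h => (Equiv.injective _ h), ← sum_ite_eq' s i fun _ => (j : ℤ) - i,
    ← sum_ite_eq' s j fun _ => (j : ℤ) - i,
    ← sum_sub_distrib, ← sum_add_distrib]
  refine sum_congr rfl fun x _ => ?_
  rw [Equiv.swap_apply_def]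
  split_ifs <;> (try subst_vars) <;> omega

lemma potential_lt_swp {n k l i j : ℕ} (hij : i < j) {v : Finset ℕ × Finset ℕ}
    (hv : v ∈ vecs n k l) (hm : Movable i j v) : potential v < potential (swp i j v) := by
  have dv := (mem_vecs.1 hv).2.2.2.2
  rw [Finset.disjoint_left] at dv
  have d1 := @dv i
  have d2 := @dv j
  unfold Movable at hm
  simp only [potential, swp, sum_image_swap hij.ne]
  have : (i : ℤ) < j := by exact_mod_cast hij
  split_ifs <;> first | (exfalso; tauto) | linarith

lemma exists_stable {n k l : ℕ} {F : Finset (Finset ℕ × Finset ℕ)} (hF : F ⊆ vecs n k l)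
    (ha : AntiFree F) :
    ∃ G ⊆ vecs n k l, AntiFree G ∧ #G = #F ∧ Stable n G := by
  classical
  obtain ⟨G, hG, hmax⟩ := exists_max_image
    ((vecs n k l).powerset.filter fun G => AntiFree G ∧ #G = #F)
    (fun G => ∑ v ∈ G, potential v) ⟨F, by simp [hF, ha]⟩
  simp only [mem_filter, mem_powerset] at hG hmax
  obtain ⟨hGv, hGa, hGc⟩ := hG
  refine ⟨G, hGv, hGa, hGc, ?_⟩
  intro i j hij hj v hv hm
  by_contra hvn
  set s : Finset ℕ × Finset ℕ → Finset ℕ × Finset ℕ :=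
    fun w => if Movable i j w ∧ swp i j w ∉ G then swp i j w else w with hs
  have hs1 : ∀ w, Movable i j w → swp i j w ∉ G → s w = swp i j w :=
    fun w h h' => if_pos ⟨h, h'⟩
  have hcases : ∀ w, (Movable i j w ∧ swp i j w ∉ G ∧ s w = swp i j w) ∨
      (¬ (Movable i j w ∧ swp i j w ∉ G) ∧ s w = w) := by
    intro w
    by_cases h : Movable i j w ∧ swp i j w ∉ G
    · exact .inl ⟨h.1, h.2, if_pos h⟩
    · exact .inr ⟨h, if_neg h⟩
  have hinj : Set.InjOn s G := by
    intro w hw w' hw' h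
    rcases hcases w with ⟨-, hn, e⟩ | ⟨-, e⟩ <;> rcases hcases w' with ⟨-, hn', e'⟩ | ⟨-, e'⟩
    · rw [e, e'] at h
      rw [← swp_swp i j w, h, swp_swp]
    · rw [e, e'] at h
      exact absurd (h ▸ hw') hn
    · rw [e, e'] at h
      exact absurd (h ▸ hw) hn'
    · rw [← e, h, e']
  have hmix : ∀ w ∈ G, ∀ w' ∈ G, Movable i j w → ¬ (Movable i j w' ∧ swp i j w' ∉ G) →
      ¬ Anti (swp i j w) w' := by
    intro w hw w' hw' hmw hmw' hA
    by_cases h : Movable i j w'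
    · have : swp i j w' ∈ G := by
        by_contra hc
        exact hmw' ⟨h, hc⟩
      exact hGa w hw _ this (anti_swp_swp.1 hA)
    · exact hGa w hw w' hw' (anti_of_anti_swp (hGv hw) (hGv hw') hmw h hA)
  have hcard : #(G.image s) = #F := by rw [card_image_of_injOn hinj, hGc]
  have hle : ∑ w ∈ G.image s, potential w ≤ ∑ w ∈ G, potential w := by
    refine hmax _ ⟨?_, ?_, hcard⟩
    · intro x hx
      obtain ⟨w, hw, rfl⟩ := mem_image.1 hx
      rcases hcases w with ⟨-, -, e⟩ | ⟨-, e⟩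
      · rw [e]
        exact swp_mem_vecs (hij.trans hj) hj (hGv hw)
      · rw [e]
        exact hGv hw
    · intro x hx y hy
      obtain ⟨w, hw, rfl⟩ := mem_image.1 hx
      obtain ⟨w', hw', rfl⟩ := mem_image.1 hy
      rcases hcases w with ⟨hm, hn, e⟩ | ⟨hn, e⟩ <;>
        rcases hcases w' with ⟨hm', hn', e'⟩ | ⟨hn', e'⟩
      · rw [e, e', anti_swp_swp, swp_swp]
        exact hGa w hw w' hw'
      · rw [e, e']
        exact hmix w hw w' hw' hm hn'
      · rw [e, e']
        exact fun h => hmix w' hw' w hw hm' hn h.symm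
      · rw [e, e']
        exact hGa w hw w' hw'
  rw [sum_image hinj] at hle
  refine absurd hle (not_le.2 (sum_lt_sum (fun w hw => ?_) ⟨v, hv, ?_⟩))
  · rcases hcases w with ⟨hm, -, e⟩ | ⟨-, e⟩
    · rw [e]
      exact (potential_lt_swp hij (hGv hw) hm).le
    · rw [e]
  · rw [hs1 v hm hvn]
    exact potential_lt_swp hij (hGv hv) hm

/-- The `d` smallest elements outside of `A`. -/
lemma exists_initial (A : Finset ℕ) (d : ℕ) :
    ∃ Z : Finset ℕ, #Z = d ∧ Disjoint Z A ∧ ∀ y, Z ⊆ range y ∨ range y \ A ⊆ Z := by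
  induction d with
  | zero => exact ⟨∅, by simp⟩
  | succ d ih =>
    obtain ⟨Z, hc, hd, hZ⟩ := ih
    have hex : ∃ x, x ∉ A ∪ Z := Infinite.exists_notMem_finset _
    have hz := Nat.find_spec hex
    have hmin := fun x => Nat.find_min (m := x) hex
    set z := Nat.find hex
    rw [notMem_union] at hz
    refine ⟨insert z Z, by rw [card_insert_of_notMem hz.2, hc], ?_, fun y => ?_⟩
    · rw [disjoint_insert_left]
      exact ⟨hz.1, hd⟩
    · rcases hZ y with h | h
      · by_cases hy : z < y
        · exact .inl (insert_subset (mem_range.2 hy) h)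
        · refine .inr fun x hx => ?_
          rw [mem_sdiff, mem_range] at hx
          have := hmin x (by omega)
          grind
      · exact .inr (h.trans (subset_insert _ _))

/-- If every initial segment contains at least as many elements of `X` as of `P`, then the
elements of `P` can be matched to smaller elements of `X`. -/
lemma exists_matching {P X : Finset ℕ} (hd : Disjoint P X)
    (h : ∀ y, #(P.filter (· < y)) ≤ #(X.filter (· < y))) :
    ∃ f : ℕ → ℕ, Set.InjOn f P ∧ ∀ p ∈ P, f p ∈ X ∧ f p < p := by
  have hall : ∀ s : Finset P, #s ≤ #(s.biUnion fun p => X.filter (· < (p : ℕ))) := by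
    intro s
    rcases s.eq_empty_or_nonempty with rfl | hs
    · simp
    obtain ⟨m, hm, hmax⟩ := exists_max_image s (fun p => (p : ℕ)) hs
    calc #s = #(s.map (Function.Embedding.subtype _)) := (card_map _).symm
      _ ≤ #(P.filter (· < (m : ℕ) + 1)) := by
        refine card_le_card fun x hx => ?_
        obtain ⟨p, hp, rfl⟩ := mem_map.1 hx
        exact mem_filter.2 ⟨p.2, Nat.lt_succ_of_le (hmax p hp)⟩
      _ ≤ #(X.filter (· < (m : ℕ) + 1)) := h _
      _ ≤ _ := by
        refine card_le_card fun x hx => mem_biUnion.2 ⟨m, hm, ?_⟩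
        rw [mem_filter] at hx ⊢
        have : x ≠ m := fun e => (Finset.disjoint_left.1 hd) m.2 (e ▸ hx.1)
        exact ⟨hx.1, by omega⟩
  obtain ⟨f, hf, hfX⟩ := (all_card_le_biUnion_card_iff_exists_injective _).1 hall
  refine ⟨fun x => if hx : x ∈ P then f ⟨x, hx⟩ else 0, ?_, ?_⟩
  · intro x hx y hy e
    rw [mem_coe] at hx hy
    simp only [hx, hy, dif_pos] at e
    exact congrArg Subtype.val (hf e)
  · intro p hp
    simpa [hp] using hfX ⟨p, hp⟩

/-- Stability allows to move all of `v.1` to smaller positions simultaneously. -/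
lemma Stable.shift_mem {n k l : ℕ} {F : Finset (Finset ℕ × Finset ℕ)} (hF : F ⊆ vecs n k l)
    (hS : Stable n F) {P N X : Finset ℕ} (hv : (P, N) ∈ F) (hPX : Disjoint P X) {f : ℕ → ℕ}
    (hf : Set.InjOn f P) (hfX : ∀ p ∈ P, f p ∈ X ∧ f p < p) {s : Finset ℕ} (hs : s ⊆ P) :
    ((P \ s) ∪ s.image f, (N \ s.image f) ∪ s.filter fun p => f p ∈ N) ∈ F := by
  induction s using Finset.induction_on with
  | empty => simpa using hv
  | insert p s hp ih =>
    obtain ⟨hpP, hsP⟩ := insert_subset_iff.1 hs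
    obtain ⟨h1, -, -, -, hPN⟩ := mem_vecs.1 (hF hv)
    rw [Finset.disjoint_left] at hPX hPN
    have hfs : f p ∉ s.image f := by
      intro h
      obtain ⟨q, hq, e⟩ := mem_image.1 h
      exact hp (hf (hsP hq) hpP e ▸ hq)
    have hfP : f p ∉ P := fun h => hPX h (hfX p hpP).1
    have hps : p ∉ s.image f := by
      intro h
      obtain ⟨q, hq, e⟩ := mem_image.1 h
      exact hPX hpP (e ▸ (hfX q (hsP hq)).1)
    have hlt := (hfX p hpP).2
    have hmem := hS (f p) p hlt (mem_range.1 (h1 hpP)) _ (ih hsP) (.inr ⟨by grind, by grind⟩)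
    convert hmem using 1
    have hpN : p ∉ N := hPN hpP
    have hfs' : f p ∉ s := fun h => hfP (hsP h)
    refine Prod.ext ?_ ?_
    · ext x
      rw [mem_swp_fst]
      by_cases hx1 : x = f p
      · rw [hx1, Equiv.swap_apply_left]
        grind
      by_cases hx2 : x = p
      · rw [hx2, Equiv.swap_apply_right]
        grind
      rw [Equiv.swap_apply_of_ne_of_ne hx1 hx2]
      grind
    · ext x
      rw [mem_swp_snd]
      by_cases hx1 : x = f p
      · rw [hx1, Equiv.swap_apply_left]
        grind
      by_cases hx2 : x = p
      · rw [hx2, Equiv.swap_apply_right]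
        grind
      rw [Equiv.swap_apply_of_ne_of_ne hx1 hx2]
      grind

/-- A member of a stable family without antipodal pairs has a final segment with more `-1`s than
`1`s, or an initial segment more than half filled with `1`s. -/
lemma Stable.unbalanced_or_dense {n k l : ℕ} (hlk : l ≤ k) {F : Finset (Finset ℕ × Finset ℕ)}
    (hF : F ⊆ vecs n k l) (ha : AntiFree F) (hS : Stable n F) {P N : Finset ℕ}
    (hv : (P, N) ∈ F) :
    (∃ t, #(P.filter (t ≤ ·)) < #(N.filter (t ≤ ·))) ∨ ∃ m, m < 2 * #(P.filter (· < m)) := by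
  by_contra! h
  obtain ⟨hA, hB⟩ := h
  obtain ⟨-, hPk, -, hNl, hPN⟩ := mem_vecs.1 (hF hv)
  simp only at hPk hNl hPN
  obtain ⟨Z, hZc, hZd, hZ⟩ := exists_initial (P ∪ N) (k - l)
  rw [disjoint_union_right] at hZd
  have hPX : Disjoint P (N ∪ Z) := disjoint_union_right.2 ⟨hPN, hZd.1.symm⟩
  have hXc : #(N ∪ Z) = k := by
    rw [card_union_of_disjoint hZd.2.symm, hNl, hZc]
    omega
  have hsplit : ∀ (s : Finset ℕ) y, #(s.filter (· < y)) + #(s.filter (y ≤ ·)) = #s := by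
    intro s y
    simpa only [not_lt] using card_filter_add_card_filter_not (s := s) (· < y)
  obtain ⟨f, hf, hfX⟩ := exists_matching hPX (fun y => by
    have hP := hsplit P y
    have hN := hsplit N y
    have hAy := hA y
    have hBy := hB y
    rcases hZ y with h | h
    · rw [filter_union, card_union_of_disjoint (disjoint_filter_filter hZd.2.symm),
        filter_true_of_mem fun x hx => mem_range.1 (h hx)]
      omega
    · have h1 : range y \ P.filter (· < y) ⊆ (N ∪ Z).filter (· < y) := by
        intro x hx
        have := @h x
        grind
      have h2 := card_le_card h1
      rw [card_sdiff_of_subset fun x hx => mem_range.2 (mem_filter.1 hx).2, card_range] at h2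
      omega)
  have hmem := hS.shift_mem hF hv hPX hf hfX Subset.rfl
  have himg : P.image f = N ∪ Z := by
    refine eq_of_subset_of_card_le (image_subset_iff.2 fun p hp => (hfX p hp).1) ?_
    rw [hXc, card_image_of_injOn hf, hPk]
  rw [sdiff_self, himg] at hmem
  refine ha _ hv _ hmem ⟨?_, ?_, ?_⟩
  · simpa using hPX
  · simp
  · intro x hx
    grind

/-- A set with more than half of the elements of an initial segment contains `0` or one of the
pairs `{2j+1, 2j+2}`. -/
lemma exists_pair_of_dense {P : Finset ℕ} {m : ℕ} (h : m < 2 * #(P.filter (· < m))) :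
    0 ∈ P ∨ ∃ j, j + 1 < #P ∧ 2 * j + 1 ∈ P ∧ 2 * j + 2 ∈ P := by
  by_contra! hc
  obtain ⟨h0, hj⟩ := hc
  have hle : #(P.filter (· < m)) ≤ #P := card_le_card (filter_subset _ _)
  have hinj : Set.InjOn (fun x => (x - 1) / 2) (P.filter (· < m)) := by
    have key : ∀ x ∈ P.filter (· < m), ∀ y ∈ P.filter (· < m), x < y →
        (x - 1) / 2 = (y - 1) / 2 → False := by
      intro x hx y hy hxy e
      rw [mem_filter] at hx hy
      have hx0 : x ≠ 0 := fun e => h0 (e ▸ hx.1)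
      have ex : x = 2 * ((x - 1) / 2) + 1 := by omega
      have ey : y = 2 * ((x - 1) / 2) + 2 := by omega
      exact hj _ (by omega) (ex ▸ hx.1) (ey ▸ hy.1)
    intro x hx y hy e
    rcases lt_trichotomy x y with hxy | hxy | hxy
    · exact (key x hx y hy hxy e).elim
    · exact hxy
    · exact (key y hy x hx hxy e.symm).elim
  have := card_le_card_of_injOn (t := range (m / 2)) _ (fun x hx => by
    have hx' := mem_filter.1 hx
    have hx0 : x ≠ 0 := fun e => h0 (e ▸ hx'.1)
    simp only [coe_range, Set.mem_Iio]
    omega) hinj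
  rw [card_range] at this
  omega

/-- A double count between pairs `b` and the pairs `a` obtained from `b` by exchanging its two
entries, after moving `d` elements from `b.1 ∩ Y`, among them those of `E`, to positions in `Y`
outside of `b.1 ∪ b.2`. -/
lemma card_mul_le_card_mul_of_exchange {B M : Finset (Finset ℕ × Finset ℕ)} {Y E : Finset ℕ}
    {q l d : ℕ} (hEY : E ⊆ Y) (hEd : #E ≤ d)
    (hB : ∀ b ∈ B, Disjoint b.1 b.2 ∧ #(b.1 ∩ Y) = q + d ∧ #(b.2 ∩ Y) = l ∧ E ⊆ b.1)
    (hM : ∀ a ∈ M, Disjoint a.1 a.2 ∧ #(a.1 ∩ Y) = l + d ∧ #(a.2 ∩ Y) = q)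
    (hBM : ∀ b ∈ B, ∀ R' ⊆ b.1 ∩ Y, ∀ R ⊆ Y \ (b.1 ∪ b.2), #R' = d → #R = d → E ⊆ R' →
      (b.2 ∪ R, b.1 \ R') ∈ M) :
    #B * ((q + d - #E).choose (d - #E) * (#Y - (q + d + l)).choose d) ≤
      #M * ((l + d).choose l * (#Y - (q + d + l) - #E).choose (d - #E)) := by
  have hout : ∀ (v : Finset ℕ × Finset ℕ) (a b : ℕ), Disjoint v.1 v.2 → #(v.1 ∩ Y) = a →
      #(v.2 ∩ Y) = b → #(Y \ (v.1 ∪ v.2)) = #Y - (a + b) := by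
    rintro v a b hd rfl rfl
    rw [card_sdiff, union_inter_distrib_right, card_union_of_disjoint
      (hd.mono inter_subset_left inter_subset_left)]
  set D : Finset (Σ _ : Finset ℕ × Finset ℕ, Finset ℕ × Finset ℕ) := B.sigma fun b =>
    ((b.1 ∩ Y) \ E).powersetCard (d - #E) ×ˢ (Y \ (b.1 ∪ b.2)).powersetCard d with hD
  set C : Finset (Σ _ : Finset ℕ × Finset ℕ, Finset ℕ × Finset ℕ) :=
    (M.filter fun a => E ⊆ Y \ (a.1 ∪ a.2)).sigma fun a =>
      (a.1 ∩ Y).powersetCard l ×ˢ ((Y \ (a.1 ∪ a.2)) \ E).powersetCard (d - #E) with hC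
  have hDc : #D = #B * ((q + d - #E).choose (d - #E) * (#Y - (q + d + l)).choose d) := by
    rw [hD, card_sigma]
    refine sum_const_nat fun b hb => ?_
    obtain ⟨hd, h1, h2, hE⟩ := hB b hb
    rw [card_product, card_powersetCard, card_powersetCard, hout b _ _ hd h1 h2,
      card_sdiff_of_subset (subset_inter hE hEY), h1]
  have hCc : #C ≤ #M * ((l + d).choose l * (#Y - (q + d + l) - #E).choose (d - #E)) := by
    rw [hC, card_sigma, sum_const_nat
      (m := (l + d).choose l * (#Y - (q + d + l) - #E).choose (d - #E))]
    · exact Nat.mul_le_mul_right _ (card_filter_le _ _)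
    · intro a ha
      obtain ⟨ha, hE⟩ := mem_filter.1 ha
      obtain ⟨hd, h1, h2⟩ := hM a ha
      rw [card_product, card_powersetCard, card_powersetCard, card_sdiff_of_subset hE,
        hout a _ _ hd h1 h2, h1, show q + d + l = l + d + q by ring]
  rw [← hDc]
  refine le_trans ?_ hCc
  have hR : ∀ x ∈ D, x.1 ∈ B ∧ x.2.1 ⊆ x.1.1 ∩ Y ∧ Disjoint x.2.1 E ∧ #x.2.1 = d - #E ∧
      x.2.2 ⊆ Y ∧ Disjoint x.2.2 (x.1.1 ∪ x.1.2) ∧ #x.2.2 = d := by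
    rintro ⟨b, T, R⟩ hx
    simp only [hD, mem_sigma, mem_product, mem_powersetCard, subset_sdiff] at hx
    tauto
  refine card_le_card_of_injOn
    (fun x => ⟨(x.1.2 ∪ x.2.2, x.1.1 \ (E ∪ x.2.1)), (x.1.2 ∩ Y, x.2.1)⟩) ?_ ?_
  · rintro ⟨b, T, R⟩ hx
    obtain ⟨hb, hT, hTE, hTc, hRY, hRb, hRc⟩ := hR _ hx
    obtain ⟨hd, h1, h2, hE⟩ := hB b hb
    simp only at hT hTE hTc hRY hRb hRc
    have hmem := hBM b hb (E ∪ T) (union_subset (subset_inter hE hEY) hT) R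
      (subset_sdiff.2 ⟨hRY, hRb⟩) (by rw [card_union_of_disjoint hTE.symm]; omega) hRc
      subset_union_left
    rw [Finset.disjoint_left] at hd hRb hTE
    simp only [hC, mem_coe, mem_sigma, mem_filter, mem_product, mem_powersetCard]
    refine ⟨⟨hmem, fun x hx => ?_⟩, ⟨?_, h2⟩, fun x hx => ?_, hTc⟩
    · have := hE hx
      grind
    · exact inter_subset_inter_right subset_union_left
    · have := hT hx
      grind
  · rintro ⟨b, T, R⟩ hx ⟨b', T', R'⟩ hx' e
    obtain ⟨hb, hT, -, -, hRY, hRb, -⟩ := hR _ hx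
    obtain ⟨hb', hT', -, -, hRY', hRb', -⟩ := hR _ hx'
    have hE := (hB b hb).2.2.2
    have hE' := (hB b' hb').2.2.2
    simp only [Sigma.mk.injEq, Prod.mk.injEq, heq_eq_eq] at e hT hT' hRY hRY' hRb hRb' hE hE'
    obtain ⟨⟨e1, e2⟩, e3, rfl⟩ := e
    rw [Finset.disjoint_left] at hRb hRb'
    have hb1 : b.1 = b'.1 := by
      have : ∀ P : Finset ℕ, E ⊆ P → T ⊆ P ∩ Y → P = P \ (E ∪ T) ∪ (E ∪ T) := fun P h h' =>
        (sdiff_union_of_subset (union_subset h (h'.trans inter_subset_left))).symm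
      rw [this _ hE hT, e2, ← this _ hE' hT']
    have hb2 : b.2 = b'.2 := by
      ext x
      have h1 := Finset.ext_iff.1 e1 x
      have h2 := Finset.ext_iff.1 e3 x
      have h3 := @hRY x
      have h4 := @hRY' x
      grind
    have hRR : R = R' := by
      ext x
      have h1 := Finset.ext_iff.1 e1 x
      rw [hb2] at h1 hRb
      have h3 := @hRb x
      have h4 := @hRb' x
      grind
    rw [Prod.ext hb1 hb2, hRR]

/-- The members of `F` with a `1` at position `n`, restricted to `range n`. -/
def posLink (F : Finset (Finset ℕ × Finset ℕ)) (n k l : ℕ) : Finset (Finset ℕ × Finset ℕ) :=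
  (vecs n (k - 1) l).filter fun b => (insert n b.1, b.2) ∈ F

/-- The pairs for which the extension by a `-1` at position `n` is missing in `F`. -/
def negMiss (F : Finset (Finset ℕ × Finset ℕ)) (n k l : ℕ) : Finset (Finset ℕ × Finset ℕ) :=
  (vecs n k (l - 1)).filter fun a => (a.1, insert n a.2) ∉ F

lemma card_add_card_negMiss_le {n k l : ℕ} {F : Finset (Finset ℕ × Finset ℕ)}
    (hF : F ⊆ vecs (n + 1) k l) :
    #F + #(negMiss F n k l) ≤ #(F ∩ vecs n k l) + #(vecs n k (l - 1)) + #(posLink F n k l) := by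
  set A := (vecs n k (l - 1)).filter fun a => (a.1, insert n a.2) ∈ F with hA
  have h1 : #A + #(negMiss F n k l) = #(vecs n k (l - 1)) :=
    card_filter_add_card_filter_not _
  have hsub : F ⊆ (F ∩ vecs n k l) ∪ A.image (fun a => (a.1, insert n a.2)) ∪
      (posLink F n k l).image (fun b => (insert n b.1, b.2)) := by
    rintro ⟨P, N⟩ hv
    obtain ⟨hP, hPc, hN, hNc, hd⟩ := mem_vecs.1 (hF hv)
    simp only at hP hPc hN hNc hd
    rw [range_add_one] at hP hN
    have hd' := Finset.disjoint_left.1 hd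
    by_cases hnP : n ∈ P
    · refine mem_union_right _ (mem_image.2 ⟨(P.erase n, N), mem_filter.2 ⟨mem_vecs.2 ⟨?_, ?_, ?_,
        hNc, ?_⟩, ?_⟩, ?_⟩)
      · exact (erase_subset_erase n hP).trans (erase_insert_subset _ _)
      · simp only [card_erase_of_mem hnP, hPc]
      · exact (subset_insert_iff_of_notMem (hd' hnP)).1 hN
      · exact hd.mono_left (erase_subset _ _)
      · simpa [insert_erase hnP] using hv
      · simp [insert_erase hnP]
    have hP' := (subset_insert_iff_of_notMem hnP).1 hP
    by_cases hnN : n ∈ N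
    · refine mem_union_left _ (mem_union_right _ (mem_image.2 ⟨(P, N.erase n),
        mem_filter.2 ⟨mem_vecs.2 ⟨hP', hPc, ?_, ?_, ?_⟩, ?_⟩, ?_⟩))
      · exact (erase_subset_erase n hN).trans (erase_insert_subset _ _)
      · simp only [card_erase_of_mem hnN, hNc]
      · exact hd.mono_right (erase_subset _ _)
      · simpa [insert_erase hnN] using hv
      · simp [insert_erase hnN]
    · exact mem_union_left _ (mem_union_left _ (mem_inter.2 ⟨hv, mem_vecs.2
        ⟨hP', hPc, (subset_insert_iff_of_notMem hnN).1 hN, hNc, hd⟩⟩))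
  have h2 := (card_le_card hsub).trans ((card_union_le _ _).trans
    (add_le_add (card_union_le _ _) le_rfl))
  have h3 : #(A.image fun a => (a.1, insert n a.2)) ≤ #A := card_image_le
  have h4 : #((posLink F n k l).image fun b => (insert n b.1, b.2)) ≤ #(posLink F n k l) :=
    card_image_le
  omega

lemma exchange_mem_negMiss {n k l : ℕ} (hl : 1 ≤ l) (hlk : l ≤ k)
    {F : Finset (Finset ℕ × Finset ℕ)} (ha : AntiFree F) {b : Finset ℕ × Finset ℕ}
    (hb : b ∈ posLink F n k l) {R R' : Finset ℕ} (hR' : R' ⊆ b.1)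
    (hR : R ⊆ range n \ (b.1 ∪ b.2)) (hR'c : #R' = k - l) (hRc : #R = k - l) :
    (b.2 ∪ R, b.1 \ R') ∈ negMiss F n k l := by
  obtain ⟨hb, hbF⟩ := mem_filter.1 hb
  obtain ⟨hP, hPc, hN, hNc, hd⟩ := mem_vecs.1 hb
  rw [subset_sdiff, disjoint_union_right] at hR
  obtain ⟨hRn, hRP, hRN⟩ := hR
  have hn : n ∉ b.2 ∪ R := fun h => absurd (union_subset hN hRn h) notMem_range_self
  refine mem_filter.2 ⟨mem_vecs.2 ⟨union_subset hN hRn, ?_, sdiff_subset.trans hP, ?_, ?_⟩, ?_⟩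
  · simp only [card_union_of_disjoint hRN.symm, hNc, hRc]
    omega
  · simp only [card_sdiff_of_subset hR', hPc, hR'c]
    omega
  · exact (disjoint_union_left.2 ⟨hd.symm, hRP⟩).mono_right sdiff_subset
  · refine fun h => ha _ hbF _ h ⟨?_, subset_union_left, ?_⟩
    · exact disjoint_insert_left.2 ⟨hn, disjoint_union_right.2 ⟨hd, hRP.symm⟩⟩
    · exact insert_subset_insert _ sdiff_subset

lemma card_posLink_filter_subset {n k l : ℕ} (hl : 1 ≤ l) (hlk : l ≤ k)
    {F : Finset (Finset ℕ × Finset ℕ)} (ha : AntiFree F) {E : Finset ℕ} (hE : E ⊆ range n)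
    (hEd : #E ≤ k - l) :
    #((posLink F n k l).filter (E ⊆ ·.1)) *
        ((k - 1 - #E).choose (k - l - #E) * (n - (k + l - 1)).choose (k - l)) ≤
      #(negMiss F n k l) * (k.choose l * (n - (k + l - 1) - #E).choose (k - l - #E)) := by
  have hq : l - 1 + (k - l) = k - 1 := by omega
  have := card_mul_le_card_mul_of_exchange (B := (posLink F n k l).filter (E ⊆ ·.1))
    (M := negMiss F n k l) (q := l - 1) (l := l) hE hEd ?_ ?_ ?_
  · rwa [hq, card_range, show k - 1 + l = k + l - 1 by omega,
      show l + (k - l) = k by omega] at this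
  · intro b hb
    obtain ⟨hb, hbE⟩ := mem_filter.1 hb
    obtain ⟨hP, hPc, hN, hNc, hd⟩ := mem_vecs.1 (mem_filter.1 hb).1
    rw [inter_eq_left.2 hP, inter_eq_left.2 hN, hq]
    exact ⟨hd, hPc, hNc, hbE⟩
  · intro a ha
    obtain ⟨hP, hPc, hN, hNc, hd⟩ := mem_vecs.1 (mem_filter.1 ha).1
    rw [inter_eq_left.2 hP, inter_eq_left.2 hN]
    exact ⟨hd, by omega, hNc⟩
  · intro b hb R' hR' R hR hR'c hRc _
    exact exchange_mem_negMiss hl hlk ha (mem_filter.1 hb).1 (hR'.trans inter_subset_left) hR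
      hR'c hRc

lemma mul_le_of_mul_choose_le {L D w b m : ℕ} (hDw : D ≤ w)
    (h : b * ((L + D + 1).choose (D + 1) * (w + 2).choose (D + 2)) ≤
      m * ((L + D + 3).choose (L + 1) * (w + 1).choose (D + 1))) :
    b * ((L + 1) * (w + 2)) ≤ m * ((L + D + 3) * (L + D + 2)) := by
  have h1 := Nat.add_one_mul_choose_eq (L + D + 2) (D + 1)
  have h2 := Nat.choose_mul_succ_eq (L + D + 1) (D + 1)
  have h3 := Nat.add_one_mul_choose_eq (w + 1) (D + 1)
  rw [show L + D + 1 + 1 - (D + 1) = L + 1 by omega] at h2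
  rw [Nat.choose_symm_of_eq_add (show L + D + 3 = L + 1 + (D + 2) by ring)] at h
  simp only [Nat.add_assoc, Nat.reduceAdd] at h1 h2 h3 h ⊢
  have hp : 0 < (D + 2) * ((L + (D + 1)).choose (D + 1) * (w + 2).choose (D + 2)) :=
    Nat.mul_pos (by omega)
      (Nat.mul_pos (Nat.choose_pos (by omega)) (Nat.choose_pos (by omega)))
  refine Nat.le_of_mul_le_mul_right ?_ hp
  have := Nat.mul_le_mul_right ((D + 2) * (L + 1) * (w + 2)) h
  refine (Eq.trans_le ?_ this).trans_eq ?_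
  · ring
  · zify at h1 h2 h3 ⊢
    linear_combination (-m * (L + 1) * (w + 2) * (w + 1).choose (D + 1) : ℤ) * h1 -
      (m * (L + D + 3) * (w + 2) * (w + 1).choose (D + 1) : ℤ) * h2 +
      (m * (L + D + 3) * (L + D + 2) * (L + (D + 1)).choose (D + 1) : ℤ) * h3

lemma mul_le_of_mul_choose_le' {L D w b m : ℕ} (hDw : D ≤ w)
    (h : b * ((L + D).choose D * (w + 2).choose (D + 2)) ≤
      m * ((L + D + 3).choose (L + 1) * w.choose D)) :
    b * ((L + 1) * ((w + 2) * (w + 1))) ≤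
      m * ((L + D + 3) * (L + D + 2) * (L + D + 1)) := by
  have h1 := Nat.add_one_mul_choose_eq (L + D + 2) (D + 1)
  have h1' := Nat.add_one_mul_choose_eq (L + D + 1) D
  have h2 := Nat.choose_mul_succ_eq (L + D) D
  have h3 := Nat.add_one_mul_choose_eq (w + 1) (D + 1)
  have h3' := Nat.add_one_mul_choose_eq w D
  rw [show L + D + 1 - D = L + 1 by omega] at h2
  rw [Nat.choose_symm_of_eq_add (show L + D + 3 = L + 1 + (D + 2) by ring)] at h
  simp only [Nat.add_assoc, Nat.reduceAdd] at h1 h2 h3 h1' h3' h ⊢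
  have hp : 0 < (D + 2) * (D + 1) * ((L + D).choose D * (w + 2).choose (D + 2)) :=
    Nat.mul_pos (by positivity)
      (Nat.mul_pos (Nat.choose_pos (by omega)) (Nat.choose_pos (by omega)))
  refine Nat.le_of_mul_le_mul_right ?_ hp
  have := Nat.mul_le_mul_right ((D + 2) * (D + 1) * (L + 1) * ((w + 2) * (w + 1))) h
  refine (Eq.trans_le ?_ this).trans_eq ?_
  · ring
  · have e1 : (D + 2) * (D + 1) * (L + 1) * (L + (D + 3)).choose (D + 2) =
        (L + D + 3) * (L + D + 2) * (L + D + 1) * (L + D).choose D := by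
      zify at h1 h1' h2 ⊢
      linear_combination (-(D + 1) * (L + 1) : ℤ) * h1 - ((L + 1) * (L + D + 3) : ℤ) * h1' -
        ((L + D + 2) * (L + D + 3) : ℤ) * h2
    have e2 : (w + 2) * (w + 1) * w.choose D =
        (D + 2) * (D + 1) * (w + 2).choose (D + 2) := by
      zify at h3 h3' ⊢
      linear_combination (D + 1 : ℤ) * h3 + (w + 2 : ℤ) * h3'
    zify at e1 e2 ⊢
    linear_combination (m * (w + 2) * (w + 1) * w.choose D : ℤ) * e1 +
      (m * (L + D + 3) * (L + D + 2) * (L + D + 1) * (L + D).choose D : ℤ) * e2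

lemma card_posLink_filter_subset_le {n k l : ℕ} (hl : 1 ≤ l) (hlk : l + 1 < k) (hn : 3 * k ≤ n)
    {F : Finset (Finset ℕ × Finset ℕ)} (ha : AntiFree F) {E : Finset ℕ} (hE : E ⊆ range n) :
    (#E = 1 → #((posLink F n k l).filter (E ⊆ ·.1)) * (l * (n - (k + l - 1))) ≤
      #(negMiss F n k l) * (k * (k - 1))) ∧
    (#E = 2 → #((posLink F n k l).filter (E ⊆ ·.1)) *
        (l * ((n - (k + l - 1)) * (n - (k + l - 1) - 1))) ≤
      #(negMiss F n k l) * (k * (k - 1) * (k - 2))) := by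
  obtain ⟨L, rfl⟩ : ∃ L, l = L + 1 := ⟨l - 1, by omega⟩
  obtain ⟨D, rfl⟩ : ∃ D, k = L + D + 3 := ⟨k - L - 3, by omega⟩
  obtain ⟨w, hw⟩ : ∃ w, n - (L + D + 3 + (L + 1) - 1) = w + 2 :=
    ⟨n - (L + D + 3 + (L + 1) - 1) - 2, by omega⟩
  have := card_posLink_filter_subset hl (by omega) ha hE (k := L + D + 3)
  rw [show L + D + 3 - (L + 1) = D + 2 by omega, hw] at this
  rw [hw]
  constructor <;> intro hEc <;> rw [hEc] at this
  · exact mul_le_of_mul_choose_le (by omega) (this (by omega))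
  · exact mul_le_of_mul_choose_le' (by omega) (this (by omega))

/-- `t` is the last position from which on `v` has two elements more than `u`, and `u` has `j`
elements there. -/
def Overtakes (t j : ℕ) (u v : Finset ℕ) : Prop :=
  #(u.filter (t ≤ ·)) = j ∧ #(v.filter (t ≤ ·)) = j + 2 ∧
    ∀ t', t < t' → #(v.filter (t' ≤ ·)) ≤ #(u.filter (t' ≤ ·)) + 1

lemma exists_overtakes {n t : ℕ} {u v : Finset ℕ} (hv : v ⊆ range n)
    (h : #(u.filter (t ≤ ·)) + 2 ≤ #(v.filter (t ≤ ·))) :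
    ∃ t < n, ∃ j, Overtakes t j u v := by
  have hlt : ∀ t, #(u.filter (t ≤ ·)) + 2 ≤ #(v.filter (t ≤ ·)) → t < n := by
    intro t ht
    obtain ⟨x, hx⟩ := card_pos.1 (show 0 < #(v.filter (t ≤ ·)) by omega)
    rw [mem_filter] at hx
    exact hx.2.trans_lt (mem_range.1 (hv hx.1))
  have hspec := Nat.findGreatest_spec
    (P := fun t => #(u.filter (t ≤ ·)) + 2 ≤ #(v.filter (t ≤ ·))) (hlt t h).le h
  have hmax := fun t' => Nat.findGreatest_is_greatest (k := t') (n := n)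
    (P := fun t => #(u.filter (t ≤ ·)) + 2 ≤ #(v.filter (t ≤ ·)))
  set s := Nat.findGreatest (fun t => #(u.filter (t ≤ ·)) + 2 ≤ #(v.filter (t ≤ ·))) n
  have hlast : ∀ t', s < t' → #(v.filter (t' ≤ ·)) ≤ #(u.filter (t' ≤ ·)) + 1 := by
    intro t' ht'
    by_contra hc
    exact hmax t' ht' (hlt t' (by omega)).le (by omega)
  refine ⟨s, hlt s hspec, #(u.filter (s ≤ ·)), rfl, le_antisymm ?_ hspec, hlast⟩
  have h1 : #(v.filter (s ≤ ·)) ≤ #(v.filter (s + 1 ≤ ·)) + 1 := by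
    refine (card_le_card (t := insert s (v.filter (s + 1 ≤ ·))) ?_).trans (card_insert_le _ _)
    intro x hx
    rw [mem_filter] at hx
    rw [mem_insert, mem_filter]
    have := hx.2
    by_cases e : x = s
    · exact .inl e
    · exact .inr ⟨hx.1, by omega⟩
  have h2 : #(u.filter (s + 1 ≤ ·)) ≤ #(u.filter (s ≤ ·)) :=
    card_le_card (monotone_filter_right _ fun x _ hx => by omega)
  have := hlast (s + 1) (Nat.lt_succ_self s)
  omega

lemma Overtakes.unique {t j t' j' : ℕ} {u v : Finset ℕ} (h : Overtakes t j u v)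
    (h' : Overtakes t' j' u v) : t = t' ∧ j = j' := by
  obtain ⟨h1, h2, h3⟩ := h
  obtain ⟨h1', h2', h3'⟩ := h'
  rcases lt_trichotomy t t' with ht | rfl | ht
  · have := h3 _ ht
    omega
  · exact ⟨rfl, h1.symm.trans h1'⟩
  · have := h3' _ ht
    omega

lemma card_inter_range_add (s : Finset ℕ) (t : ℕ) :
    #(s ∩ range t) + #(s.filter (t ≤ ·)) = #s := by
  rw [← card_filter_add_card_filter_not (s := s) (· < t)]
  simp only [not_lt]
  congr 2
  ext x
  simp

open scoped Classical in
lemma card_overtaken_le {n k l t j : ℕ} (hl : 1 ≤ l) (hlk : l ≤ k)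
    {F : Finset (Finset ℕ × Finset ℕ)} (ha : AntiFree F) {B : Finset (Finset ℕ × Finset ℕ)}
    (hB : B ⊆ posLink F n k l) (hsparse : ∀ b ∈ B, ∀ m, 2 * #(b.1 ∩ range m) ≤ m)
    (ht : t < n) :
    (k - 1) * #(B.filter fun b => Overtakes t j b.1 b.2) ≤
      (l - 1) * #((negMiss F n k l).filter fun a => Overtakes t j a.2 a.1) := by
  rcases (B.filter fun b => Overtakes t j b.1 b.2).eq_empty_or_nonempty with h0 | ⟨b₀, hb₀⟩
  · simp [h0]
  have hBc : ∀ b ∈ B, Overtakes t j b.1 b.2 → Disjoint b.1 b.2 ∧ j + 2 ≤ l ∧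
      #(b.1 ∩ range t) = k - 1 - j ∧ #(b.2 ∩ range t) = l - (j + 2) := by
    intro b hb ho
    obtain ⟨hP, hPc, hN, hNc, hd⟩ := mem_vecs.1 (mem_filter.1 (hB hb)).1
    have h1 := card_inter_range_add b.1 t
    have h2 := card_inter_range_add b.2 t
    rw [ho.1] at h1
    rw [ho.2.1] at h2
    exact ⟨hd, by omega, by omega, by omega⟩
  obtain ⟨hb₀, ho₀⟩ := mem_filter.1 hb₀
  obtain ⟨-, hjl, hc₀, -⟩ := hBc b₀ hb₀ ho₀
  have hs₀ := hsparse b₀ hb₀ t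
  obtain ⟨i, rfl⟩ : ∃ i, l = j + 2 + i := ⟨l - (j + 2), by omega⟩
  obtain ⟨d, rfl⟩ : ∃ d, k = j + 2 + i + d := ⟨k - (j + 2 + i), by omega⟩
  have key := card_mul_le_card_mul_of_exchange (B := B.filter fun b => Overtakes t j b.1 b.2)
    (M := (negMiss F n (j + 2 + i + d) (j + 2 + i)).filter fun a => Overtakes t j a.2 a.1)
    (Y := range t) (E := ∅) (q := i + 1) (l := i) (d := d) (by simp) (by simp) ?_ ?_ ?_
  · simp only [card_empty, Nat.sub_zero, card_range] at key
    have hpos : 0 < (t - (i + 1 + d + i)).choose d := Nat.choose_pos (by omega)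
    rw [← mul_assoc, ← mul_assoc] at key
    have key := Nat.le_of_mul_le_mul_right key hpos
    generalize #(B.filter fun b => Overtakes t j b.1 b.2) = x at key ⊢
    generalize #((negMiss F n (j + 2 + i + d) (j + 2 + i)).filter
      fun a => Overtakes t j a.2 a.1) = y at key ⊢
    have h1 := Nat.choose_mul_succ_eq (i + d) d
    rw [show i + d + 1 - d = i + 1 by omega] at h1
    rw [Nat.choose_symm_of_eq_add (show i + d = i + d from rfl),
      show i + 1 + d = i + d + 1 by ring] at key
    have h2 : x * (i + d + 1) ≤ y * (i + 1) := by
      refine Nat.le_of_mul_le_mul_right ?_ (Nat.choose_pos (show d ≤ i + d by omega))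
      calc x * (i + d + 1) * (i + d).choose d = x * (i + d + 1).choose d * (i + 1) := by
            rw [mul_assoc, mul_assoc, ← h1]
            ring
        _ ≤ y * (i + d).choose d * (i + 1) := Nat.mul_le_mul_right _ key
        _ = _ := by ring
    have h3 : x ≤ y := by
      by_contra! hc
      nlinarith
    rw [show j + 2 + i + d - 1 = (i + d + 1) + j by omega,
      show j + 2 + i - 1 = i + 1 + j by omega]
    nlinarith
  · intro b hb
    obtain ⟨hb, ho⟩ := mem_filter.1 hb
    obtain ⟨hd, -, h1, h2⟩ := hBc b hb ho
    exact ⟨hd, by omega, by omega, by simp⟩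
  · intro a ha
    obtain ⟨ha, ho⟩ := mem_filter.1 ha
    obtain ⟨hP, hPc, hN, hNc, hd⟩ := mem_vecs.1 (mem_filter.1 ha).1
    have h1 := card_inter_range_add a.1 t
    have h2 := card_inter_range_add a.2 t
    rw [ho.2.1] at h1
    rw [ho.1] at h2
    exact ⟨hd, by omega, by omega⟩
  · intro b hb R' hR' R hR hR'c hRc _
    obtain ⟨hb, ho⟩ := mem_filter.1 hb
    refine mem_filter.2 ⟨exchange_mem_negMiss hl hlk ha (hB hb) (hR'.trans inter_subset_left)
      (hR.trans (sdiff_subset_sdiff (range_mono ht.le) Subset.rfl)) (by omega) (by omega), ?_⟩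
    have e1 : ∀ t', t ≤ t' → (b.1 \ R').filter (t' ≤ ·) = b.1.filter (t' ≤ ·) := by
      intro t' ht'
      ext x
      have := @hR' x
      grind
    have e2 : ∀ t', t ≤ t' → (b.2 ∪ R).filter (t' ≤ ·) = b.2.filter (t' ≤ ·) := by
      intro t' ht'
      ext x
      have := @hR x
      grind
    refine ⟨?_, ?_, fun t' ht' => ?_⟩
    · rw [e1 t le_rfl, ho.1]
    · rw [e2 t le_rfl, ho.2.1]
    · rw [e1 t' ht'.le, e2 t' ht'.le]
      exact ho.2.2 t' ht'

lemma card_sparse_le {n k l : ℕ} (hl : 1 ≤ l) (hlk : l ≤ k)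
    {F : Finset (Finset ℕ × Finset ℕ)} (ha : AntiFree F) {B : Finset (Finset ℕ × Finset ℕ)}
    (hB : B ⊆ posLink F n k l) (hsparse : ∀ b ∈ B, ∀ m, 2 * #(b.1 ∩ range m) ≤ m)
    (hover : ∀ b ∈ B, ∃ t, #(b.1.filter (t ≤ ·)) + 2 ≤ #(b.2.filter (t ≤ ·))) :
    (k - 1) * #B ≤ (l - 1) * #(negMiss F n k l) := by
  classical
  have hcover : B ⊆ (range n ×ˢ range l).biUnion fun i =>
      B.filter fun b => Overtakes i.1 i.2 b.1 b.2 := by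
    intro b hb
    obtain ⟨t, ht⟩ := hover b hb
    obtain ⟨-, -, hN, hNc, -⟩ := mem_vecs.1 (mem_filter.1 (hB hb)).1
    obtain ⟨s, hs, j, ho⟩ := exists_overtakes hN ht
    have h2 := card_inter_range_add b.2 s
    rw [ho.2.1] at h2
    simp only [mem_biUnion, mem_product, mem_range, mem_filter]
    exact ⟨(s, j), ⟨hs, by simp only; omega⟩, hb, ho⟩
  have hM : ∑ i ∈ range n ×ˢ range l,
      #((negMiss F n k l).filter fun a => Overtakes i.1 i.2 a.2 a.1) ≤ #(negMiss F n k l) := by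
    rw [← card_biUnion]
    · exact card_le_card (biUnion_subset.2 fun i _ => filter_subset _ _)
    · intro i _ i' _ hne
      refine Finset.disjoint_left.2 fun a h h' => ?_
      obtain ⟨e1, e2⟩ := (mem_filter.1 h).2.unique (mem_filter.1 h').2
      exact hne (Prod.ext e1 e2)
  calc (k - 1) * #B ≤ (k - 1) * ∑ i ∈ range n ×ˢ range l,
        #(B.filter fun b => Overtakes i.1 i.2 b.1 b.2) :=
        Nat.mul_le_mul_left _ ((card_le_card hcover).trans card_biUnion_le)
    _ ≤ (l - 1) * ∑ i ∈ range n ×ˢ range l,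
        #((negMiss F n k l).filter fun a => Overtakes i.1 i.2 a.2 a.1) := by
      rw [mul_sum, mul_sum]
      refine sum_le_sum fun i hi => card_overtaken_le hl hlk ha hB hsparse ?_
      exact mem_range.1 (mem_product.1 hi).1
    _ ≤ _ := Nat.mul_le_mul_left _ hM

lemma le_of_weighted_bounds {k l W x y z M : ℕ} (hl : 1 ≤ l) (hlk : l + 1 < k)
    (hW : 4 * k ^ 2 < W) (hx : (k - 1) * x ≤ (l - 1) * M)
    (hy : y * (l * W) ≤ M * (k * (k - 1)))
    (hz : z * (l * (W * (W - 1))) ≤ (k - 1) * (M * (k * (k - 1) * (k - 2)))) :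
    x + y + z ≤ M := by
  obtain ⟨a, rfl⟩ : ∃ a, l = a + 1 := ⟨l - 1, by omega⟩
  obtain ⟨c, rfl⟩ : ∃ c, k = a + c + 3 := ⟨k - a - 3, by omega⟩
  obtain ⟨V, rfl⟩ : ∃ V, W = V + 1 := ⟨W - 1, by omega⟩
  rw [show a + c + 3 - 1 = a + c + 2 by omega] at hx hy hz
  rw [show a + c + 3 - 2 = a + c + 1 by omega] at hz
  simp only [Nat.add_sub_cancel] at hx hz
  set q := a + c with hq
  have hV : 4 * (q + 3) ^ 2 ≤ V := by omega
  have hy' : 4 * (a + 1) * y ≤ M := by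
    refine Nat.le_of_mul_le_mul_right (?_ : _ ≤ M * ((q + 3) * (q + 2))) (by positivity)
    refine le_trans ?_ hy
    calc 4 * (a + 1) * y * ((q + 3) * (q + 2)) = y * ((a + 1) * (4 * ((q + 3) * (q + 2)))) := by
          ring
      _ ≤ _ := by
        gcongr
        nlinarith
  have hz' : 4 * (a + 1) * z ≤ M := by
    refine Nat.le_of_mul_le_mul_right
      (?_ : _ ≤ M * ((q + 2) * ((q + 3) * (q + 2) * (q + 1)))) (by positivity)
    refine le_trans ?_ (hz.trans_eq (by ring))
    calc 4 * (a + 1) * z * ((q + 2) * ((q + 3) * (q + 2) * (q + 1))) =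
          z * ((a + 1) * ((4 * ((q + 3) * (q + 2))) * ((q + 2) * (q + 1)))) := by ring
      _ ≤ _ := by
        gcongr
        · nlinarith
        · nlinarith
  have h1 : 2 * (a + 1) * (y + z) ≤ M := by linarith
  have h2 : 2 * (q + 2) * (y + z) ≤ (c + 2) * M := by
    calc 2 * (q + 2) * (y + z) ≤ (c + 2) * (2 * (a + 1) * (y + z)) := by
          rw [← mul_assoc]
          refine Nat.mul_le_mul_right _ ?_
          nlinarith [Nat.zero_le (a * c)]
      _ ≤ _ := Nat.mul_le_mul_left _ h1
  refine Nat.le_of_mul_le_mul_left (?_ : (q + 2) * _ ≤ (q + 2) * _) (by positivity)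
  nlinarith

lemma card_posLink_le_card_negMiss {n k l : ℕ} (hl : 1 ≤ l) (hlk : l + 1 < k)
    (hn : 5 * k ^ 2 ≤ n) {F : Finset (Finset ℕ × Finset ℕ)} (hF : F ⊆ vecs (n + 1) k l)
    (ha : AntiFree F) (hS : Stable (n + 1) F) : #(posLink F n k l) ≤ #(negMiss F n k l) := by
  have hkn : 3 * k ≤ n := by nlinarith
  set E : ℕ → Finset ℕ := fun j => {2 * j + 1, 2 * j + 2} with hE
  set B := (posLink F n k l).filter fun b => 0 ∉ b.1 ∧ ∀ j ∈ range (k - 1), ¬ E j ⊆ b.1 with hB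
  have hBP : ∀ b ∈ B, ∀ m, 2 * #((insert n b.1).filter (· < m)) ≤ m := by
    intro b hb m
    obtain ⟨hb, h0, hj⟩ := mem_filter.1 hb
    have hc := (mem_vecs.1 (hF (mem_filter.1 hb).2)).2.1
    by_contra! hm
    rcases exists_pair_of_dense hm with h | ⟨j, hjk, h1, h2⟩
    · exact h0 ((mem_insert.1 h).resolve_left (by omega))
    · rw [hc] at hjk
      refine hj j (mem_range.2 (by omega)) (insert_subset ?_ (singleton_subset_iff.2 ?_))
      · exact (mem_insert.1 h1).resolve_left (by omega)
      · exact (mem_insert.1 h2).resolve_left (by omega)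
  have hx : (k - 1) * #B ≤ (l - 1) * #(negMiss F n k l) := by
    refine card_sparse_le hl (by omega) ha (filter_subset _ _) (fun b hb m => ?_) fun b hb => ?_
    · refine le_trans (Nat.mul_le_mul_left 2 (card_le_card fun x hx => ?_)) (hBP b hb m)
      rw [mem_inter, mem_range] at hx
      exact mem_filter.2 ⟨mem_insert_of_mem hx.1, hx.2⟩
    · obtain ⟨hbv, hbF⟩ := mem_filter.1 (mem_filter.1 hb).1
      obtain ⟨hP, -, hN, -, -⟩ := mem_vecs.1 hbv
      rcases hS.unbalanced_or_dense (by omega) hF ha hbF with ⟨t, ht⟩ | ⟨m, hm⟩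
      · refine ⟨t, ?_⟩
        obtain ⟨x, hx⟩ := card_pos.1 (pos_of_gt ht)
        rw [mem_filter] at hx
        have htn := hx.2.trans_lt (mem_range.1 (hN hx.1))
        rw [filter_insert, if_pos htn.le, card_insert_of_notMem] at ht
        · exact ht
        · exact fun h => absurd (hP (mem_filter.1 h).1) notMem_range_self
      · exact absurd (hBP b hb m) (not_le.2 hm)
  have hy := (card_posLink_filter_subset_le (E := {0}) hl hlk hkn ha
    (singleton_subset_iff.2 (mem_range.2 (by omega)))).1 (card_singleton 0)
  have hz := sum_le_sum fun j (hj : j ∈ range (k - 1)) =>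
    (card_posLink_filter_subset_le (E := E j) hl hlk hkn ha (by
      rw [mem_range] at hj
      refine insert_subset ?_ (singleton_subset_iff.2 ?_) <;> rw [mem_range] <;> omega)).2
    (card_pair (by omega))
  rw [← sum_mul, sum_const, card_range, smul_eq_mul] at hz
  have hcover : posLink F n k l ⊆ B ∪ (posLink F n k l).filter ({0} ⊆ ·.1) ∪
      (range (k - 1)).biUnion fun j => (posLink F n k l).filter (E j ⊆ ·.1) := by
    intro b hb
    by_cases h0 : 0 ∈ b.1
    · exact mem_union_left _ (mem_union_right _
        (mem_filter.2 ⟨hb, singleton_subset_iff.2 h0⟩))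
    by_cases hj : ∃ j ∈ range (k - 1), E j ⊆ b.1
    · obtain ⟨j, hj, hE⟩ := hj
      exact mem_union_right _ (mem_biUnion.2 ⟨j, hj, mem_filter.2 ⟨hb, hE⟩⟩)
    · push Not at hj
      exact mem_union_left _ (mem_union_left _ (mem_filter.2 ⟨hb, h0, hj⟩))
  have hW : 4 * k ^ 2 < n - (k + l - 1) := by
    have : k + l - 1 < k ^ 2 := by
      have : 3 * k ≤ k ^ 2 := by nlinarith
      omega
    omega
  refine le_trans ?_ (le_of_weighted_bounds hl hlk hW hx hy hz)
  exact (card_le_card hcover).trans ((card_union_le _ _).trans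
    (add_le_add (card_union_le _ _) card_biUnion_le))

lemma gVal_succ_le {n k l : ℕ} (hl : 1 ≤ l) (hlk : l + 1 < k) (hn : 5 * k ^ 2 ≤ n) :
    gVal (n + 1) k l ≤ gVal n k l + #(vecs n k (l - 1)) := by
  obtain ⟨F₀, hF₀, ha₀, hc₀⟩ := exists_card_eq_gVal (n + 1) k l
  obtain ⟨F, hF, ha, hc, hS⟩ := exists_stable hF₀ ha₀
  have h1 := card_add_card_negMiss_le hF
  have h2 := card_posLink_le_card_negMiss hl hlk hn hF ha hS
  have h3 : #(F ∩ vecs n k l) ≤ gVal n k l := card_le_gVal inter_subset_right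
    fun v hv w hw => ha v (mem_inter.1 hv).1 w (mem_inter.1 hw).1
  omega

end SignedVec

/-- For integers `l ≥ 1`, `k > l + 1` and `n ≥ 5k²`,
one has `g(n+1,k,l) - g(n,k,l) = C(n,k+l-1)·C(k+l-1,l-1)`. -/
theorem stmt_5 (k l n : ℕ) (hl : 1 ≤ l) (hlk : l + 1 < k) (hn : 5 * k ^ 2 ≤ n) :
    gVal (n + 1) k l =
      gVal n k l + Nat.choose n (k + l - 1) * Nat.choose (k + l - 1) (l - 1) := by
  rw [Nat.add_sub_assoc hl, ← SignedVec.card_vecs]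
  exact le_antisymm (SignedVec.gVal_succ_le hl hlk hn) (SignedVec.gVal_succ_ge k l n hl)
end

section
/- For integers ℓ ≥ 1, k = ℓ+1 and n ≥ 2k³, one has g(n+1,k,ℓ) − g(n,k,ℓ) = C(n,k+ℓ−1)·C(k+ℓ−1,ℓ−1). -/
section Vectors

variable {n a b : ℕ} {v w : Fin n → ℤ}

open Classical in
/-- The finite set `V(n,a,b)`. -/
noncomputable def pmVecs (n a b : ℕ) : Finset (Fin n → ℤ) :=
  (Fintype.piFinset fun _ => ({0, 1, -1} : Finset ℤ)).filter (IsPMVec n a b)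

theorem mem_pmVecs : v ∈ pmVecs n a b ↔ IsPMVec n a b v := by
  simp only [pmVecs, Finset.mem_filter, Fintype.mem_piFinset, Finset.mem_insert,
    Finset.mem_singleton, and_iff_right_iff_imp]
  exact fun h => h.1

theorem card_pmVecs (n a b : ℕ) :
    (pmVecs n a b).card = n.choose (a + b) * (a + b).choose b := by
  classical
  have h : (((Finset.univ : Finset (Fin n)).powersetCard (a + b)).sigma
      fun U => U.powersetCard b).card = n.choose (a + b) * (a + b).choose b := by
    rw [Finset.card_sigma, Finset.sum_congr rfl (g := fun _ => (a + b).choose b)]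
    · simp
    · intro U hU
      rw [Finset.card_powersetCard, (Finset.mem_powersetCard.1 hU).2]
  rw [← h]
  refine Finset.card_nbij'
    (fun v => ⟨Finset.univ.filter fun i => v i ≠ 0, Finset.univ.filter fun i => v i = -1⟩)
    (fun p i => if i ∈ p.2 then -1 else if i ∈ p.1 then 1 else 0) ?_ ?_ ?_ ?_
  · intro v hv
    obtain ⟨h0, h1, h2⟩ := mem_pmVecs.1 (Finset.mem_coe.1 hv)
    have hU : (Finset.univ.filter fun i => v i ≠ 0) =
        (Finset.univ.filter fun i => v i = 1) ∪ (Finset.univ.filter fun i => v i = -1) := by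
      ext i
      have := h0 i
      simp only [Finset.mem_filter, Finset.mem_univ, true_and, Finset.mem_union]
      omega
    simp only [Finset.coe_sigma, Set.mem_sigma_iff, Finset.mem_coe, Finset.mem_powersetCard,
      Finset.subset_univ, true_and]
    refine ⟨?_, ?_, h2⟩
    · rw [hU, Finset.card_union_of_disjoint, h1, h2]
      rw [Finset.disjoint_filter]
      intro i _ hi
      omega
    · intro i
      simp only [Finset.mem_filter, Finset.mem_univ, true_and]
      omega
  · rintro ⟨U, M⟩ hp
    simp only [Finset.coe_sigma, Set.mem_sigma_iff, Finset.mem_coe, Finset.mem_powersetCard,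
      Finset.subset_univ, true_and] at hp
    obtain ⟨hU, hMU, hM⟩ := hp
    refine Finset.mem_coe.2 (mem_pmVecs.2 ⟨fun i => ?_, ?_, ?_⟩)
    · dsimp only
      split_ifs <;> simp
    · have : (Finset.univ.filter fun i => (if i ∈ M then (-1 : ℤ) else if i ∈ U then 1 else 0) = 1)
          = U \ M := by
        ext i
        simp only [Finset.mem_filter, Finset.mem_univ, true_and, Finset.mem_sdiff]
        split_ifs <;> simp_all
      rw [this, Finset.card_sdiff_of_subset hMU]
      omega
    · have : (Finset.univ.filter fun i => (if i ∈ M then (-1 : ℤ) else if i ∈ U then 1 else 0) = -1)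
          = M := by
        ext i
        simp only [Finset.mem_filter, Finset.mem_univ, true_and]
        split_ifs <;> simp_all
      rw [this, hM]
  · intro v hv
    obtain ⟨h0, -, -⟩ := mem_pmVecs.1 (Finset.mem_coe.1 hv)
    ext i
    have := h0 i
    simp only [Finset.mem_filter, Finset.mem_univ, true_and]
    split_ifs <;> omega
  · rintro ⟨U, M⟩ hp
    simp only [Finset.coe_sigma, Set.mem_sigma_iff, Finset.mem_coe, Finset.mem_powersetCard,
      Finset.subset_univ, true_and] at hp
    obtain ⟨hU, hMU, hM⟩ := hp
    have h1 : (Finset.univ.filter fun i => (if i ∈ M then (-1 : ℤ) else if i ∈ U then 1 else 0) ≠ 0)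
        = U := by
      ext i
      have := @hMU i
      simp only [Finset.mem_filter, Finset.mem_univ, true_and]
      split_ifs <;> simp_all
    have h2 : (Finset.univ.filter fun i => (if i ∈ M then (-1 : ℤ) else if i ∈ U then 1 else 0) = -1)
        = M := by
      ext i
      simp only [Finset.mem_filter, Finset.mem_univ, true_and]
      split_ifs <;> simp_all
    simp only [h1, h2]

theorem isPMVec_succ_zero {v : Fin (n + 1) → ℤ} (h : v (Fin.last n) = 0) :
    IsPMVec (n + 1) a b v ↔ IsPMVec n a b (Fin.init v) := by
  have hi : ∀ i, v (Fin.castSucc i) = Fin.init v i := fun _ => rfl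
  simp only [IsPMVec, Finset.card_filter, Fin.sum_univ_castSucc]
  simp [Fin.forall_fin_succ', h, hi]

theorem isPMVec_succ_neg {v : Fin (n + 1) → ℤ} (h : v (Fin.last n) = -1) :
    IsPMVec (n + 1) a (b + 1) v ↔ IsPMVec n a b (Fin.init v) := by
  have hi : ∀ i, v (Fin.castSucc i) = Fin.init v i := fun _ => rfl
  simp only [IsPMVec, Finset.card_filter, Fin.sum_univ_castSucc]
  simp [Fin.forall_fin_succ', h, hi]

theorem isPMVec_succ_pos {v : Fin (n + 1) → ℤ} (h : v (Fin.last n) = 1) :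
    IsPMVec (n + 1) (a + 1) b v ↔ IsPMVec n a b (Fin.init v) := by
  have hi : ∀ i, v (Fin.castSucc i) = Fin.init v i := fun _ => rfl
  simp only [IsPMVec, Finset.card_filter, Fin.sum_univ_castSucc]
  simp [Fin.forall_fin_succ', h, hi]

/-- Vectors with prescribed last coordinate `s` are counted by deleting that coordinate. -/
theorem card_filter_last {a' b' : ℕ} (s : ℤ)
    (h : ∀ v : Fin (n + 1) → ℤ, v (Fin.last n) = s →
      (IsPMVec (n + 1) a' b' v ↔ IsPMVec n a b (Fin.init v))) :
    ((pmVecs (n + 1) a' b').filter fun v => v (Fin.last n) = s).card =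
      n.choose (a + b) * (a + b).choose b := by
  rw [← card_pmVecs]
  refine Finset.card_nbij' (fun v => Fin.init v) (fun v => Fin.snoc (α := fun _ => ℤ) v s) ?_ ?_ ?_ ?_
  · intro v hv
    obtain ⟨h1, h2⟩ := Finset.mem_filter.1 (Finset.mem_coe.1 hv)
    exact Finset.mem_coe.2 (mem_pmVecs.2 ((h v h2).1 (mem_pmVecs.1 h1)))
  · intro v hv
    have hs : Fin.snoc (α := fun _ => ℤ) v s (Fin.last n) = s := by simp
    refine Finset.mem_coe.2 (Finset.mem_filter.2 ⟨mem_pmVecs.2 ((h _ hs).2 ?_), hs⟩)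
    rw [Fin.init_snoc]
    exact mem_pmVecs.1 (Finset.mem_coe.1 hv)
  · intro v hv
    obtain ⟨-, h2⟩ := Finset.mem_filter.1 (Finset.mem_coe.1 hv)
    subst h2
    exact Fin.snoc_init_self v
  · intro v _
    exact Fin.init_snoc _ _

theorem card_filter_last_neg (n a b : ℕ) :
    ((pmVecs (n + 1) a (b + 1)).filter fun v => v (Fin.last n) = -1).card =
      n.choose (a + b) * (a + b).choose b :=
  card_filter_last _ fun _ => isPMVec_succ_neg

theorem card_filter_last_pos (n a b : ℕ) :
    ((pmVecs (n + 1) (a + 1) b).filter fun v => v (Fin.last n) = 1).card =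
      n.choose (a + b) * (a + b).choose b :=
  card_filter_last _ fun _ => isPMVec_succ_pos

/-- Two vectors of `V(n,a,b)` that agree at `i₀` differ by a permutation fixing `i₀`. -/
theorem IsPMVec.exists_perm (hv : IsPMVec n a b v) (hw : IsPMVec n a b w) (i₀ : Fin n)
    (h : v i₀ = w i₀) : ∃ τ : Equiv.Perm (Fin n), τ i₀ = i₀ ∧ ∀ i, w (τ i) = v i := by
  classical
  have hz : ∀ {u : Fin n → ℤ}, IsPMVec n a b u →
      (Finset.univ.filter fun i => u i = 0).card + (a + b) = n := by
    rintro u ⟨h0, h1, h2⟩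
    have h3 := Finset.card_filter_add_card_filter_not (s := Finset.univ) (fun i => u i = 0)
    have h4 := Finset.card_filter_add_card_filter_not
      (s := Finset.univ.filter fun i => ¬ u i = 0) (fun i => u i = 1)
    rw [Finset.filter_filter, Finset.filter_filter] at h4
    have h5 : (Finset.univ.filter fun i => ¬ u i = 0 ∧ u i = 1) =
        Finset.univ.filter fun i => u i = 1 := by
      ext i; simp only [Finset.mem_filter, Finset.mem_univ, true_and]; omega
    have h6 : (Finset.univ.filter fun i => ¬ u i = 0 ∧ ¬ u i = 1) =
        Finset.univ.filter fun i => u i = -1 := by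
      ext i; have := h0 i; simp only [Finset.mem_filter, Finset.mem_univ, true_and]; omega
    rw [h5, h6, h1, h2] at h4
    rw [← h4] at h3
    simpa using h3
  have hc : ∀ c : ℤ, Nonempty ({i // v i = c} ≃ {i // w i = c}) := by
    intro c
    rw [← Fintype.card_eq, Fintype.card_subtype, Fintype.card_subtype]
    by_cases c0 : c = 0
    · have := hz hv
      have := hz hw
      subst c0
      omega
    by_cases c1 : c = 1
    · rw [c1, hv.2.1, hw.2.1]
    by_cases c2 : c = -1
    · rw [c2, hv.2.2, hw.2.2]
    rw [Finset.filter_eq_empty_iff.2, Finset.filter_eq_empty_iff.2]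
    · intro i _; have := hw.1 i; omega
    · intro i _; have := hv.1 i; omega
  let τ := Equiv.ofFiberEquiv fun c => (hc c).some
  have hτ : ∀ i, w (τ i) = v i := Equiv.ofFiberEquiv_map _
  refine ⟨τ.trans (Equiv.swap (τ i₀) i₀), by simp, fun i => ?_⟩
  have hs : ∀ j, w (Equiv.swap (τ i₀) i₀ j) = w j := by
    intro j
    rw [Equiv.swap_apply_def]
    split_ifs with h1 h2
    · rw [h1, hτ, h]
    · rw [h2, hτ, h]
    · rfl
  rw [Equiv.trans_apply, hs, hτ]

end Vectors

section Arcs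

variable {l : ℕ}

/-- The sign pattern on the cyclically ordered set `Fin (2l+1)` which is `-1` on the arc of
length `l` starting at `j`, and `1` elsewhere. -/
def arcSign (l : ℕ) (j s : Fin (2 * l + 1)) : ℤ :=
  if (j.val ≤ s.val ∧ s.val < j.val + l) ∨ s.val + (2 * l + 1) < j.val + l then -1 else 1

/-- The arc following the arc which starts at `j` starts at `arcNext j`. -/
def arcNext (j : Fin (2 * l + 1)) : Fin (2 * l + 1) :=
  if h : j.val + l < 2 * l + 1 then ⟨j.val + l, h⟩ else ⟨j.val + l - (2 * l + 1), by omega⟩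

/-- The only point outside the arcs starting at `j` and at `arcNext j`. -/
def arcGap (j : Fin (2 * l + 1)) : Fin (2 * l + 1) :=
  if j.val = 0 then ⟨2 * l, by omega⟩ else ⟨j.val - 1, by omega⟩

theorem arcNext_val (j : Fin (2 * l + 1)) :
    (arcNext j).val = if j.val + l < 2 * l + 1 then j.val + l else j.val + l - (2 * l + 1) := by
  unfold arcNext; split_ifs <;> rfl

theorem arcGap_val (j : Fin (2 * l + 1)) :
    (arcGap j).val = if j.val = 0 then 2 * l else j.val - 1 := by
  unfold arcGap; split_ifs <;> rfl

theorem arcNext_bijective : Function.Bijective (arcNext (l := l)) := by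
  rw [← Finite.injective_iff_bijective]
  intro i j h
  have h' := congrArg Fin.val h
  rw [arcNext_val, arcNext_val] at h'
  ext
  have := i.isLt
  have := j.isLt
  split_ifs at h' <;> omega

theorem arcSign_eq (j s : Fin (2 * l + 1)) : arcSign l j s = 1 ∨ arcSign l j s = -1 := by
  unfold arcSign; split_ifs <;> simp

theorem arcSign_eq_neg_one_iff (j s : Fin (2 * l + 1)) : arcSign l j s = -1 ↔
    (j.val ≤ s.val ∧ s.val < j.val + l) ∨ s.val + (2 * l + 1) < j.val + l := by
  unfold arcSign; split_ifs with h
  · exact iff_of_true rfl h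
  · exact iff_of_false (by decide) h

theorem arcSign_arcNext (j s : Fin (2 * l + 1)) :
    arcSign l (arcNext j) s = if s = arcGap j then 1 else - arcSign l j s := by
  have := s.isLt
  have := j.isLt
  have h1 := arcNext_val j
  have h2 : s = arcGap j ↔ s.val = if j.val = 0 then 2 * l else j.val - 1 := by
    rw [← arcGap_val, Fin.ext_iff]
  simp only [arcSign, h1, h2]
  split_ifs <;> first | rfl | omega

theorem arcSign_arcGap (j : Fin (2 * l + 1)) : arcSign l j (arcGap j) = 1 := by
  have := j.isLt
  simp only [arcSign, arcGap_val]
  split_ifs <;> first | rfl | omega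

theorem card_arcSign_eq_neg_one (j : Fin (2 * l + 1)) :
    (Finset.univ.filter fun s => arcSign l j s = -1).card = l := by
  have hj := j.isLt
  have hi : Function.Injective fun t : Fin l =>
      (if h : j.val + t.val < 2 * l + 1 then ⟨j.val + t.val, h⟩
        else ⟨j.val + t.val - (2 * l + 1), by omega⟩ : Fin (2 * l + 1)) := by
    intro s t h
    dsimp only at h
    ext
    split_ifs at h <;> simp only [Fin.mk.injEq] at h <;> omega
  have : (Finset.univ.filter fun s => arcSign l j s = -1) = Finset.univ.image fun t : Fin l =>
      (if h : j.val + t.val < 2 * l + 1 then ⟨j.val + t.val, h⟩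
        else ⟨j.val + t.val - (2 * l + 1), by omega⟩ : Fin (2 * l + 1)) := by
    ext s
    have hs := s.isLt
    simp only [Finset.mem_filter, Finset.mem_univ, true_and, Finset.mem_image,
      arcSign_eq_neg_one_iff]
    constructor
    · intro h
      by_cases hjs : j.val ≤ s.val
      · refine ⟨⟨s.val - j.val, ?_⟩, ?_⟩
        · omega
        · ext
          rw [dif_pos (by dsimp only; omega)]
          dsimp only
          omega
      · refine ⟨⟨s.val + (2 * l + 1) - j.val, ?_⟩, ?_⟩
        · omega
        · ext
          rw [dif_neg (by dsimp only; omega)]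
          dsimp only
          omega
    · rintro ⟨t, rfl⟩
      have := t.isLt
      split_ifs <;> dsimp only <;> omega
  rw [this, Finset.card_image_of_injective _ hi, Finset.card_univ, Fintype.card_fin]

theorem isPMVec_arcSign (j : Fin (2 * l + 1)) : IsPMVec (2 * l + 1) (l + 1) l (arcSign l j) := by
  refine ⟨fun s => Or.inr (arcSign_eq j s), ?_, card_arcSign_eq_neg_one j⟩
  have h := Finset.card_filter_add_card_filter_not (s := Finset.univ) (fun s => arcSign l j s = -1)
  have h2 : (Finset.univ.filter fun s => ¬ arcSign l j s = -1) =
      Finset.univ.filter fun s => arcSign l j s = 1 := by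
    ext s
    have := arcSign_eq j s
    simp only [Finset.mem_filter, Finset.mem_univ, true_and]
    omega
  rw [h2, card_arcSign_eq_neg_one, Finset.card_univ, Fintype.card_fin] at h
  omega

/-- Any two consecutive arcs, neither of them missed by `0`, can be moved onto any other two
by a permutation fixing `0`, up to the order of the arcs. -/
theorem exists_perm_arcs {i j : Fin (2 * l + 1)} (hi : arcGap i ≠ 0) (hj : arcGap j ≠ 0) :
    ∃ τ : Equiv.Perm (Fin (2 * l + 1)), τ 0 = 0 ∧
      ((∀ s, arcSign l j (τ s) = arcSign l i s ∧
        arcSign l (arcNext j) (τ s) = arcSign l (arcNext i) s) ∨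
      (∀ s, arcSign l j (τ s) = arcSign l (arcNext i) s ∧
        arcSign l (arcNext j) (τ s) = arcSign l i s)) := by
  let u : Fin (2 * l + 1) → Fin (2 * l + 1) → ℤ := fun j s =>
    if s = arcGap j then 0 else arcSign l j s
  have hu : ∀ j, ∀ s, arcSign l j s = (if u j s = -1 then -1 else 1) ∧
      arcSign l (arcNext j) s = if u j s = 1 then -1 else 1 := by
    intro j s
    simp only [u, arcSign_arcNext]
    by_cases hs : s = arcGap j
    · simp [hs, arcSign_arcGap]
    · rcases arcSign_eq j s with h | h <;> simp [hs, h]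
  have hu' : ∀ j, IsPMVec (2 * l + 1) l l (u j) := by
    intro j
    refine ⟨fun s => ?_, ?_, ?_⟩
    · have := arcSign_eq j s
      simp only [u]
      split_ifs <;> simp [this]
    · refine Eq.trans (congrArg Finset.card ?_) (card_arcSign_eq_neg_one (arcNext j))
      ext s
      simp only [Finset.mem_filter, Finset.mem_univ, true_and, (hu j s).2]
      split_ifs <;> simp_all
    · refine Eq.trans (congrArg Finset.card ?_) (card_arcSign_eq_neg_one j)
      ext s
      simp only [Finset.mem_filter, Finset.mem_univ, true_and, (hu j s).1]
      split_ifs <;> simp_all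
  have hneg : IsPMVec (2 * l + 1) l l (fun s => - u i s) := by
    obtain ⟨h0, h1, h2⟩ := hu' i
    refine ⟨fun s => ?_, ?_, ?_⟩
    · have := h0 s; dsimp only; omega
    · refine Eq.trans (congrArg Finset.card ?_) h2
      ext s
      simp only [Finset.mem_filter, Finset.mem_univ, true_and]
      omega
    · refine Eq.trans (congrArg Finset.card ?_) h1
      ext s
      simp only [Finset.mem_filter, Finset.mem_univ, true_and]
      omega
  have h0 : u i 0 = u j 0 ∨ - u i 0 = u j 0 := by
    simp only [u, if_neg hi.symm, if_neg hj.symm]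
    have := arcSign_eq i 0
    have := arcSign_eq j 0
    omega
  rcases h0 with h0 | h0
  · obtain ⟨τ, hτ, h⟩ := (hu' i).exists_perm (hu' j) 0 h0
    refine ⟨τ, hτ, Or.inl fun s => ?_⟩
    rw [(hu j _).1, (hu j _).2, (hu i _).1, (hu i _).2, h]
    exact ⟨rfl, rfl⟩
  · obtain ⟨τ, hτ, h⟩ := hneg.exists_perm (hu' j) 0 h0
    refine ⟨τ, hτ, Or.inr fun s => ?_⟩
    rw [(hu j _).1, (hu j _).2, (hu i _).1, (hu i _).2, h]
    constructor <;> congr 1 <;> rw [eq_iff_iff] <;> omega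

theorem val_one_fin (hl : 1 ≤ l) : (1 : Fin (2 * l + 1)).val = 1 := by
  rw [Fin.val_one', Nat.mod_eq_of_lt (by omega)]

theorem arcNext_one_val (hl : 1 ≤ l) : (arcNext (1 : Fin (2 * l + 1))).val = l + 1 := by
  rw [arcNext_val, val_one_fin hl, if_pos (by omega), add_comm]

theorem arcNext_arcNext_one (hl : 1 ≤ l) : arcNext (arcNext (1 : Fin (2 * l + 1))) = 0 := by
  ext
  rw [arcNext_val, arcNext_one_val hl, if_neg (by omega), Fin.val_zero]
  omega

theorem arcGap_one (hl : 1 ≤ l) : arcGap (1 : Fin (2 * l + 1)) = 0 := by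
  ext
  rw [arcGap_val, val_one_fin hl]
  rfl

theorem arcGap_ne_zero (hl : 1 ≤ l) {j : Fin (2 * l + 1)} (hj : j ≠ 1) : arcGap j ≠ 0 := by
  have := val_one_fin hl
  rw [Ne, Fin.ext_iff, arcGap_val, Fin.val_zero]
  rw [Ne, Fin.ext_iff] at hj
  split_ifs <;> omega

theorem arcGap_arcNext_one_val (hl : 1 ≤ l) :
    (arcGap (arcNext (1 : Fin (2 * l + 1)))).val = l := by
  rw [arcGap_val, arcNext_one_val hl, if_neg (by omega), Nat.add_sub_cancel]

theorem arcSign_mul_arcNext {j s : Fin (2 * l + 1)} (h : s ≠ arcGap j) :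
    arcSign l j s * arcSign l (arcNext j) s = -1 := by
  rw [arcSign_arcNext, if_neg h]
  rcases arcSign_eq j s with h | h <;> simp [h]

theorem card_arcSign_zero_eq_neg_one (hl : 1 ≤ l) :
    (Finset.univ.filter fun j => arcSign l j 0 = -1).card = l := by
  have h : (Finset.univ.filter fun j => arcSign l j 0 = -1) =
      insert 0 (Finset.Ioi (arcNext (1 : Fin (2 * l + 1)))) := by
    ext j
    simp only [Finset.mem_filter, Finset.mem_univ, true_and, arcSign_eq_neg_one_iff,
      Finset.mem_insert, Finset.mem_Ioi, Fin.lt_def, arcNext_one_val hl, Fin.ext_iff, Fin.val_zero]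
    omega
  rw [h, Finset.card_insert_of_notMem, Fin.card_Ioi, arcNext_one_val hl]
  · omega
  · simp

theorem card_arcSign_zero_eq_one (hl : 1 ≤ l) :
    (Finset.univ.filter fun j => arcSign l j 0 = 1).card = l + 1 := by
  have h := Finset.card_filter_add_card_filter_not (s := Finset.univ) (fun j => arcSign l j 0 = -1)
  have h2 : (Finset.univ.filter fun j => ¬ arcSign l j 0 = -1) =
      Finset.univ.filter fun j => arcSign l j 0 = 1 := by
    ext j
    have := arcSign_eq j 0
    simp only [Finset.mem_filter, Finset.mem_univ, true_and]
    omega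
  rw [h2, card_arcSign_zero_eq_neg_one hl, Finset.card_univ, Fintype.card_fin] at h
  omega

/-- Katona's cycle bound for a set `S` of arcs, corrected by the number of pairs of consecutive
arcs in `S` and improved when three particular arcs are missing. -/
theorem two_mul_card_arcs_le (hl : 1 ≤ l) (S : Finset (Fin (2 * l + 1))) :
    2 * S.card + (if 0 ∉ S ∧ 1 ∉ S ∧ arcNext 1 ∉ S then 1 else 0) ≤
      2 * l + 2 * (Finset.univ.filter fun j => j ∈ S ∧ arcNext j ∈ S).card := by
  classical
  have hS : S.card = ∑ j, if j ∈ S then 1 else 0 := by simp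
  have hS' : S.card = ∑ j, if arcNext j ∈ S then 1 else 0 := by
    rw [hS]
    exact (arcNext_bijective.sum_comp fun j => if j ∈ S then 1 else 0).symm
  have hm : S.card + S.card + (Finset.univ.filter fun j => j ∉ S ∧ arcNext j ∉ S).card =
      2 * l + 1 + (Finset.univ.filter fun j => j ∈ S ∧ arcNext j ∈ S).card := by
    have h1 : 2 * l + 1 = ∑ _j : Fin (2 * l + 1), 1 := by simp
    conv_lhs => rw [hS]
    conv_lhs => enter [1, 2]; rw [← hS, hS']
    conv_rhs => enter [1]; rw [h1]
    rw [Finset.card_filter, Finset.card_filter, ← Finset.sum_add_distrib,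
      ← Finset.sum_add_distrib, ← Finset.sum_add_distrib]
    refine Finset.sum_congr rfl fun j _ => ?_
    by_cases h1 : j ∈ S <;> by_cases h2 : arcNext j ∈ S <;> simp [h1, h2]
  split_ifs with h
  · obtain ⟨h0, h1, h2⟩ := h
    have hsub : ({1, arcNext 1} : Finset (Fin (2 * l + 1))) ⊆
        Finset.univ.filter fun j => j ∉ S ∧ arcNext j ∉ S := by
      intro j hj
      simp only [Finset.mem_insert, Finset.mem_singleton] at hj
      simp only [Finset.mem_filter, Finset.mem_univ, true_and]
      rcases hj with rfl | rfl
      · exact ⟨h1, h2⟩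
      · rw [arcNext_arcNext_one hl]
        exact ⟨h2, h0⟩
    have := Finset.card_le_card hsub
    rw [Finset.card_pair] at this
    · omega
    · rw [Ne, Fin.ext_iff, val_one_fin hl, arcNext_one_val hl]
      omega
  · omega

end Arcs

section Placement

variable {m n a b : ℕ} {φ : Fin m → Fin n}

theorem IsPMVec.extend {χ : Fin m → ℤ} (hχ : IsPMVec m a b χ) (hφ : Function.Injective φ) :
    IsPMVec n a b (Function.extend φ χ 0) := by
  have hc : ∀ c : ℤ, c ≠ 0 → (Finset.univ.filter fun i => Function.extend φ χ 0 i = c).card =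
      (Finset.univ.filter fun s => χ s = c).card := by
    intro c hc
    rw [← Finset.card_image_of_injective _ hφ]
    congr 1
    ext i
    simp only [Finset.mem_filter, Finset.mem_univ, true_and, Finset.mem_image]
    by_cases hi : ∃ s, φ s = i
    · obtain ⟨s, rfl⟩ := hi
      rw [hφ.extend_apply]
      exact ⟨fun h => ⟨s, h, rfl⟩, fun ⟨t, ht, hts⟩ => hφ hts ▸ ht⟩
    · rw [Function.extend_apply' _ _ _ hi]
      exact ⟨fun h => absurd h.symm hc, fun ⟨t, _, hts⟩ => absurd ⟨t, hts⟩ hi⟩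
  refine ⟨fun i => ?_, ?_, ?_⟩
  · by_cases hi : ∃ s, φ s = i
    · obtain ⟨s, rfl⟩ := hi
      rw [hφ.extend_apply]
      exact hχ.1 s
    · rw [Function.extend_apply' _ _ _ hi]
      exact Or.inl rfl
  · rw [hc 1 one_ne_zero, hχ.2.1]
  · rw [hc (-1) (by norm_num), hχ.2.2]

theorem extend_comp_perm (τ : Equiv.Perm (Fin n)) (hφ : Function.Injective φ) (χ : Fin m → ℤ)
    (i : Fin n) : Function.extend (τ ∘ φ) χ 0 (τ i) = Function.extend φ χ 0 i := by
  by_cases hi : ∃ s, φ s = i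
  · obtain ⟨s, rfl⟩ := hi
    rw [hφ.extend_apply, ← (τ.injective.comp hφ).extend_apply χ 0 s, Function.comp_apply]
  · rw [Function.extend_apply' _ _ _ hi, Function.extend_apply']
    · rfl
    · rintro ⟨s, hs⟩
      exact hi ⟨s, τ.injective hs⟩

theorem extend_perm_comp (τ : Equiv.Perm (Fin m)) (hφ : Function.Injective φ) (χ : Fin m → ℤ) :
    Function.extend (φ ∘ τ) χ 0 = Function.extend φ (χ ∘ τ.symm) 0 := by
  ext i
  by_cases hi : ∃ s, φ s = i
  · obtain ⟨s, rfl⟩ := hi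
    obtain ⟨t, rfl⟩ := τ.surjective s
    rw [hφ.extend_apply]
    exact ((hφ.comp τ.injective).extend_apply χ 0 t).trans (by simp)
  · rw [Function.extend_apply' _ _ _ hi, Function.extend_apply']
    rintro ⟨s, hs⟩
    exact hi ⟨_, hs⟩

theorem injective_update (hφ : Function.Injective φ) {y : Fin n} (hy : y ∉ Set.range φ)
    (p : Fin m) : Function.Injective (Function.update φ p y) := by
  intro s t h
  simp only [Function.update_apply] at h
  split_ifs at h with h1 h2 h2
  · rw [h1, h2]
  · exact absurd ⟨t, h.symm⟩ hy
  · exact absurd ⟨s, h⟩ hy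
  · exact hφ h

theorem extend_update (hφ : Function.Injective φ) {y : Fin n} (hy : y ∉ Set.range φ)
    (p : Fin m) (χ : Fin m → ℤ) :
    Function.extend φ χ 0 ∘ Equiv.swap y (φ p) = Function.extend (Function.update φ p y) χ 0 := by
  have h : Function.update φ p y = Equiv.swap y (φ p) ∘ φ := by
    ext1 s
    rw [Function.update_apply, Function.comp_apply, Equiv.swap_apply_def]
    split_ifs with h1 h2 h3 h4 h5
    · exact absurd ⟨s, h2⟩ hy
    · rfl
    · exact absurd (congrArg φ h1) h3
    · exact absurd ⟨s, h4⟩ hy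
    · exact absurd (hφ h5) h1
    · rfl
  ext i
  obtain ⟨i, rfl⟩ := (Equiv.swap y (φ p)).surjective i
  rw [h, extend_comp_perm _ hφ, Function.comp_apply, Equiv.swap_apply_self]

theorem extend_swap (hφ : Function.Injective φ) (χ : Fin m → ℤ) (s t : Fin m) :
    Function.extend φ χ 0 ∘ Equiv.swap (φ s) (φ t) =
      Function.extend φ (χ ∘ Equiv.swap s t) 0 := by
  have h := extend_perm_comp (Equiv.swap s t) hφ χ
  rw [Equiv.symm_swap] at h
  rw [← h, ← hφ.swap_comp]
  ext i
  obtain ⟨i, rfl⟩ := (Equiv.swap (φ s) (φ t)).surjective i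
  rw [extend_comp_perm _ hφ, Function.comp_apply, Equiv.swap_apply_self]

/-- Two consecutive arcs placed by maps that differ precisely at the point outside both arcs
have the smallest possible scalar product. -/
theorem dotZ_extend_update {l : ℕ} {φ : Fin (2 * l + 1) → Fin n} (hφ : Function.Injective φ)
    {y : Fin n} (hy : y ∉ Set.range φ) (j : Fin (2 * l + 1)) {χ χ' : Fin (2 * l + 1) → ℤ}
    (h : ∀ s, s ≠ j → χ s * χ' s = -1) :
    dotZ (Function.extend φ χ 0) (Function.extend (Function.update φ j y) χ' 0) = -2 * l := by
  have hφ' := injective_update hφ hy j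
  unfold dotZ
  rw [← Finset.sum_subset (Finset.subset_univ (Finset.univ.image φ)),
    Finset.sum_image fun s _ t _ h => hφ h, ← Finset.add_sum_erase _ _ (Finset.mem_univ j),
    Finset.sum_congr rfl (g := fun _ => (-1 : ℤ))]
  · rw [Function.extend_apply' χ' (0 : Fin n → ℤ) (φ j)]
    · simp [Finset.card_erase_of_mem]
    · rintro ⟨s, hs⟩
      rw [Function.update_apply] at hs
      split_ifs at hs with h1
      · exact hy ⟨j, hs.symm⟩
      · exact h1 (hφ hs)
  · intro s hs
    have hs := Finset.ne_of_mem_erase hs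
    have h1 : φ s = Function.update φ j y s := by rw [Function.update_of_ne hs]
    rw [hφ.extend_apply, h1, hφ'.extend_apply, h s hs]
  · intro i _ hi
    rw [Function.extend_apply', Pi.zero_apply, zero_mul]
    rintro ⟨s, rfl⟩
    exact hi (Finset.mem_image_of_mem _ (Finset.mem_univ s))

end Placement

section LastShifted

/-- A family of vectors in `V(n+1,l+1,l)` without two members of scalar product `-2l`, which is
closed under moving a larger last entry to an earlier coordinate. -/
structure LastShifted (l n : ℕ) (F : Finset (Fin (n + 1) → ℤ)) : Prop where
  isPMVec : ∀ v ∈ F, IsPMVec (n + 1) (l + 1) l v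
  dot : ∀ v ∈ F, ∀ w ∈ F, -2 * (l : ℤ) < dotZ v w
  shift : ∀ v ∈ F, ∀ i, v i < v (Fin.last n) → v ∘ Equiv.swap i (Fin.last n) ∈ F

open Classical in
/-- The ways to place a cycle of length `2l+1` in `Fin (n+1)`, with `0` put at the last point. -/
noncomputable def placements (l n : ℕ) : Finset (Fin (2 * l + 1) → Fin (n + 1)) :=
  Finset.univ.filter fun φ => Function.Injective φ ∧ φ 0 = Fin.last n

/-- The vector supported on a placed cycle which is `-1` on the arc starting at `j`. -/
noncomputable def arcVec {l n : ℕ} (φ : Fin (2 * l + 1) → Fin (n + 1)) (j : Fin (2 * l + 1)) :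
    Fin (n + 1) → ℤ :=
  Function.extend φ (arcSign l j) 0

variable {l n : ℕ} {F : Finset (Fin (n + 1) → ℤ)} {φ : Fin (2 * l + 1) → Fin (n + 1)}

theorem mem_placements : φ ∈ placements l n ↔ Function.Injective φ ∧ φ 0 = Fin.last n := by
  simp [placements]

theorem placements_nonempty (h : 2 * l ≤ n) : (placements l n).Nonempty := by
  let e : Fin (2 * l + 1) → Fin (n + 1) := fun s => Fin.rev (Fin.castLE (by omega) s)
  refine ⟨e, mem_placements.2 ⟨fun s t hst => ?_, ?_⟩⟩
  · exact Fin.castLE_injective _ (Fin.rev_injective hst)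
  · ext
    simp [e]

theorem arcVec_apply (hφ : Function.Injective φ) (j s : Fin (2 * l + 1)) :
    arcVec φ j (φ s) = arcSign l j s :=
  hφ.extend_apply _ _ _

theorem LastShifted.arcVec_update_notMem (hF : LastShifted l n F) (hφ : Function.Injective φ)
    {y : Fin (n + 1)} (hy : y ∉ Set.range φ) {i j p : Fin (2 * l + 1)}
    (h : ∀ s, s ≠ p → arcSign l i s * arcSign l j s = -1) (hi : arcVec φ i ∈ F) :
    arcVec (Function.update φ p y) j ∉ F := fun hj =>
  (hF.dot _ hi _ hj).ne' (dotZ_extend_update hφ hy p h)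

/-- The placements for which both arcs around the gap `arcGap j` belong to the family. -/
noncomputable def doublePlacements (F : Finset (Fin (n + 1) → ℤ)) (j : Fin (2 * l + 1)) :
    Finset (Fin (2 * l + 1) → Fin (n + 1)) := by
  classical
  exact (placements l n).filter fun φ => arcVec φ j ∈ F ∧ arcVec φ (arcNext j) ∈ F

theorem mem_doublePlacements {j : Fin (2 * l + 1)} : φ ∈ doublePlacements F j ↔
    φ ∈ placements l n ∧ arcVec φ j ∈ F ∧ arcVec φ (arcNext j) ∈ F := by
  simp [doublePlacements]

theorem exists_notMem_range (hn : 2 * l < n) (φ : Fin (2 * l + 1) → Fin (n + 1)) :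
    ∃ y, y ∉ Set.range φ := by
  by_contra! h
  have := Fintype.card_le_of_surjective φ h
  simp only [Fintype.card_fin] at this
  omega

theorem LastShifted.doublePlacements_one (hF : LastShifted l n F) (hl : 1 ≤ l) (hn : 2 * l < n) :
    doublePlacements F (1 : Fin (2 * l + 1)) = ∅ := by
  rw [Finset.eq_empty_iff_forall_notMem]
  intro φ h
  obtain ⟨hφ, h1, h2⟩ := mem_doublePlacements.1 h
  obtain ⟨hφ, h0⟩ := mem_placements.1 hφ
  obtain ⟨y, hy⟩ := exists_notMem_range hn φ
  refine hF.arcVec_update_notMem (p := 0) (j := 1) hφ hy (fun s hs => ?_) h2 ?_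
  · rw [mul_comm, arcSign_mul_arcNext (by rwa [arcGap_one hl])]
  · have := hF.shift _ h1 y ?_
    · rwa [← h0, arcVec, extend_update hφ hy] at this
    · rw [← h0, arcVec_apply hφ, ← arcGap_one hl, arcSign_arcGap, arcVec,
        Function.extend_apply' _ _ _ hy]
      exact zero_lt_one

theorem card_doublePlacements_le (F : Finset (Fin (n + 1) → ℤ)) {i j : Fin (2 * l + 1)}
    (hi : arcGap i ≠ 0) (hj : arcGap j ≠ 0) :
    (doublePlacements F j).card ≤ (doublePlacements F i).card := by
  obtain ⟨τ, h0, hτ⟩ := exists_perm_arcs hi hj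
  refine Finset.card_le_card_of_injOn (fun φ => φ ∘ τ) (fun φ h => ?_) fun φ _ ψ _ h => ?_
  · obtain ⟨hp, h1, h2⟩ := mem_doublePlacements.1 (Finset.mem_coe.1 h)
    obtain ⟨hφ, hφ0⟩ := mem_placements.1 hp
    have hvec : ∀ a b : Fin (2 * l + 1), (∀ s, arcSign l a (τ s) = arcSign l b s) →
        arcVec (φ ∘ τ) b = arcVec φ a := by
      intro a b hab
      rw [arcVec, extend_perm_comp τ hφ, arcVec]
      congr 1
      ext s
      rw [Function.comp_apply, ← hab, Equiv.apply_symm_apply]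
    refine Finset.mem_coe.2 (mem_doublePlacements.2
      ⟨mem_placements.2 ⟨hφ.comp τ.injective, (congrArg φ h0).trans hφ0⟩, ?_⟩)
    rcases hτ with hτ | hτ
    · rw [hvec j i fun s => (hτ s).1, hvec _ _ fun s => (hτ s).2]
      exact ⟨h1, h2⟩
    · rw [hvec _ i fun s => (hτ s).2, hvec _ _ fun s => (hτ s).1]
      exact ⟨h2, h1⟩
  · exact τ.surjective.injective_comp_right h

/-- The placements for which the arcs starting at `0`, `1` and `l+1` are all missing. -/
noncomputable def missedPlacements (l : ℕ) (F : Finset (Fin (n + 1) → ℤ)) :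
    Finset (Fin (2 * l + 1) → Fin (n + 1)) := by
  classical
  exact (placements l n).filter fun φ =>
    arcVec φ 0 ∉ F ∧ arcVec φ 1 ∉ F ∧ arcVec φ (arcNext 1) ∉ F

theorem mem_missedPlacements : φ ∈ missedPlacements l F ↔
    φ ∈ placements l n ∧ arcVec φ 0 ∉ F ∧ arcVec φ 1 ∉ F ∧ arcVec φ (arcNext 1) ∉ F := by
  simp [missedPlacements]

theorem LastShifted.update_mem_missedPlacements (hF : LastShifted l n F) (hl : 1 ≤ l)
    (hφ : φ ∈ doublePlacements F (arcNext 1)) {y : Fin (n + 1)} (hy : y ∉ Set.range φ) :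
    Function.update φ (arcGap (arcNext 1)) y ∈ missedPlacements l F := by
  obtain ⟨hp, h1, h2⟩ := mem_doublePlacements.1 hφ
  obtain ⟨hφ, hφ0⟩ := mem_placements.1 hp
  have hp := arcGap_arcNext_one_val hl
  set p : Fin (2 * l + 1) := arcGap (arcNext 1) with hpdef
  have hp0 : 0 ≠ p := by
    rw [Ne, Fin.ext_iff, hp, Fin.val_zero]
    omega
  have hψ := injective_update hφ hy p
  have hψ0 : Function.update φ p y 0 = Fin.last n := by rw [Function.update_of_ne hp0, hφ0]
  have hψp : Function.update φ p y p = y := Function.update_self _ _ _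
  have m0 : arcVec (Function.update φ p y) 0 ∉ F := by
    refine hF.arcVec_update_notMem hφ hy (fun s hs => ?_) h1
    rw [← arcNext_arcNext_one hl, arcSign_mul_arcNext hs]
  refine mem_missedPlacements.2 ⟨mem_placements.2 ⟨hψ, hψ0⟩, m0, fun h => m0 ?_, ?_⟩
  · have hv1 : (1 : Fin (2 * l + 1)).val = 1 := val_one_fin hl
    have := hF.shift _ h y ?_
    · rw [← hψ0] at this
      nth_rw 2 [← hψp] at this
      rw [arcVec, extend_swap hψ] at this
      have hsgn : arcSign l 1 ∘ Equiv.swap p 0 = arcSign l 0 := by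
        ext s
        have hs := s.isLt
        rw [Function.comp_apply, Equiv.swap_apply_def]
        split_ifs with e1 e2
        · subst e1
          simp only [arcSign, hv1, Fin.val_zero, hp]
          split_ifs <;> first | rfl | omega
        · subst e2
          simp only [arcSign, hv1, Fin.val_zero, hp]
          split_ifs <;> first | rfl | omega
        · rw [Fin.ext_iff, hp] at e1
          rw [Fin.ext_iff, Fin.val_zero] at e2
          simp only [arcSign, hv1, Fin.val_zero]
          split_ifs <;> first | rfl | omega
      rw [hsgn] at this
      exact this
    · have e1 : arcVec (Function.update φ p y) 1 y = -1 := by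
        nth_rw 2 [← hψp]
        rw [arcVec_apply hψ, arcSign_eq_neg_one_iff]
        omega
      have e2 : arcVec (Function.update φ p y) 1 (Fin.last n) = 1 := by
        rw [← hψ0, arcVec_apply hψ]
        rw [← arcGap_one hl, arcSign_arcGap]
      rw [e1, e2]
      norm_num
  · refine hF.arcVec_update_notMem hφ hy (fun s hs => ?_) h2
    rw [mul_comm, arcSign_mul_arcNext hs]

theorem LastShifted.card_missedPlacements (hF : LastShifted l n F) (hl : 1 ≤ l) :
    (doublePlacements F (arcNext (1 : Fin (2 * l + 1)))).card * (n - 2 * l) ≤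
      (missedPlacements l F).card := by
  classical
  have hcard : ((doublePlacements F (arcNext (1 : Fin (2 * l + 1)))).sigma
      fun φ => (Finset.univ.image φ)ᶜ).card =
      (doublePlacements F (arcNext (1 : Fin (2 * l + 1)))).card * (n - 2 * l) := by
    rw [Finset.card_sigma, Finset.sum_congr rfl (g := fun _ => n - 2 * l), Finset.sum_const,
      smul_eq_mul]
    intro φ h
    have hφ := (mem_placements.1 (mem_doublePlacements.1 h).1).1
    rw [Finset.card_compl, Finset.card_image_of_injective _ hφ, Finset.card_univ,
      Fintype.card_fin, Fintype.card_fin]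
    omega
  rw [← hcard]
  refine Finset.card_le_card_of_injOn
    (fun x => Function.update x.1 (arcGap (arcNext 1)) x.2) ?_ ?_
  · rintro ⟨φ, y⟩ h
    obtain ⟨h1, h2⟩ := Finset.mem_sigma.1 (Finset.mem_coe.1 h)
    exact Finset.mem_coe.2 (hF.update_mem_missedPlacements hl h1 (by simpa using h2))
  · rintro ⟨φ, y⟩ h ⟨ψ, z⟩ h' he
    obtain ⟨h1, h2⟩ := Finset.mem_sigma.1 (Finset.mem_coe.1 h)
    obtain ⟨h1', h2'⟩ := Finset.mem_sigma.1 (Finset.mem_coe.1 h')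
    dsimp only at h1 h2 h1' h2' he
    have hφ := (mem_placements.1 (mem_doublePlacements.1 h1).1).1
    have hψ := (mem_placements.1 (mem_doublePlacements.1 h1').1).1
    have hψφ : ψ = Function.update φ (arcGap (arcNext 1)) (ψ (arcGap (arcNext 1))) := by
      ext1 s
      by_cases hs : s = arcGap (arcNext 1)
      · rw [hs, Function.update_self]
      · have := congrFun he s
        rw [Function.update_of_ne hs, Function.update_of_ne hs] at this
        rw [Function.update_of_ne hs, this]
    have hyz : y = z := by
      simpa using congrFun he (arcGap (arcNext 1))
    by_cases hr : ψ (arcGap (arcNext 1)) ∈ Set.range φ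
    · obtain ⟨t, ht⟩ := hr
      have : t = arcGap (arcNext 1) := by
        by_contra hne
        have h3 := congrFun hψφ t
        rw [Function.update_of_ne hne, ht] at h3
        exact hne (hψ h3)
      rw [this] at ht
      rw [← ht, Function.update_eq_self] at hψφ
      subst hψφ
      subst hyz
      rfl
    · refine absurd (mem_doublePlacements.1 h1').2.2 ?_
      rw [hψφ]
      exact hF.arcVec_update_notMem hφ hr (fun s hs => arcSign_mul_arcNext hs)
        (mem_doublePlacements.1 h1).2.1

open Classical in
/-- On average over all placements, the family contains at most `l` arcs. -/
theorem LastShifted.sum_card_arcs_le (hF : LastShifted l n F) (hl : 1 ≤ l) (hn : 6 * l ≤ n) :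
    ∑ φ ∈ placements l n, (Finset.univ.filter fun j => arcVec φ j ∈ F).card ≤
      l * (placements l n).card := by
  have hone : ∀ φ ∈ placements l n,
      2 * (Finset.univ.filter fun j => arcVec φ j ∈ F).card +
        (if arcVec φ 0 ∉ F ∧ arcVec φ 1 ∉ F ∧ arcVec φ (arcNext 1) ∉ F then 1 else 0) ≤
      2 * l + 2 * ∑ j, if arcVec φ j ∈ F ∧ arcVec φ (arcNext j) ∈ F then 1 else 0 := by
    intro φ _
    have := two_mul_card_arcs_le hl (Finset.univ.filter fun j => arcVec φ j ∈ F)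
    rw [Finset.card_filter (fun j => j ∈ _ ∧ _)] at this
    simpa only [Finset.mem_filter, Finset.mem_univ, true_and] using this
  have hsum := Finset.sum_le_sum hone
  rw [Finset.sum_add_distrib, Finset.sum_add_distrib, ← Finset.card_filter, Finset.sum_const,
    smul_eq_mul, ← Finset.mul_sum, ← Finset.mul_sum, Finset.sum_comm (s := placements l n)] at hsum
  have hmiss : ((placements l n).filter fun φ => arcVec φ 0 ∉ F ∧ arcVec φ 1 ∉ F ∧
      arcVec φ (arcNext 1) ∉ F) = missedPlacements l F := by
    ext φ
    rw [mem_missedPlacements, Finset.mem_filter]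
  have hdouble : ∑ j : Fin (2 * l + 1), ∑ φ ∈ placements l n,
      (if arcVec φ j ∈ F ∧ arcVec φ (arcNext j) ∈ F then 1 else 0) ≤
      2 * l * (doublePlacements F (arcNext (1 : Fin (2 * l + 1)))).card := by
    have hj : ∀ j : Fin (2 * l + 1), ∑ φ ∈ placements l n,
        (if arcVec φ j ∈ F ∧ arcVec φ (arcNext j) ∈ F then 1 else 0) =
        (doublePlacements F j).card := by
      intro j
      rw [← Finset.card_filter]
      congr 1
    simp only [hj]
    rw [← Finset.add_sum_erase _ _ (Finset.mem_univ 1), hF.doublePlacements_one hl (by omega),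
      Finset.card_empty, zero_add]
    refine (Finset.sum_le_card_nsmul _ _
      (doublePlacements F (arcNext (1 : Fin (2 * l + 1)))).card fun j hj => ?_).trans_eq ?_
    · refine card_doublePlacements_le F (arcGap_ne_zero hl ?_)
        (arcGap_ne_zero hl (Finset.ne_of_mem_erase hj))
      rw [Ne, Fin.ext_iff, arcNext_one_val hl, val_one_fin hl]
      omega
    · rw [Finset.card_erase_of_mem (Finset.mem_univ _), Finset.card_univ, Fintype.card_fin,
        Nat.add_sub_cancel, smul_eq_mul]
  rw [hmiss] at hsum
  have hcard := hF.card_missedPlacements hl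
  have h4 : (doublePlacements F (arcNext (1 : Fin (2 * l + 1)))).card * (4 * l) ≤
      (doublePlacements F (arcNext (1 : Fin (2 * l + 1)))).card * (n - 2 * l) :=
    Nat.mul_le_mul_left _ (by omega)
  nlinarith

open Classical in
/-- All vectors with a given last coordinate occur equally often as a given arc. -/
theorem card_mul_card_arcVec_eq {s : ℤ} {j : Fin (2 * l + 1)} (hj : arcSign l j 0 = s)
    {v : Fin (n + 1) → ℤ} (hv : IsPMVec (n + 1) (l + 1) l v) (hs : v (Fin.last n) = s) :
    ((pmVecs (n + 1) (l + 1) l).filter fun v => v (Fin.last n) = s).card *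
      ((placements l n).filter fun φ => arcVec φ j = v).card = (placements l n).card := by
  have hmaps : ∀ φ ∈ placements l n, arcVec φ j ∈
      (pmVecs (n + 1) (l + 1) l).filter fun v => v (Fin.last n) = s := by
    intro φ hφ
    obtain ⟨hφ, h0⟩ := mem_placements.1 hφ
    refine Finset.mem_filter.2 ⟨mem_pmVecs.2 ((isPMVec_arcSign j).extend hφ), ?_⟩
    rw [← h0, arcVec_apply hφ, hj]
  have hle : ∀ v w : Fin (n + 1) → ℤ, IsPMVec (n + 1) (l + 1) l v → IsPMVec (n + 1) (l + 1) l w →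
      v (Fin.last n) = w (Fin.last n) →
      ((placements l n).filter fun φ => arcVec φ j = v).card ≤
        ((placements l n).filter fun φ => arcVec φ j = w).card := by
    intro v w hv hw h
    obtain ⟨τ, hτ, hτv⟩ := hv.exists_perm hw _ h
    refine Finset.card_le_card_of_injOn (fun φ => τ ∘ φ) (fun φ hφ => ?_) fun φ _ ψ _ he => ?_
    · obtain ⟨hp, rfl⟩ := Finset.mem_filter.1 (Finset.mem_coe.1 hφ)
      obtain ⟨hφ, h0⟩ := mem_placements.1 hp
      refine Finset.mem_coe.2 (Finset.mem_filter.2 ⟨mem_placements.2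
        ⟨τ.injective.comp hφ, (congrArg τ h0).trans hτ⟩, ?_⟩)
      ext i
      obtain ⟨i, rfl⟩ := τ.surjective i
      rw [hτv, arcVec, extend_comp_perm τ hφ, arcVec]
    · exact τ.injective.comp_left he
  rw [Finset.card_eq_sum_card_fiberwise hmaps, Finset.sum_congr rfl, Finset.sum_const, smul_eq_mul]
  intro w hw
  obtain ⟨hw, hws⟩ := Finset.mem_filter.1 hw
  have hw := mem_pmVecs.1 hw
  exact le_antisymm (hle _ _ hw hv (by rw [hs, hws])) (hle _ _ hv hw (by rw [hs, hws]))

open Classical in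
theorem mul_sum_card_arcVec_ge (hl : 1 ≤ l) {v : Fin (n + 1) → ℤ}
    (hv : IsPMVec (n + 1) (l + 1) l v) (h0 : v (Fin.last n) ≠ 0) :
    l * (placements l n).card ≤ n.choose (2 * l) * (2 * l).choose (l - 1) *
      ∑ j : Fin (2 * l + 1), ((placements l n).filter fun φ => arcVec φ j = v).card := by
  obtain ⟨l, rfl⟩ : ∃ k, l = k + 1 := ⟨l - 1, by omega⟩
  rw [Nat.add_sub_cancel]
  have key : ∀ s : ℤ, v (Fin.last n) = s →
      ((pmVecs (n + 1) (l + 1 + 1) (l + 1)).filter fun v => v (Fin.last n) = s).card *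
      ∑ j : Fin (2 * (l + 1) + 1), ((placements (l + 1) n).filter fun φ => arcVec φ j = v).card ≥
      (Finset.univ.filter fun j => arcSign (l + 1) j 0 = s).card * (placements (l + 1) n).card := by
    intro s hs
    have e : (Finset.univ.filter fun j => arcSign (l + 1) j 0 = s).card *
        (placements (l + 1) n).card = ∑ _j ∈ Finset.univ.filter (fun j => arcSign (l + 1) j 0 = s),
        (placements (l + 1) n).card := by rw [Finset.sum_const, smul_eq_mul]
    rw [ge_iff_le, e, Finset.mul_sum]
    refine le_trans (Finset.sum_le_sum fun j hj => ?_)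
      (Finset.sum_le_sum_of_subset (Finset.filter_subset _ _))
    exact (card_mul_card_arcVec_eq (Finset.mem_filter.1 hj).2 hv hs).ge
  rcases hv.1 (Fin.last n) with h | h | h
  · exact absurd h h0
  · have := key 1 h
    rw [card_filter_last_pos, card_arcSign_zero_eq_one hl] at this
    have hc := Nat.choose_succ_right_eq (2 * (l + 1)) l
    rw [show l + 1 + (l + 1) = 2 * (l + 1) by ring] at this
    rw [show 2 * (l + 1) - l = l + 1 + 1 by omega] at hc
    generalize ∑ j : Fin (2 * (l + 1) + 1),
      ((placements (l + 1) n).filter fun φ => arcVec φ j = v).card = T at this ⊢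
    refine Nat.le_of_mul_le_mul_left (?_ : (l + 1 + 1) * _ ≤ (l + 1 + 1) * _) (by omega)
    calc (l + 1 + 1) * ((l + 1) * (placements (l + 1) n).card)
        = (l + 1) * ((l + 1 + 1) * (placements (l + 1) n).card) := by ring
      _ ≤ (l + 1) * (n.choose (2 * (l + 1)) * (2 * (l + 1)).choose (l + 1) * T) :=
        Nat.mul_le_mul_left _ this
      _ = n.choose (2 * (l + 1)) * ((2 * (l + 1)).choose (l + 1) * (l + 1)) * T := by ring
      _ = (l + 1 + 1) * (n.choose (2 * (l + 1)) * (2 * (l + 1)).choose l * T) := by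
        rw [hc]; ring
  · have := key (-1) h
    rw [card_filter_last_neg, card_arcSign_zero_eq_neg_one hl] at this
    rwa [show l + 1 + 1 + l = 2 * (l + 1) by ring] at this

theorem LastShifted.card_filter_last_ne_zero_le (hF : LastShifted l n F) (hl : 1 ≤ l)
    (hn : 6 * l ≤ n) :
    (F.filter fun v => v (Fin.last n) ≠ 0).card ≤
      n.choose (2 * l) * (2 * l).choose (l - 1) := by
  classical
  have hpos : 0 < l * (placements l n).card :=
    Nat.mul_pos hl (placements_nonempty (by omega)).card_pos
  have hswap : ∑ v ∈ F.filter (fun v => v (Fin.last n) ≠ 0),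
      ∑ j : Fin (2 * l + 1), ((placements l n).filter fun φ => arcVec φ j = v).card ≤
      ∑ φ ∈ placements l n, (Finset.univ.filter fun j => arcVec φ j ∈ F).card := by
    refine (Finset.sum_le_sum_of_subset (Finset.filter_subset _ F)).trans_eq ?_
    simp only [Finset.card_filter]
    rw [Finset.sum_comm, Finset.sum_comm (s := placements l n)]
    refine Finset.sum_congr rfl fun j _ => ?_
    rw [Finset.sum_comm]
    exact Finset.sum_congr rfl fun φ _ => by rw [Finset.sum_ite_eq]
  have h1 : (F.filter fun v => v (Fin.last n) ≠ 0).card * (l * (placements l n).card) ≤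
      n.choose (2 * l) * (2 * l).choose (l - 1) * ∑ v ∈ F.filter (fun v => v (Fin.last n) ≠ 0),
      ∑ j : Fin (2 * l + 1), ((placements l n).filter fun φ => arcVec φ j = v).card := by
    rw [Finset.mul_sum, ← smul_eq_mul, ← Finset.sum_const]
    refine Finset.sum_le_sum fun v hv => ?_
    obtain ⟨hvF, hv0⟩ := Finset.mem_filter.1 hv
    exact mul_sum_card_arcVec_ge hl (hF.isPMVec v hvF) hv0
  exact Nat.le_of_mul_le_mul_right (h1.trans
    (Nat.mul_le_mul_left _ (hswap.trans (hF.sum_card_arcs_le hl hn)))) hpos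

end LastShifted

section Extremal

variable {n k l : ℕ}

theorem bddAbove_card (n k l : ℕ) : BddAbove {m | ∃ F : Finset (Fin n → ℤ),
    (∀ v ∈ F, IsPMVec n k l v) ∧
    (∀ v ∈ F, ∀ w ∈ F, -2 * (l : ℤ) < dotZ v w) ∧ F.card = m} := by
  refine ⟨(pmVecs n k l).card, ?_⟩
  rintro m ⟨F, hF, -, rfl⟩
  exact Finset.card_le_card fun v hv => mem_pmVecs.2 (hF v hv)

theorem card_le_gVal {F : Finset (Fin n → ℤ)} (hF : ∀ v ∈ F, IsPMVec n k l v)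
    (hdot : ∀ v ∈ F, ∀ w ∈ F, -2 * (l : ℤ) < dotZ v w) : F.card ≤ gVal n k l := by
  refine le_csSup (bddAbove_card n k l) ?_
  exact ⟨F, hF, hdot, rfl⟩

theorem exists_card_eq_gVal (n k l : ℕ) : ∃ F : Finset (Fin n → ℤ),
    (∀ v ∈ F, IsPMVec n k l v) ∧
    (∀ v ∈ F, ∀ w ∈ F, -2 * (l : ℤ) < dotZ v w) ∧ F.card = gVal n k l := by
  refine Nat.sSup_mem ?_ (bddAbove_card n k l)
  exact ⟨0, ∅, by simp⟩

theorem dotZ_succ (v w : Fin (n + 1) → ℤ) :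
    dotZ v w = dotZ (Fin.init v) (Fin.init w) + v (Fin.last n) * w (Fin.last n) :=
  Fin.sum_univ_castSucc _

theorem dotZ_comm (v w : Fin n → ℤ) : dotZ v w = dotZ w v :=
  Finset.sum_congr rfl fun _ _ => mul_comm _ _

theorem dotZ_comp_perm (τ : Equiv.Perm (Fin n)) (v w : Fin n → ℤ) :
    dotZ (v ∘ τ) (w ∘ τ) = dotZ v w :=
  Equiv.sum_comp τ fun i => v i * w i

theorem IsPMVec.comp_perm {v : Fin n → ℤ} (hv : IsPMVec n k l v) (τ : Equiv.Perm (Fin n)) :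
    IsPMVec n k l (v ∘ τ) := by
  refine ⟨fun i => hv.1 _, ?_, ?_⟩
  · rw [← hv.2.1, Finset.card_filter, Finset.card_filter]
    exact Equiv.sum_comp τ fun i => if v i = 1 then 1 else 0
  · rw [← hv.2.2, Finset.card_filter, Finset.card_filter]
    exact Equiv.sum_comp τ fun i => if v i = -1 then 1 else 0

theorem comp_swap_comp_swap (v : Fin n → ℤ) (i j : Fin n) :
    (v ∘ Equiv.swap i j) ∘ Equiv.swap i j = v := by
  ext s
  simp

theorem dotZ_comp_swap (v w : Fin n → ℤ) {i j : Fin n} (hij : i ≠ j) :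
    dotZ (v ∘ Equiv.swap i j) w = dotZ v w + (v j - v i) * (w i - w j) := by
  have hji : j ∈ Finset.univ.erase i := Finset.mem_erase.2 ⟨hij.symm, Finset.mem_univ j⟩
  rw [dotZ, dotZ, ← Finset.add_sum_erase _ _ (Finset.mem_univ i), ← Finset.add_sum_erase _ _ hji,
    ← Finset.add_sum_erase Finset.univ _ (Finset.mem_univ i), ← Finset.add_sum_erase _ _ hji,
    Finset.sum_congr rfl (g := fun s => v s * w s)]
  · simp only [Function.comp_apply, Equiv.swap_apply_left, Equiv.swap_apply_right]
    ring
  · intro s hs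
    have h1 := Finset.ne_of_mem_erase hs
    have h2 := Finset.ne_of_mem_erase (Finset.mem_of_mem_erase hs)
    rw [Function.comp_apply, Equiv.swap_apply_of_ne_of_ne h2 h1]

open Classical in
/-- The effect of the shift at `i` and the last coordinate on a member of the family `F`. -/
noncomputable def shiftVec (F : Finset (Fin (n + 1) → ℤ)) (i : Fin (n + 1))
    (v : Fin (n + 1) → ℤ) : Fin (n + 1) → ℤ :=
  if v i < v (Fin.last n) ∧ v ∘ Equiv.swap i (Fin.last n) ∉ F then
    v ∘ Equiv.swap i (Fin.last n) else v

variable {F : Finset (Fin (n + 1) → ℤ)} {i : Fin (n + 1)} {v w : Fin (n + 1) → ℤ}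

theorem shiftVec_of_moved (h : v i < v (Fin.last n) ∧ v ∘ Equiv.swap i (Fin.last n) ∉ F) :
    shiftVec F i v = v ∘ Equiv.swap i (Fin.last n) :=
  if_pos h

theorem shiftVec_of_not_moved
    (h : ¬ (v i < v (Fin.last n) ∧ v ∘ Equiv.swap i (Fin.last n) ∉ F)) : shiftVec F i v = v :=
  if_neg h

theorem shiftVec_injOn : Set.InjOn (shiftVec F i) F := by
  intro v hv w hw h
  by_cases h1 : v i < v (Fin.last n) ∧ v ∘ Equiv.swap i (Fin.last n) ∉ F
  · rw [shiftVec_of_moved h1] at h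
    by_cases h2 : w i < w (Fin.last n) ∧ w ∘ Equiv.swap i (Fin.last n) ∉ F
    · rw [shiftVec_of_moved h2] at h
      rw [← comp_swap_comp_swap v i (Fin.last n), h, comp_swap_comp_swap]
    · rw [shiftVec_of_not_moved h2] at h
      exact absurd (h ▸ hw) h1.2
  · rw [shiftVec_of_not_moved h1] at h
    by_cases h2 : w i < w (Fin.last n) ∧ w ∘ Equiv.swap i (Fin.last n) ∉ F
    · rw [shiftVec_of_moved h2] at h
      exact absurd (h ▸ hv) h2.2
    · rwa [shiftVec_of_not_moved h2] at h

theorem lt_dotZ_comp_swap {c : ℤ} (hdot : ∀ v ∈ F, ∀ w ∈ F, c < dotZ v w)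
    (hv : v ∈ F) (hw : w ∈ F) (h1 : v i < v (Fin.last n))
    (h2 : ¬ (w i < w (Fin.last n) ∧ w ∘ Equiv.swap i (Fin.last n) ∉ F)) :
    c < dotZ (v ∘ Equiv.swap i (Fin.last n)) w := by
  by_cases h3 : w ∘ Equiv.swap i (Fin.last n) ∈ F
  · rw [← comp_swap_comp_swap w i (Fin.last n), dotZ_comp_perm]
    exact hdot v hv _ h3
  · have h4 : w (Fin.last n) ≤ w i := not_lt.1 fun h => h2 ⟨h, h3⟩
    rw [dotZ_comp_swap v w (by rintro rfl; exact lt_irrefl _ h1)]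
    have := hdot v hv w hw
    have := mul_nonneg (sub_nonneg.2 h1.le) (sub_nonneg.2 h4)
    linarith

theorem lt_dotZ_shiftVec {c : ℤ} (hdot : ∀ v ∈ F, ∀ w ∈ F, c < dotZ v w)
    (hv : v ∈ F) (hw : w ∈ F) : c < dotZ (shiftVec F i v) (shiftVec F i w) := by
  by_cases h1 : v i < v (Fin.last n) ∧ v ∘ Equiv.swap i (Fin.last n) ∉ F <;>
    by_cases h2 : w i < w (Fin.last n) ∧ w ∘ Equiv.swap i (Fin.last n) ∉ F
  · rw [shiftVec_of_moved h1, shiftVec_of_moved h2, dotZ_comp_perm]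
    exact hdot v hv w hw
  · rw [shiftVec_of_moved h1, shiftVec_of_not_moved h2]
    exact lt_dotZ_comp_swap hdot hv hw h1.1 h2
  · rw [shiftVec_of_not_moved h1, shiftVec_of_moved h2, dotZ_comm]
    exact lt_dotZ_comp_swap hdot hw hv h2.1 h1
  · rw [shiftVec_of_not_moved h1, shiftVec_of_not_moved h2]
    exact hdot v hv w hw

theorem shiftVec_last_le (v : Fin (n + 1) → ℤ) :
    shiftVec F i v (Fin.last n) ≤ v (Fin.last n) := by
  by_cases h : v i < v (Fin.last n) ∧ v ∘ Equiv.swap i (Fin.last n) ∉ F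
  · rw [shiftVec_of_moved h, Function.comp_apply, Equiv.swap_apply_right]
    exact h.1.le
  · rw [shiftVec_of_not_moved h]

theorem exists_lastShifted (l n : ℕ) : ∃ F : Finset (Fin (n + 1) → ℤ),
    LastShifted l n F ∧ F.card = gVal (n + 1) (l + 1) l := by
  classical
  let S := (pmVecs (n + 1) (l + 1) l).powerset.filter fun F =>
    (∀ v ∈ F, ∀ w ∈ F, -2 * (l : ℤ) < dotZ v w) ∧ F.card = gVal (n + 1) (l + 1) l
  have hS : ∀ F, F ∈ S ↔ (∀ v ∈ F, IsPMVec (n + 1) (l + 1) l v) ∧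
      (∀ v ∈ F, ∀ w ∈ F, -2 * (l : ℤ) < dotZ v w) ∧ F.card = gVal (n + 1) (l + 1) l := by
    intro F
    simp only [S, Finset.mem_filter, Finset.mem_powerset, Finset.subset_iff, mem_pmVecs]
  obtain ⟨F₀, hF₀⟩ := exists_card_eq_gVal (n + 1) (l + 1) l
  obtain ⟨F, hF, hmin⟩ := Finset.exists_min_image S (fun F => ∑ v ∈ F, v (Fin.last n))
    ⟨F₀, (hS F₀).2 hF₀⟩
  obtain ⟨hpm, hdot, hcard⟩ := (hS F).1 hF
  refine ⟨F, ⟨hpm, hdot, fun v hv i hi => ?_⟩, hcard⟩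
  by_contra hvF
  have hF' : F.image (shiftVec F i) ∈ S := by
    refine (hS _).2 ⟨?_, ?_, ?_⟩
    · rw [Finset.forall_mem_image]
      intro w hw
      unfold shiftVec
      split_ifs
      · exact (hpm w hw).comp_perm _
      · exact hpm w hw
    · simp only [Finset.forall_mem_image]
      exact fun v hv w hw => lt_dotZ_shiftVec hdot hv hw
    · rw [Finset.card_image_of_injOn shiftVec_injOn, hcard]
  have hlt := hmin _ hF'
  rw [Finset.sum_image shiftVec_injOn] at hlt
  refine hlt.not_gt (Finset.sum_lt_sum (fun w _ => shiftVec_last_le w) ⟨v, hv, ?_⟩)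
  rwa [shiftVec_of_moved ⟨hi, hvF⟩, Function.comp_apply, Equiv.swap_apply_right]

theorem gVal_succ_le (hl : 1 ≤ l) (hn : 6 * l ≤ n) : gVal (n + 1) (l + 1) l ≤
    gVal n (l + 1) l + n.choose (2 * l) * (2 * l).choose (l - 1) := by
  classical
  obtain ⟨F, hF, hcard⟩ := exists_lastShifted l n
  have hle : (F.filter fun v => v (Fin.last n) = 0).card ≤ gVal n (l + 1) l := by
    have hinj : Set.InjOn (fun v : Fin (n + 1) → ℤ => (Fin.init v : Fin n → ℤ))
        (F.filter fun v => v (Fin.last n) = 0) := by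
      intro v hv w hw h
      have hv := (Finset.mem_filter.1 (Finset.mem_coe.1 hv)).2
      have hw := (Finset.mem_filter.1 (Finset.mem_coe.1 hw)).2
      rw [← Fin.snoc_init_self v, ← Fin.snoc_init_self w, hv, hw]
      exact congrArg (fun u => Fin.snoc (α := fun _ => ℤ) u 0) h
    rw [← Finset.card_image_of_injOn hinj]
    refine card_le_gVal ?_ ?_
    · rw [Finset.forall_mem_image]
      intro v hv
      obtain ⟨hv, hv0⟩ := Finset.mem_filter.1 hv
      exact (isPMVec_succ_zero hv0).1 (hF.isPMVec v hv)
    · simp only [Finset.forall_mem_image]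
      intro v hv w hw
      obtain ⟨hv, hv0⟩ := Finset.mem_filter.1 hv
      have := hF.dot v hv w (Finset.mem_filter.1 hw).1
      rwa [dotZ_succ, hv0, zero_mul, add_zero] at this
  have hD := hF.card_filter_last_ne_zero_le hl hn
  have hsplit := Finset.card_filter_add_card_filter_not (s := F) fun v => v (Fin.last n) = 0
  simp only [ne_eq] at hD
  omega

/-- The scalar product is bounded below by minus the number of coordinates of opposite sign. -/
theorem IsPMVec.neg_add_le_dotZ {n a b c d : ℕ} {v w : Fin n → ℤ} (hv : IsPMVec n a b v)
    (hw : IsPMVec n c d w) : -((b : ℤ) + d) ≤ dotZ v w := by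
  rw [← hv.2.2, ← hw.2.2, Finset.card_filter, Finset.card_filter, dotZ]
  push_cast
  rw [← Finset.sum_add_distrib, ← Finset.sum_neg_distrib]
  refine Finset.sum_le_sum fun i _ => ?_
  rcases hv.1 i with h | h | h <;> rcases hw.1 i with h' | h' | h' <;> simp [h, h']

theorem le_gVal_succ (hl : 1 ≤ l) :
    gVal n (l + 1) l + n.choose (2 * l) * (2 * l).choose (l - 1) ≤ gVal (n + 1) (l + 1) l := by
  classical
  obtain ⟨F, hpm, hdot, hcard⟩ := exists_card_eq_gVal n (l + 1) l
  obtain ⟨m, rfl⟩ : ∃ m, l = m + 1 := ⟨l - 1, by omega⟩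
  let e : (Fin n → ℤ) → Fin (n + 1) → ℤ := fun v => Fin.snoc (α := fun _ => ℤ) v 0
  have he0 : ∀ v, e v (Fin.last n) = 0 := fun v => Fin.snoc_last _ _
  have hei : ∀ v, Fin.init (e v) = v := fun v => Fin.init_snoc _ _
  have heinj : Function.Injective e := fun v w h => by rw [← hei v, h, hei]
  let G := (pmVecs (n + 1) (m + 1 + 1) (m + 1)).filter fun v => v (Fin.last n) = -1
  have hG : ∀ v ∈ G, IsPMVec (n + 1) (m + 1 + 1) (m + 1) v ∧ v (Fin.last n) = -1 := fun v hv =>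
    ⟨mem_pmVecs.1 (Finset.mem_filter.1 hv).1, (Finset.mem_filter.1 hv).2⟩
  have hdisj : Disjoint (F.image e) G := by
    rw [Finset.disjoint_left, Finset.forall_mem_image]
    intro v _ hv
    have := (hG _ hv).2
    rw [he0] at this
    omega
  have hcardG : G.card = n.choose (2 * (m + 1)) * (2 * (m + 1)).choose (m + 1 - 1) := by
    rw [card_filter_last_neg, Nat.add_sub_cancel, show m + 1 + 1 + m = 2 * (m + 1) by ring]
  have hFG : ∀ v ∈ F, ∀ w ∈ G, -2 * ((m + 1 : ℕ) : ℤ) < dotZ (e v) w := by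
    intro v hv w hw
    obtain ⟨hw, hw1⟩ := hG w hw
    have := (hpm v hv).neg_add_le_dotZ ((isPMVec_succ_neg hw1).1 hw)
    rw [dotZ_succ, he0, hei]
    push_cast at this ⊢
    linarith
  rw [← hcard, ← hcardG, ← Finset.card_image_of_injective F heinj,
    ← Finset.card_union_of_disjoint hdisj]
  refine card_le_gVal ?_ ?_
  · intro v hv
    rcases Finset.mem_union.1 hv with hv | hv
    · obtain ⟨u, hu, rfl⟩ := Finset.mem_image.1 hv
      rw [isPMVec_succ_zero (he0 u), hei]
      exact hpm u hu
    · exact (hG v hv).1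
  · intro v hv w hw
    rcases Finset.mem_union.1 hv with hv | hv <;> rcases Finset.mem_union.1 hw with hw | hw
    · obtain ⟨u, hu, rfl⟩ := Finset.mem_image.1 hv
      obtain ⟨t, ht, rfl⟩ := Finset.mem_image.1 hw
      rw [dotZ_succ, he0, zero_mul, add_zero, hei, hei]
      exact hdot u hu t ht
    · obtain ⟨u, hu, rfl⟩ := Finset.mem_image.1 hv
      exact hFG u hu w hw
    · obtain ⟨t, ht, rfl⟩ := Finset.mem_image.1 hw
      rw [dotZ_comm]
      exact hFG t ht v hv
    · obtain ⟨hv, hv1⟩ := hG v hv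
      obtain ⟨hw, hw1⟩ := hG w hw
      have := ((isPMVec_succ_neg hv1).1 hv).neg_add_le_dotZ ((isPMVec_succ_neg hw1).1 hw)
      rw [dotZ_succ, hv1, hw1]
      push_cast at this ⊢
      linarith

end Extremal

/-- For integers `l ≥ 1`, `k = l + 1` and `n ≥ 2k³`,
one has `g(n+1,k,l) - g(n,k,l) = C(n,k+l-1)·C(k+l-1,l-1)`. -/
theorem stmt_6 (k l n : ℕ) (hl : 1 ≤ l) (hlk : k = l + 1) (hn : 2 * k ^ 3 ≤ n) :
    gVal (n + 1) k l =
      gVal n k l + Nat.choose n (k + l - 1) * Nat.choose (k + l - 1) (l - 1) := by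
  subst hlk
  have hn : 6 * l ≤ n := by nlinarith [Nat.zero_le (l ^ 3), Nat.zero_le (l ^ 2)]
  rw [show l + 1 + l - 1 = 2 * l by omega]
  exact le_antisymm (gVal_succ_le hl hn) (le_gVal_succ hl)
end

section
/- Let k > ℓ ≥ 1 be integers and set n₀ = (k+ℓ)·2^{k+ℓ+2}. For every integer n ≥ 3n₀, one has m(n,k,ℓ) = p(n,k,ℓ). -/
/-- `m(n,k,l)`: the maximum size of a family `V ⊆ V(n,k,l)` with
`⟨v,w⟩ ≥ 0` for all `v, w ∈ V`. -/
noncomputable def mVal (n k l : ℕ) : ℕ :=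
  sSup {m | ∃ F : Finset (Fin n → ℤ),
    (∀ v ∈ F, IsPMVec n k l v) ∧
    (∀ v ∈ F, ∀ w ∈ F, 0 ≤ dotZ v w) ∧ F.card = m}

/-- `p(n,k,l) = max_{0 ≤ x ≤ n} C(x,k)·C(n-x,l)`. -/
def pVal (n k l : ℕ) : ℕ :=
  (Finset.range (n + 1)).sup fun x => Nat.choose x k * Nat.choose (n - x) l

theorem three_pow_mul_choose_le (a r : ℕ) : 3 ^ r * a.choose r ≤ (3 * a).choose r := by
  have key : 3 ^ r * a.descFactorial r ≤ (3 * a).descFactorial r := by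
    induction r with
    | zero => simp
    | succ r ih =>
      rw [Nat.descFactorial_succ, Nat.descFactorial_succ, pow_succ]
      calc 3 ^ r * 3 * ((a - r) * a.descFactorial r)
          = (3 * (a - r)) * (3 ^ r * a.descFactorial r) := by ring
        _ ≤ (3 * a - r) * (3 * a).descFactorial r := Nat.mul_le_mul (by omega) ih
  rw [Nat.descFactorial_eq_factorial_mul_choose, Nat.descFactorial_eq_factorial_mul_choose] at key
  refine Nat.le_of_mul_le_mul_left ?_ (Nat.factorial_pos r)
  linarith

theorem le_pVal {n k l x : ℕ} (hx : x ≤ n) : x.choose k * (n - x).choose l ≤ pVal n k l :=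
  Finset.le_sup (f := fun x => Nat.choose x k * Nat.choose (n - x) l)
    (Finset.mem_range.2 (Nat.lt_succ_of_le hx))

theorem exists_pVal_eq (n k l : ℕ) :
    ∃ x ≤ n, pVal n k l = x.choose k * (n - x).choose l := by
  obtain ⟨x, hx, h⟩ := Finset.exists_mem_eq_sup (Finset.range (n + 1)) (by simp)
    fun x => Nat.choose x k * Nat.choose (n - x) l
  exact ⟨x, Nat.lt_succ_iff.1 (Finset.mem_range.1 hx), h⟩

theorem pVal_mul_le_pVal_succ_mul {m k l : ℕ} (hm : k + l ≤ m + 2) :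
    pVal m k l * (m + 2) ≤ pVal (m + 1) k l * (m + 2 - (k + l)) := by
  obtain ⟨x, hx, h⟩ := exists_pVal_eq m k l
  obtain ⟨y, rfl⟩ := Nat.exists_eq_add_of_le hx
  rw [Nat.add_sub_cancel_left] at h
  rcases Nat.lt_or_ge x k with hk | hk
  · simp [h, Nat.choose_eq_zero_of_lt hk]
  rcases Nat.lt_or_ge y l with hl | hl
  · simp [h, Nat.choose_eq_zero_of_lt hl]
  have h1 : (x + 1).choose k * y.choose l ≤ pVal (x + y + 1) k l := by
    simpa [show x + y + 1 - (x + 1) = y by omega] using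
      le_pVal (n := x + y + 1) (k := k) (l := l) (x := x + 1) (by omega)
  have h2 : x.choose k * (y + 1).choose l ≤ pVal (x + y + 1) k l := by
    simpa [show x + y + 1 - x = y + 1 by omega] using
      le_pVal (n := x + y + 1) (k := k) (l := l) (x := x) (by omega)
  have e1 := Nat.choose_mul_succ_eq x k
  have e2 := Nat.choose_mul_succ_eq y l
  rw [h]
  obtain ⟨a, rfl⟩ := Nat.exists_eq_add_of_le hk
  obtain ⟨b, rfl⟩ := Nat.exists_eq_add_of_le hl
  rw [show k + a + 1 - k = a + 1 by omega] at e1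
  rw [show l + b + 1 - l = b + 1 by omega] at e2
  rw [show k + a + (l + b) + 2 - (k + l) = a + b + 2 by omega]
  generalize pVal (k + a + (l + b) + 1) k l = p at *
  generalize (k + a).choose k = c at *
  generalize (l + b).choose l = d at *
  generalize (k + a + 1).choose k = c' at *
  generalize (l + b + 1).choose l = d' at *
  rcases le_total (k * (l + b + 1)) (l * (k + a + 1)) with hc | hc
  · refine Nat.le_of_mul_le_mul_right (c := b + 1) ?_ (by omega)
    calc c * d * (k + a + (l + b) + 2) * (b + 1)
        = c * d * ((k + a + (l + b) + 2) * (b + 1)) := by ring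
      _ ≤ c * d * ((l + b + 1) * (a + b + 2)) := Nat.mul_le_mul_left _ (by nlinarith)
      _ = c * (d * (l + b + 1)) * (a + b + 2) := by ring
      _ = (c * d') * (a + b + 2) * (b + 1) := by rw [e2]; ring
      _ ≤ p * (a + b + 2) * (b + 1) := by gcongr
  · refine Nat.le_of_mul_le_mul_right (c := a + 1) ?_ (by omega)
    calc c * d * (k + a + (l + b) + 2) * (a + 1)
        = c * d * ((k + a + (l + b) + 2) * (a + 1)) := by ring
      _ ≤ c * d * ((k + a + 1) * (a + b + 2)) := Nat.mul_le_mul_left _ (by nlinarith)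
      _ = d * (c * (k + a + 1)) * (a + b + 2) := by ring
      _ = (c' * d) * (a + b + 2) * (a + 1) := by rw [e1]; ring
      _ ≤ p * (a + b + 2) * (a + 1) := by gcongr

theorem choose_mul_choose_le_two_pow_mul_pVal {n k l : ℕ} (hn : k + l ≤ n) :
    n.choose (k + l) * (k + l).choose l ≤ 2 ^ (k + l) * pVal n k l := by
  obtain ⟨d, rfl⟩ := Nat.exists_eq_add_of_le hn
  have hterm : ∀ y ∈ Finset.range (d + 1),
      (k + l + d).choose (k + l) * (k + l).choose l * d.choose y
        = (k + l + d).choose (k + y) * ((k + y).choose k * (k + l + d - (k + y)).choose l) := by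
    intro y hy
    obtain ⟨z, rfl⟩ := Nat.exists_eq_add_of_le (Nat.lt_succ_iff.1 (Finset.mem_range.1 hy))
    rw [show k + l + (y + z) - (k + y) = l + z by omega]
    have f : ∀ a b : ℕ, (a + b).choose a * a.factorial * b.factorial = (a + b).factorial := by
      intro a b
      rw [Nat.choose_symm_add]
      exact Nat.add_choose_mul_factorial_mul_factorial a b
    have f1 := f (k + l) (y + z)
    have f2 := Nat.add_choose_mul_factorial_mul_factorial k l
    have f3 := f y z
    have f4 := f (k + y) (l + z)
    have f5 := f k y
    have f6 := f l z
    rw [show k + y + (l + z) = k + l + (y + z) by ring] at f4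
    have hk := Nat.factorial_pos k
    have hl := Nat.factorial_pos l
    have hy := Nat.factorial_pos y
    have hz := Nat.factorial_pos z
    refine Nat.eq_of_mul_eq_mul_right (mul_pos (mul_pos hk hl) (mul_pos hy hz)) ?_
    calc _ = (k + l + (y + z)).choose (k + l)
            * ((k + l).choose l * k.factorial * l.factorial)
            * ((y + z).choose y * y.factorial * z.factorial) := by ring
      _ = (k + l + (y + z)).choose (k + y)
            * ((k + y).choose k * k.factorial * y.factorial)
            * ((l + z).choose l * l.factorial * z.factorial) := by
          rw [f2, f3, f5, f6, f1, f4]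
      _ = _ := by ring
  have hsum : (k + l + d).choose (k + l) * (k + l).choose l * 2 ^ d
      ≤ 2 ^ (k + l + d) * pVal (k + l + d) k l := by
    rw [← Nat.sum_range_choose d, Finset.mul_sum, Finset.sum_congr rfl hterm,
      ← Nat.sum_range_choose (k + l + d), Finset.sum_mul]
    refine (Finset.sum_le_sum (g := fun y => (k + l + d).choose (k + y) * pVal (k + l + d) k l)
      fun y hy => Nat.mul_le_mul_left _ (le_pVal ?_)).trans ?_
    · have := Finset.mem_range.1 hy
      omega
    · rw [← Finset.sum_image (s := Finset.range (d + 1)) (g := fun y => k + y)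
        (f := fun x => (k + l + d).choose x * pVal (k + l + d) k l)
        (fun a _ b _ h => by simpa using h)]
      refine Finset.sum_le_sum_of_subset fun x hx => ?_
      simp only [Finset.mem_image, Finset.mem_range] at hx ⊢
      omega
  refine Nat.le_of_mul_le_mul_right (c := 2 ^ d) ?_ (by positivity)
  rw [pow_add] at hsum
  linarith

theorem sub_one_mul_sub_two_le_two_pow (r : ℕ) : (r - 1) * (r - 2) ≤ 2 ^ r := by
  induction r using Nat.strong_induction_on with
  | _ r ih =>
    rcases Nat.lt_or_ge r 5 with h | h
    · interval_cases r <;> simp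
    · obtain ⟨s, rfl⟩ := Nat.exists_eq_add_of_le h
      have := ih (4 + s) (by omega)
      rw [show 5 + s = (4 + s) + 1 by ring, pow_succ]
      rw [show 4 + s - 1 = s + 3 by omega, show 4 + s - 2 = s + 2 by omega] at this
      rw [show 4 + s + 1 - 1 = s + 4 by omega, show 4 + s + 1 - 2 = s + 3 by omega]
      nlinarith

theorem degree_bound_le_pVal_sub {m k l : ℕ} (hr : 3 ≤ k + l)
    (hm : (k + l) * 2 ^ (k + l + 2) ≤ m) :
    8 * (2 * ((m - 2).choose (k + l - 2) * (k + l).choose l)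
      + 2 * (k + l - 1) ^ 2 * ((m - 3).choose (k + l - 3) * (k + l).choose l))
      + 5 * pVal (m - 1) k l ≤ 5 * pVal m k l := by
  have h2 : (k + l) * 4 ≤ (k + l) * 2 ^ (k + l + 2) :=
    Nat.mul_le_mul_left _ (by rw [pow_add]; nlinarith [Nat.one_le_two_pow (n := k + l)])
  have hlow := choose_mul_choose_le_two_pow_mul_pVal (n := m) (k := k) (l := l) (by omega)
  have hsub := sub_one_mul_sub_two_le_two_pow (k + l)
  have hmono := pVal_mul_le_pVal_succ_mul (m := m - 1) (k := k) (l := l) (by omega)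
  obtain ⟨r, hr'⟩ : ∃ r, k + l = r + 3 := ⟨k + l - 3, by omega⟩
  obtain ⟨s, rfl⟩ : ∃ s, m = s + (r + 3) := ⟨m - (r + 3), by omega⟩
  rw [hr'] at hm hlow hsub hmono ⊢
  clear h2 hr
  rw [show s + (r + 3) - 1 + 2 = s + r + 4 by omega, show s + (r + 3) - 1 + 1 = s + (r + 3) by omega,
    show s + r + 4 - (r + 3) = s + 1 by omega] at hmono
  have e3 := Nat.add_one_mul_choose_eq (s + r) r
  have e2 := Nat.add_one_mul_choose_eq (s + r + 1) (r + 1)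
  have e1 := Nat.add_one_mul_choose_eq (s + r + 2) (r + 2)
  rw [show s + (r + 3) - 2 = s + r + 1 by omega, show s + (r + 3) - 3 = s + r by omega,
    show r + 3 - 2 = r + 1 by omega, show r + 3 - 3 = r by omega, show r + 3 - 1 = r + 2 by omega]
  rw [show r + 3 - 2 = r + 1 by omega, show r + 3 - 1 = r + 2 by omega] at hsub
  simp only [show s + r + 1 + 1 = s + r + 2 by ring, show s + r + 2 + 1 = s + (r + 3) by ring,
    show r + 1 + 1 = r + 2 by ring, show r + 2 + 1 = r + 3 by ring] at e1 e2
  rw [show r + 3 + 2 = (r + 3) + 2 by ring, pow_add] at hm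
  generalize pVal (s + (r + 3) - 1) k l = p' at *
  generalize pVal (s + (r + 3)) k l = p at *
  generalize (s + r).choose r = c3 at *
  generalize (s + r + 1).choose (r + 1) = c2 at *
  generalize (s + r + 2).choose (r + 2) = c1 at *
  generalize (s + (r + 3)).choose (r + 3) = c at *
  generalize (r + 3).choose l = q at *
  have hEpos : 0 < 2 ^ (r + 3) := by positivity
  generalize 2 ^ (r + 3) = E at *
  have hE : 4 * (r + 2) * E ≤ s + r + 1 := by nlinarith
  have ht : 4 * (r + 2) ^ 2 * c3 ≤ c2 := by
    refine Nat.le_of_mul_le_mul_left (c := s + r + 1) ?_ (by omega)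
    calc (s + r + 1) * (4 * (r + 2) ^ 2 * c3) = 4 * (r + 2) ^ 2 * ((s + r + 1) * c3) := by ring
      _ = 4 * (r + 2) * ((r + 2) * (r + 1)) * c2 := by rw [e3]; ring
      _ ≤ 4 * (r + 2) * E * c2 := by gcongr
      _ ≤ (s + r + 1) * c2 := by gcongr
  have hp : p' + 4 * (c2 * q) ≤ p := by
    have hd : (s + r + 4) * p' + (r + 3) * p ≤ (s + r + 4) * p := by nlinarith
    have hcc : (s + (r + 3)) * ((s + r + 2) * c2) = (r + 2) * ((r + 3) * c) := by
      rw [e2, mul_left_comm, mul_comm (r + 2), mul_comm (r + 3), ← e1]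
      ring
    have h5 : (s + r + 4) * (s + r + 1) * (c2 * q) ≤ (r + 2) * E * ((r + 3) * p) := by
      calc (s + r + 4) * (s + r + 1) * (c2 * q)
          ≤ (s + (r + 3)) * (s + r + 2) * (c2 * q) := Nat.mul_le_mul_right _ (by nlinarith)
        _ = (s + (r + 3)) * ((s + r + 2) * c2) * q := by ring
        _ = (r + 2) * (r + 3) * (c * q) := by rw [hcc]; ring
        _ ≤ (r + 2) * (r + 3) * (E * p) := by gcongr
        _ = _ := by ring
    have h6 : (s + r + 4) * (4 * (r + 2) * E) * (c2 * q) ≤ (r + 2) * E * ((r + 3) * p) :=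
      le_trans (by gcongr) h5
    have h7 : (s + r + 4) * (4 * (c2 * q)) ≤ (r + 3) * p := by
      refine Nat.le_of_mul_le_mul_left (c := (r + 2) * E) ?_ (by positivity)
      linarith
    refine Nat.le_of_mul_le_mul_left (c := s + r + 4) ?_ (by omega)
    linarith
  nlinarith [Nat.mul_le_mul_right q ht]

theorem terminal_bound {n k l n₀ : ℕ} (hr : 3 ≤ k + l) (hn₀ : k + l ≤ n₀) (hn : 3 * n₀ ≤ n) :
    8 * (n₀.choose (k + l) * (k + l).choose l) ≤ 3 * pVal n k l := by
  have h1 := three_pow_mul_choose_le n₀ (k + l)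
  have h2 : (3 * n₀).choose (k + l) ≤ n.choose (k + l) := Nat.choose_le_choose _ hn
  have h3 := choose_mul_choose_le_two_pow_mul_pVal (n := n) (k := k) (l := l) (by omega)
  obtain ⟨r, hr'⟩ : ∃ r, k + l = r + 3 := ⟨k + l - 3, by omega⟩
  rw [hr'] at h1 h2 h3 ⊢
  have h4 : 2 ^ r ≤ 3 ^ r := Nat.pow_le_pow_left (by norm_num) r
  have h5 : 3 ^ (r + 3) * (n₀.choose (r + 3) * (r + 3).choose l) ≤ 2 ^ (r + 3) * pVal n k l := by
    refine le_trans ?_ h3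
    rw [← mul_assoc]
    exact Nat.mul_le_mul_right _ (h1.trans h2)
  generalize n₀.choose (r + 3) * (r + 3).choose l = Q at *
  generalize pVal n k l = p at *
  have h6 : 3 ^ r * (27 * Q) ≤ 3 ^ r * (8 * p) := by
    calc 3 ^ r * (27 * Q) = 3 ^ (r + 3) * Q := by ring
      _ ≤ 2 ^ (r + 3) * p := h5
      _ = 2 ^ r * (8 * p) := by ring
      _ ≤ _ := by gcongr
  have := Nat.le_of_mul_le_mul_left h6 (by positivity)
  omega

/-- The set of coordinates at which `v` does not vanish. -/
def nzSupport {n : ℕ} (v : Fin n → ℤ) : Finset (Fin n) :=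
  Finset.univ.filter fun i => v i ≠ 0

theorem mem_nzSupport {n : ℕ} {v : Fin n → ℤ} {i : Fin n} : i ∈ nzSupport v ↔ v i ≠ 0 := by
  simp [nzSupport]

theorem IsPMVec.card_nzSupport {n k l : ℕ} {v : Fin n → ℤ} (hv : IsPMVec n k l v) :
    (nzSupport v).card = k + l := by
  obtain ⟨h, hk, hl⟩ := hv
  rw [← hk, ← hl, ← Finset.card_union_of_disjoint]
  · congr 1
    ext i
    simp only [mem_nzSupport, Finset.mem_union, Finset.mem_filter, Finset.mem_univ, true_and]
    rcases h i with h | h | h <;> simp [h]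
  · rw [Finset.disjoint_filter]
    intro i _ h1 h2
    omega

theorem IsPMVec.ext_of_filter_eq {n k l : ℕ} {v w : Fin n → ℤ} (hv : IsPMVec n k l v)
    (hw : IsPMVec n k l w) (h₁ : ∀ i, v i = 1 ↔ w i = 1) (h₂ : ∀ i, v i = -1 ↔ w i = -1) :
    v = w := by
  funext i
  have := hv.1 i
  have := hw.1 i
  have := h₁ i
  have := h₂ i
  omega

theorem card_image_nzSupport_le {n k l : ℕ} {X T : Finset (Fin n)} {W : Finset (Fin n → ℤ)}
    (hW : ∀ v ∈ W, IsPMVec n k l v ∧ nzSupport v ⊆ X ∧ T ⊆ nzSupport v) :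
    (W.image nzSupport).card ≤ (X.card - T.card).choose (k + l - T.card) := by
  rcases W.eq_empty_or_nonempty with rfl | ⟨w, hw⟩
  · simp
  have hTX : T ⊆ X := (hW w hw).2.2.trans (hW w hw).2.1
  rw [← Finset.card_sdiff_of_subset hTX, ← Finset.card_powersetCard]
  refine Finset.card_le_card_of_injOn (fun S => S \ T) ?_ ?_
  · intro S hS
    obtain ⟨v, hv, rfl⟩ := Finset.mem_image.1 hS
    obtain ⟨h1, h2, h3⟩ := hW v hv
    refine Finset.mem_coe.2 (Finset.mem_powersetCard.2 ⟨Finset.sdiff_subset_sdiff h2 le_rfl,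
      by rw [Finset.card_sdiff_of_subset h3, h1.card_nzSupport]⟩)
  · intro S hS S' hS' h
    obtain ⟨v, hv, rfl⟩ := Finset.mem_image.1 hS
    obtain ⟨v', hv', rfl⟩ := Finset.mem_image.1 hS'
    have h3 := (hW v hv).2.2
    have h3' := (hW v' hv').2.2
    rw [← Finset.sdiff_union_of_subset h3, ← Finset.sdiff_union_of_subset h3']
    exact congrArg (· ∪ T) h

theorem card_le_choose_mul_choose {n k l : ℕ} {X T : Finset (Fin n)} {W : Finset (Fin n → ℤ)}
    (hW : ∀ v ∈ W, IsPMVec n k l v ∧ nzSupport v ⊆ X ∧ T ⊆ nzSupport v) :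
    W.card ≤ (X.card - T.card).choose (k + l - T.card) * (k + l).choose l := by
  rw [mul_comm]
  refine (Finset.card_le_mul_card_image (f := nzSupport) W ((k + l).choose l) ?_).trans
    (Nat.mul_le_mul_left _ (card_image_nzSupport_le hW))
  intro S hS
  obtain ⟨u, hu, rfl⟩ := Finset.mem_image.1 hS
  rw [← Nat.choose_symm_add, ← (hW u hu).1.card_nzSupport, ← Finset.card_powersetCard]
  refine Finset.card_le_card_of_injOn (fun v => Finset.univ.filter fun i => v i = 1) ?_ ?_
  · intro v hv
    obtain ⟨hv, hs⟩ := Finset.mem_filter.1 hv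
    refine Finset.mem_coe.2 (Finset.mem_powersetCard.2 ⟨fun i hi => ?_, (hW v hv).1.2.1⟩)
    rw [← hs, mem_nzSupport, (Finset.mem_filter.1 hi).2]
    exact one_ne_zero
  · intro v hv w hw h
    obtain ⟨hv, hs⟩ := Finset.mem_filter.1 hv
    obtain ⟨hw, hs'⟩ := Finset.mem_filter.1 hw
    have h1 : ∀ i, v i = 1 ↔ w i = 1 := fun i => by simpa using Finset.ext_iff.1 h i
    have h0 : ∀ i, v i ≠ 0 ↔ w i ≠ 0 := fun i => by
      rw [← mem_nzSupport, ← mem_nzSupport, hs, hs']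
    refine (hW v hv).1.ext_of_filter_eq (hW w hw).1 h1 fun i => ?_
    have := (hW v hv).1.1 i
    have := (hW w hw).1.1 i
    have := h1 i
    have := h0 i
    omega

/-- A family of `{0,1,-1}`-vectors supported in `X` such that any two members with opposite
nonzero entries at some coordinate also have equal nonzero entries at some coordinate. -/
structure IsMeetingFamily (n k l : ℕ) (X : Finset (Fin n)) (V : Finset (Fin n → ℤ)) : Prop where
  isPMVec : ∀ v ∈ V, IsPMVec n k l v
  subset : ∀ v ∈ V, nzSupport v ⊆ X
  meet : ∀ v ∈ V, ∀ w ∈ V, ∀ i, v i ≠ 0 → w i = -v i → ∃ j, v j ≠ 0 ∧ w j = v j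

theorem exists_ne_zero_eq_of_dotZ_nonneg {n k l : ℕ} {v w : Fin n → ℤ} (hv : IsPMVec n k l v)
    (hw : IsPMVec n k l w) (h : 0 ≤ dotZ v w) {i : Fin n} (hi : v i ≠ 0) (hwi : w i = -v i) :
    ∃ j, v j ≠ 0 ∧ w j = v j := by
  by_contra! hne
  refine absurd h (not_le.2 ?_)
  refine Finset.sum_neg' (fun j _ => ?_) ⟨i, Finset.mem_univ i, ?_⟩
  · have := hne j
    rcases hv.1 j with h1 | h1 | h1 <;> rcases hw.1 j with h2 | h2 | h2 <;> simp_all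
  · rw [hwi]
    nlinarith [mul_self_pos.2 hi]

theorem isMeetingFamily_of_dotZ_nonneg {n k l : ℕ} {V : Finset (Fin n → ℤ)}
    (hV : ∀ v ∈ V, IsPMVec n k l v) (h : ∀ v ∈ V, ∀ w ∈ V, 0 ≤ dotZ v w) :
    IsMeetingFamily n k l Finset.univ V where
  isPMVec := hV
  subset _ _ := Finset.subset_univ _
  meet v hv w hw _ hi hwi :=
    exists_ne_zero_eq_of_dotZ_nonneg (hV v hv) (hV w hw) (h v hv w hw) hi hwi

namespace IsMeetingFamily

variable {n k l : ℕ} {X : Finset (Fin n)} {V : Finset (Fin n → ℤ)}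

theorem card_filter_subset_le (h : IsMeetingFamily n k l X V) (T : Finset (Fin n)) :
    (V.filter fun v => T ⊆ nzSupport v).card
      ≤ (X.card - T.card).choose (k + l - T.card) * (k + l).choose l :=
  card_le_choose_mul_choose fun v hv =>
    have hv := Finset.mem_filter.1 hv
    ⟨h.isPMVec v hv.1, h.subset v hv.1, hv.2⟩

theorem card_le (h : IsMeetingFamily n k l X V) :
    V.card ≤ X.card.choose (k + l) * (k + l).choose l := by
  simpa using h.card_filter_subset_le ∅

theorem card_filter_pair_le (h : IsMeetingFamily n k l X V) {i j : Fin n} (hij : i ≠ j) :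
    (V.filter fun v => v i ≠ 0 ∧ v j ≠ 0).card
      ≤ (X.card - 2).choose (k + l - 2) * (k + l).choose l := by
  simpa [Finset.card_pair hij, Finset.insert_subset_iff, mem_nzSupport]
    using h.card_filter_subset_le {i, j}

theorem card_filter_triple_le (h : IsMeetingFamily n k l X V) {i j j' : Fin n} (hij : i ≠ j)
    (hij' : i ≠ j') (hjj' : j ≠ j') :
    (V.filter fun v => v i ≠ 0 ∧ v j ≠ 0 ∧ v j' ≠ 0).card
      ≤ (X.card - 3).choose (k + l - 3) * (k + l).choose l := by
  simpa [Finset.card_eq_three.2 ⟨i, j, j', hij, hij', hjj', rfl⟩, Finset.insert_subset_iff,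
    mem_nzSupport] using h.card_filter_subset_le {i, j, j'}

theorem erase (h : IsMeetingFamily n k l X V) (i : Fin n) :
    IsMeetingFamily n k l (X.erase i) (V.filter fun v => v i = 0) where
  isPMVec v hv := h.isPMVec v (Finset.mem_filter.1 hv).1
  subset v hv j hj := by
    obtain ⟨hv, hi⟩ := Finset.mem_filter.1 hv
    refine Finset.mem_erase.2 ⟨?_, h.subset v hv hj⟩
    rintro rfl
    exact mem_nzSupport.1 hj hi
  meet v hv w hw := h.meet v (Finset.mem_filter.1 hv).1 w (Finset.mem_filter.1 hw).1

/-- If no two members have opposite nonzero entries at a coordinate, the family has the size of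
at most a partition family. -/
theorem card_le_pVal (h : IsMeetingFamily n k l X V)
    (hV : ∀ v ∈ V, ∀ w ∈ V, ∀ i, v i ≠ 0 → w i ≠ -v i) : V.card ≤ pVal X.card k l := by
  classical
  set P := X.filter fun i => ∃ v ∈ V, v i = 1
  have hPX : P ⊆ X := Finset.filter_subset _ _
  refine le_trans ?_ (le_pVal (Finset.card_le_card hPX))
  rw [← Finset.card_sdiff_of_subset hPX, ← Finset.card_powersetCard k P,
    ← Finset.card_powersetCard l (X \ P), ← Finset.card_product]
  refine Finset.card_le_card_of_injOn
    (fun v => (Finset.univ.filter fun i => v i = 1, Finset.univ.filter fun i => v i = -1)) ?_ ?_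
  · intro v hv
    have hX : ∀ i, v i ≠ 0 → i ∈ X := fun i hi => h.subset v hv (mem_nzSupport.2 hi)
    refine Finset.mem_coe.2 (Finset.mem_product.2 ⟨Finset.mem_powersetCard.2 ⟨fun i hi => ?_,
      (h.isPMVec v hv).2.1⟩, Finset.mem_powersetCard.2 ⟨fun i hi => ?_, (h.isPMVec v hv).2.2⟩⟩)
    · have hi := (Finset.mem_filter.1 hi).2
      exact Finset.mem_filter.2 ⟨hX i (by omega), v, hv, hi⟩
    · have hi := (Finset.mem_filter.1 hi).2
      refine Finset.mem_sdiff.2 ⟨hX i (by omega), fun hiP => ?_⟩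
      obtain ⟨-, w, hw, hwi⟩ := Finset.mem_filter.1 hiP
      exact hV v hv w hw i (by omega) (by omega)
  · intro v hv w hw hvw
    obtain ⟨h1, h2⟩ := Prod.mk.inj hvw
    exact (h.isPMVec v hv).ext_of_filter_eq (h.isPMVec w hw)
      (fun i => by simpa using Finset.ext_iff.1 h1 i)
      (fun i => by simpa using Finset.ext_iff.1 h2 i)

/-- If `V` contains a vector with entry `σ ≠ 0` at `i`, either the vectors with entry `σ` at `i`
have two further common support elements, so that there are few of them, or there are few
vectors with entry `-σ` at `i`. -/
theorem card_filter_le_or_card_filter_neg_le (h : IsMeetingFamily n k l X V) {i : Fin n} {σ : ℤ}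
    (hσ : σ ≠ 0) {w : Fin n → ℤ} (hw : w ∈ V) (hwi : w i = σ) :
    (V.filter fun v => v i = σ).card ≤ (X.card - 3).choose (k + l - 3) * (k + l).choose l ∨
    (V.filter fun v => v i = -σ).card ≤ (X.card - 2).choose (k + l - 2) * (k + l).choose l
      + (k + l - 1) ^ 2 * ((X.card - 3).choose (k + l - 3) * (k + l).choose l) := by
  classical
  set A := (X.card - 2).choose (k + l - 2) * (k + l).choose l
  set B := (X.card - 3).choose (k + l - 3) * (k + l).choose l
  set K := Finset.univ.filter fun j => j ≠ i ∧ ∀ v ∈ V, v i = σ → v j ≠ 0 with hK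
  rcases Nat.lt_or_ge 1 K.card with hcard | hcard
  · left
    obtain ⟨j, hj, j', hj', hjj'⟩ := Finset.one_lt_card.1 hcard
    simp only [hK, Finset.mem_filter, Finset.mem_univ, true_and] at hj hj'
    refine (Finset.card_le_card fun v hv => ?_).trans
      (h.card_filter_triple_le hj.1.symm hj'.1.symm hjj')
    obtain ⟨hv, hvi⟩ := Finset.mem_filter.1 hv
    exact Finset.mem_filter.2 ⟨hv, by rwa [hvi], hj.2 v hv hvi, hj'.2 v hv hvi⟩
  · right
    have havoid : ∀ j, ∃ u, j ≠ i → j ∉ K → u ∈ V ∧ u i = σ ∧ u j = 0 := by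
      intro j
      by_cases hj : j ≠ i ∧ j ∉ K
      · have hjK := hj.2
        simp only [hK, Finset.mem_filter, Finset.mem_univ, true_and] at hjK
        push Not at hjK
        obtain ⟨u, hu⟩ := hjK hj.1
        exact ⟨u, fun _ _ => hu⟩
      · exact ⟨0, fun h1 h2 => absurd ⟨h1, h2⟩ hj⟩
    choose u hu using havoid
    have hcover : (V.filter fun v => v i = -σ) ⊆
        (K.biUnion fun j => V.filter fun v => v i ≠ 0 ∧ v j ≠ 0) ∪
        (((nzSupport w).erase i \ K).biUnion fun j => ((nzSupport (u j)).erase i).biUnion fun j' =>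
          V.filter fun v => v i ≠ 0 ∧ v j ≠ 0 ∧ v j' ≠ 0) := by
      intro v hv
      obtain ⟨hv, hvi⟩ := Finset.mem_filter.1 hv
      have hmeet : ∀ x ∈ V, x i = σ → ∃ j, j ≠ i ∧ x j ≠ 0 ∧ v j ≠ 0 := by
        intro x hx hxi
        obtain ⟨j, hj, hvj⟩ := h.meet x hx v hv i (by rwa [hxi]) (by rw [hvi, hxi])
        refine ⟨j, ?_, hj, by rwa [hvj]⟩
        rintro rfl
        omega
      have hv0 : v i ≠ 0 := by omega
      obtain ⟨j, hji, hwj, hvj⟩ := hmeet w hw hwi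
      by_cases hjK : j ∈ K
      · exact Finset.mem_union_left _ (Finset.mem_biUnion.2
          ⟨j, hjK, Finset.mem_filter.2 ⟨hv, hv0, hvj⟩⟩)
      · obtain ⟨huV, hui, -⟩ := hu j hji hjK
        obtain ⟨j', hji', huj', hvj'⟩ := hmeet (u j) huV hui
        exact Finset.mem_union_right _ (Finset.mem_biUnion.2 ⟨j,
          Finset.mem_sdiff.2 ⟨Finset.mem_erase.2 ⟨hji, mem_nzSupport.2 hwj⟩, hjK⟩,
          Finset.mem_biUnion.2 ⟨j', Finset.mem_erase.2 ⟨hji', mem_nzSupport.2 huj'⟩,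
            Finset.mem_filter.2 ⟨hv, hv0, hvj, hvj'⟩⟩⟩)
    have hcardErase : ∀ x ∈ V, x i = σ → ((nzSupport x).erase i).card = k + l - 1 := by
      intro x hx hxi
      rw [Finset.card_erase_of_mem (mem_nzSupport.2 (by rwa [hxi])),
        (h.isPMVec x hx).card_nzSupport]
    refine (Finset.card_le_card hcover).trans ((Finset.card_union_le _ _).trans
      (Nat.add_le_add ?_ ?_))
    · refine (Finset.card_biUnion_le_card_mul _ _ A fun j hj => ?_).trans
        (by simpa using Nat.mul_le_mul_right A hcard)
      exact h.card_filter_pair_le (Finset.mem_filter.1 hj).2.1.symm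
    · rw [pow_two, mul_assoc]
      refine (Finset.card_biUnion_le_card_mul _ _ ((k + l - 1) * B) fun j hj => ?_).trans
        (Nat.mul_le_mul_right _ ?_)
      · obtain ⟨hj, hjK⟩ := Finset.mem_sdiff.1 hj
        have hji := (Finset.mem_erase.1 hj).1
        obtain ⟨huV, hui, huj⟩ := hu j hji hjK
        rw [← hcardErase (u j) huV hui]
        refine Finset.card_biUnion_le_card_mul _ _ B fun j' hj' => ?_
        obtain ⟨hji', hj'⟩ := Finset.mem_erase.1 hj'
        refine h.card_filter_triple_le hji.symm hji'.symm ?_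
        rintro rfl
        exact mem_nzSupport.1 hj' huj
      · rw [← hcardErase w hw hwi]
        exact Finset.card_le_card Finset.sdiff_subset

/-- If at every coordinate of `I` one sign is rare, and `I` contains all coordinates at which
both signs occur, then some coordinate of `I` lies in few supports. -/
theorem exists_card_filter_le_of_rare (h : IsMeetingFamily n k l X V) {I : Finset (Fin n)}
    (hI : I.Nonempty) {σ : Fin n → ℤ} {B : ℕ} (hσ : ∀ i ∈ I, σ i = 1 ∨ σ i = -1)
    (hne : ∀ i ∈ I, ∃ w ∈ V, w i = σ i)
    (hrare : ∀ i ∈ I, (V.filter fun v => v i = σ i).card ≤ B)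
    (hclash : ∀ v ∈ V, ∀ w ∈ V, ∀ i, v i ≠ 0 → w i = -v i → i ∈ I) :
    ∃ i ∈ I, (V.filter fun v => v i ≠ 0).card
      ≤ (k + l - 1) * (X.card - 2).choose (k + l - 2) + (k + l) * B := by
  classical
  set U := V.filter fun v => ∃ i ∈ I, v i = σ i
  have hUcard : U.card ≤ I.card * B := by
    refine (Finset.card_le_card (t := I.biUnion fun i => V.filter fun v => v i = σ i)
      fun v hv => ?_).trans (Finset.card_biUnion_le_card_mul _ _ B hrare)
    obtain ⟨hv, i, hi, hvi⟩ := Finset.mem_filter.1 hv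
    exact Finset.mem_biUnion.2 ⟨i, hi, Finset.mem_filter.2 ⟨hv, hvi⟩⟩
  have hsum : ∑ i ∈ I, (U.filter fun v => v i ≠ 0).card ≤ ∑ _i ∈ I, (k + l) * B := by
    calc ∑ i ∈ I, (U.filter fun v => v i ≠ 0).card
        = ∑ v ∈ U, (I.filter fun i => v i ≠ 0).card := by
          simp only [Finset.card_filter]
          exact Finset.sum_comm
      _ ≤ ∑ _v ∈ U, (k + l) := Finset.sum_le_sum fun v hv => by
          rw [← (h.isPMVec v (Finset.mem_filter.1 hv).1).card_nzSupport]
          exact Finset.card_le_card (Finset.filter_subset_filter _ (Finset.subset_univ _))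
      _ = U.card * (k + l) := by simp
      _ ≤ I.card * B * (k + l) := Nat.mul_le_mul_right _ hUcard
      _ = ∑ _i ∈ I, (k + l) * B := by simp; ring
  obtain ⟨i, hi, hle⟩ := Finset.exists_le_of_sum_le hI hsum
  refine ⟨i, hi, ?_⟩
  have hi0 : σ i ≠ 0 := by rcases hσ i hi with h | h <;> omega
  obtain ⟨w, hw, hwi⟩ := hne i hi
  set C := fun j => V.filter fun v => v ∉ U ∧ v i ≠ 0 ∧ v j ≠ 0
  have hCcard : ∀ j ∈ (nzSupport w).erase i, (C j).card ≤ (X.card - 2).choose (k + l - 2) := by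
    intro j hj
    have hij : i ≠ j := (Finset.mem_erase.1 hj).1.symm
    have hinj : Set.InjOn nzSupport (C j : Set (Fin n → ℤ)) := by
      intro v hv v' hv' hs
      obtain ⟨hv, hvU, -⟩ := Finset.mem_filter.1 hv
      obtain ⟨hv', hvU', -⟩ := Finset.mem_filter.1 hv'
      funext x
      by_contra hx
      have hs : v x ≠ 0 ↔ v' x ≠ 0 := by rw [← mem_nzSupport, ← mem_nzSupport, hs]
      have h1 := (h.isPMVec v hv).1 x
      have h2 := (h.isPMVec v' hv').1 x
      have hxI : x ∈ I := hclash v hv v' hv' x (by omega) (by omega)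
      have h3 : v x ≠ σ x := fun h => hvU (Finset.mem_filter.2 ⟨hv, x, hxI, h⟩)
      have h4 : v' x ≠ σ x := fun h => hvU' (Finset.mem_filter.2 ⟨hv', x, hxI, h⟩)
      have := hσ x hxI
      omega
    rw [← Finset.card_image_of_injOn hinj, ← Finset.card_pair hij]
    refine card_image_nzSupport_le fun v hv => ?_
    obtain ⟨hv, -, hvi, hvj⟩ := Finset.mem_filter.1 hv
    exact ⟨h.isPMVec v hv, h.subset v hv, by
      simp [Finset.insert_subset_iff, mem_nzSupport, hvi, hvj]⟩
  have hcover : (V.filter fun v => v i ≠ 0) ⊆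
      ((nzSupport w).erase i).biUnion C ∪ U.filter fun v => v i ≠ 0 := by
    intro v hv
    obtain ⟨hv, hvi⟩ := Finset.mem_filter.1 hv
    by_cases hvU : v ∈ U
    · exact Finset.mem_union_right _ (Finset.mem_filter.2 ⟨hvU, hvi⟩)
    have hvσ : v i ≠ σ i := fun h => hvU (Finset.mem_filter.2 ⟨hv, i, hi, h⟩)
    have h1 := (h.isPMVec v hv).1 i
    have h2 := hσ i hi
    obtain ⟨j, hwj, hvj⟩ := h.meet w hw v hv i (by omega) (by omega)
    refine Finset.mem_union_left _ (Finset.mem_biUnion.2 ⟨j, Finset.mem_erase.2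
      ⟨?_, mem_nzSupport.2 hwj⟩, Finset.mem_filter.2 ⟨hv, hvU, hvi, by rwa [hvj]⟩⟩)
    rintro rfl
    omega
  refine (Finset.card_le_card hcover).trans ((Finset.card_union_le _ _).trans
    (Nat.add_le_add ?_ hle))
  refine (Finset.card_biUnion_le_card_mul _ _ _ hCcard).trans (Nat.mul_le_mul_right _ ?_)
  rw [Finset.card_erase_of_mem (mem_nzSupport.2 (by rwa [hwi])), (h.isPMVec w hw).card_nzSupport]

/-- If two members of the family have opposite nonzero entries at some coordinate, then some
coordinate of `X` is contained in few supports. -/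
theorem exists_card_filter_le (h : IsMeetingFamily n k l X V) (hl : 1 ≤ l) (hlk : l < k)
    (hV : ∃ v ∈ V, ∃ w ∈ V, ∃ i, v i ≠ 0 ∧ w i = -v i) :
    ∃ i ∈ X, (V.filter fun v => v i ≠ 0).card
      ≤ 2 * ((X.card - 2).choose (k + l - 2) * (k + l).choose l)
        + 2 * (k + l - 1) ^ 2 * ((X.card - 3).choose (k + l - 3) * (k + l).choose l) := by
  classical
  set A := (X.card - 2).choose (k + l - 2) * (k + l).choose l with hA
  set B := (X.card - 3).choose (k + l - 3) * (k + l).choose l with hB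
  set I := X.filter fun i => (∃ v ∈ V, v i = 1) ∧ ∃ v ∈ V, v i = -1
  by_cases hrare : ∀ i ∈ I, ∃ σ : ℤ, (σ = 1 ∨ σ = -1) ∧ (V.filter fun v => v i = σ).card ≤ B
  · have hclash : ∀ v ∈ V, ∀ w ∈ V, ∀ i, v i ≠ 0 → w i = -v i → i ∈ I := by
      intro v hv w hw i hvi hwi
      refine Finset.mem_filter.2 ⟨h.subset v hv (mem_nzSupport.2 hvi), ?_⟩
      rcases (h.isPMVec v hv).1 i with h1 | h1 | h1
      · exact absurd h1 hvi
      · exact ⟨⟨v, hv, h1⟩, w, hw, by omega⟩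
      · exact ⟨⟨w, hw, by omega⟩, v, hv, h1⟩
    have hσ : ∀ i, ∃ σ : ℤ, i ∈ I → (σ = 1 ∨ σ = -1) ∧ (V.filter fun v => v i = σ).card ≤ B := by
      intro i
      by_cases hi : i ∈ I
      · obtain ⟨σ, hσ⟩ := hrare i hi
        exact ⟨σ, fun _ => hσ⟩
      · exact ⟨0, fun h => absurd h hi⟩
    choose σ hσ using hσ
    obtain ⟨v, hv, w, hw, i, hvi, hwi⟩ := hV
    obtain ⟨i, hi, hle⟩ := h.exists_card_filter_le_of_rare ⟨i, hclash v hv w hw i hvi hwi⟩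
      (fun i hi => (hσ i hi).1)
      (fun i hi => by
        obtain ⟨-, h1, h2⟩ := Finset.mem_filter.1 hi
        rcases (hσ i hi).1 with h | h <;> rwa [h])
      (fun i hi => (hσ i hi).2) hclash
    refine ⟨i, (Finset.mem_filter.1 hi).1, hle.trans ?_⟩
    have hq : k + l - 1 ≤ (k + l).choose l := by
      have h1 : (k + l).choose 1 ≤ (k + l).choose l := by
        clear * - hl hlk
        suffices ∀ j, 1 ≤ j → j ≤ l → (k + l).choose 1 ≤ (k + l).choose j from this l hl le_rfl
        intro j hj
        induction j, hj using Nat.le_induction with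
        | base => exact fun _ => le_rfl
        | succ j _ ih =>
          exact fun h => (ih (by omega)).trans (Nat.choose_le_succ_of_lt_half_left (by omega))
      rw [Nat.choose_one_right] at h1
      omega
    have h1 : (k + l - 1) * (X.card - 2).choose (k + l - 2) ≤ A := by
      rw [hA, mul_comm]
      exact Nat.mul_le_mul_left _ hq
    have h2 : k + l ≤ 2 * (k + l - 1) ^ 2 := by
      obtain ⟨s, hs⟩ : ∃ s, k + l = s + 1 := ⟨k + l - 1, by omega⟩
      rw [hs, Nat.add_sub_cancel]
      have : 2 ≤ s := by omega
      nlinarith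
    have h3 := Nat.mul_le_mul_right B h2
    omega
  · push Not at hrare
    obtain ⟨i, hi, hbig⟩ := hrare
    obtain ⟨hiX, ⟨v, hv, hvi⟩, w, hw, hwi⟩ := Finset.mem_filter.1 hi
    have h1 := (h.card_filter_le_or_card_filter_neg_le one_ne_zero hv hvi).resolve_left
      (not_le.2 (hbig 1 (Or.inl rfl)))
    have h2 := (h.card_filter_le_or_card_filter_neg_le (by norm_num) hw hwi).resolve_left
      (not_le.2 (hbig (-1) (Or.inr rfl)))
    rw [neg_neg] at h2
    refine ⟨i, hiX, ?_⟩
    have h3 : (V.filter fun v => v i ≠ 0).card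
        ≤ (V.filter fun v => v i = -1).card + (V.filter fun v => v i = 1).card := by
      refine (Finset.card_le_card fun x hx => ?_).trans (Finset.card_union_le _ _)
      obtain ⟨hx, hxi⟩ := Finset.mem_filter.1 hx
      have := (h.isPMVec x hx).1 i
      simp only [Finset.mem_union, Finset.mem_filter, hx, true_and]
      omega
    calc _ ≤ _ := h3
      _ ≤ _ := Nat.add_le_add h1 h2
      _ = _ := by ring

theorem card_le_or_card_le (h : IsMeetingFamily n k l X V) (hl : 1 ≤ l) (hlk : l < k)
    {n₀ : ℕ} (hn₀ : (k + l) * 2 ^ (k + l + 2) ≤ n₀) (hX : n₀ ≤ X.card) :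
    V.card ≤ pVal X.card k l ∨
      8 * V.card ≤ 8 * (n₀.choose (k + l) * (k + l).choose l) + 5 * pVal X.card k l := by
  obtain ⟨m, hm⟩ : ∃ m, X.card = m := ⟨_, rfl⟩
  rw [hm] at hX ⊢
  induction m, hX using Nat.le_induction generalizing X V with
  | base =>
    right
    have := h.card_le
    rw [hm] at this
    omega
  | succ m hmn ih =>
    by_cases hV : ∃ v ∈ V, ∃ w ∈ V, ∃ i, v i ≠ 0 ∧ w i = -v i
    · obtain ⟨i, hiX, hi⟩ := h.exists_card_filter_le hl hlk hV
      have hdeg := degree_bound_le_pVal_sub (m := m + 1) (k := k) (l := l) (by omega) (by omega)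
      rw [hm] at hi
      rw [Nat.add_sub_cancel] at hdeg
      have hsplit := Finset.card_filter_add_card_filter_not (s := V) (fun v => v i = 0)
      change _ + (V.filter fun v => v i ≠ 0).card = _ at hsplit
      have := ih (h.erase i) (by rw [Finset.card_erase_of_mem hiX, hm, Nat.add_sub_cancel])
      omega
    · left
      rw [← hm]
      push Not at hV
      exact h.card_le_pVal hV

end IsMeetingFamily

theorem exists_card_eq_pVal (n k l : ℕ) : ∃ F : Finset (Fin n → ℤ),
    (∀ v ∈ F, IsPMVec n k l v) ∧ (∀ v ∈ F, ∀ w ∈ F, 0 ≤ dotZ v w) ∧ F.card = pVal n k l := by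
  classical
  obtain ⟨x, hx, hp⟩ := exists_pVal_eq n k l
  obtain ⟨P, -, hP⟩ := Finset.exists_subset_card_eq (s := (Finset.univ : Finset (Fin n)))
    (n := x) (by simpa using hx)
  set f : Finset (Fin n) × Finset (Fin n) → Fin n → ℤ := fun s i =>
    if i ∈ s.1 then 1 else if i ∈ s.2 then -1 else 0 with hf
  set D := P.powersetCard k ×ˢ Pᶜ.powersetCard l with hD
  have hD' : ∀ s ∈ D, (s.1 ⊆ P ∧ s.1.card = k) ∧ (s.2 ⊆ Pᶜ ∧ s.2.card = l) := fun s hs => by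
    simpa [hD, Finset.mem_powersetCard] using hs
  have hpos : ∀ s i, f s i = 1 ↔ i ∈ s.1 := fun s i => by
    simp only [hf]; split_ifs <;> simp_all
  have hneg : ∀ s ∈ D, ∀ i, f s i = -1 ↔ i ∈ s.2 := fun s hs i => by
    have h1 := @(hD' s hs).1.1 i
    have h2 := @(hD' s hs).2.1 i
    rw [Finset.mem_compl] at h2
    simp only [hf]; split_ifs <;> simp_all
  refine ⟨D.image f, ?_, ?_, ?_⟩
  · intro v hv
    obtain ⟨s, hs, rfl⟩ := Finset.mem_image.1 hv
    refine ⟨fun i => ?_, ?_, ?_⟩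
    · simp only [hf]; split_ifs <;> simp
    · rw [← (hD' s hs).1.2]
      congr 1
      ext i
      simp [hpos]
    · rw [← (hD' s hs).2.2]
      congr 1
      ext i
      simp [hneg s hs]
  · intro v hv w hw
    obtain ⟨s, hs, rfl⟩ := Finset.mem_image.1 hv
    obtain ⟨t, ht, rfl⟩ := Finset.mem_image.1 hw
    refine Finset.sum_nonneg fun i _ => ?_
    have h1 := @(hD' s hs).1.1 i
    have h2 := @(hD' s hs).2.1 i
    have h3 := @(hD' t ht).1.1 i
    have h4 := @(hD' t ht).2.1 i
    rw [Finset.mem_compl] at h2 h4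
    simp only [hf]; split_ifs <;> simp_all
  · rw [Finset.card_image_of_injOn, hD, Finset.card_product, Finset.card_powersetCard,
      Finset.card_powersetCard, Finset.card_compl, Fintype.card_fin, hP, hp]
    intro s hs t ht hst
    refine Prod.ext (Finset.ext fun i => ?_) (Finset.ext fun i => ?_)
    · rw [← hpos, ← hpos, hst]
    · rw [← hneg s hs, ← hneg t ht, hst]

/-- Let `k > l ≥ 1` and `n₀ = (k+l)·2^(k+l+2)`. For every `n ≥ 3n₀`,
one has `m(n,k,l) = p(n,k,l)`. -/
theorem stmt_7 (k l n : ℕ) (hl : 1 ≤ l) (hlk : l < k)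
    (hn : 3 * ((k + l) * 2 ^ (k + l + 2)) ≤ n) :
    mVal n k l = pVal n k l := by
  refine IsGreatest.csSup_eq ⟨exists_card_eq_pVal n k l, ?_⟩
  rintro _ ⟨F, hF, hdot, rfl⟩
  have h := (isMeetingFamily_of_dotZ_nonneg hF hdot).card_le_or_card_le hl hlk le_rfl
    (by rw [Finset.card_univ, Fintype.card_fin]; omega)
  rw [Finset.card_univ, Fintype.card_fin] at h
  have hkl : (k + l) * 1 ≤ (k + l) * 2 ^ (k + l + 2) :=
    Nat.mul_le_mul_left _ Nat.one_le_two_pow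
  have := terminal_bound (n := n) (k := k) (l := l) (by omega) (by omega) hn
  omega
end

section
/- Let k ≥ 1 and n ≥ k+ℓ be integers and let w ∈ V(n,k,ℓ) satisfy |S_+(w) ∩ [2t−1]| ≤ t−1 for every integer t ≥ 1. Then n ≥ 2k, and, letting p_1 > p_2 > … > p_k be the indices with w_{p_i} = +1 (in decreasing order) and r_1 < r_2 < … < r_k be the k smallest indices j with w_j ≠ 1 (in increasing order), one has p_{k−i+1} > r_i for every i = 1,…,k. -/
/-- Let `k ≥ 1`, `n ≥ k + l`, and let `w ∈ V(n,k,l)` satisfy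
`|S₊(w) ∩ [2t-1]| ≤ t - 1` for every integer `t ≥ 1`.  Then `n ≥ 2k`, and letting
`p 1 > … > p k` be the indices with `w (p i) = 1` (in decreasing order) and
`r 1 < … < r k` the `k` smallest indices `j` with `w j ≠ 1` (in increasing order),
one has `p (k - i + 1) > r i` for every `i = 1, …, k`.
(Coordinate `i : Fin n` corresponds to the index `i + 1 ∈ [n]`.) -/
theorem stmt_10 (n k l : ℕ) (hk : 1 ≤ k) (hn : k + l ≤ n)
    (w : Fin n → ℤ) (hw : IsPMVec n k l w)
    (hii : ∀ t : ℕ, 1 ≤ t →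
      (Finset.univ.filter fun i : Fin n => w i = 1 ∧ (i : ℕ) + 1 ≤ 2 * t - 1).card
        ≤ t - 1)
    (p : Fin k → Fin n) (hp : StrictAnti p) (hpw : ∀ i, w (p i) = 1)
    (r : Fin k → Fin n) (hr : StrictMono r) (hrw : ∀ i, w (r i) ≠ 1)
    (hrmin : ∀ j : Fin n, w j ≠ 1 → (∀ i : Fin k, r i ≠ j) → ∀ i : Fin k, r i < j) :
    2 * k ≤ n ∧ ∀ i : Fin k, r i < p ⟨k - 1 - (i : ℕ), by omega⟩ := by
  have prefix_le (m : ℕ) :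
      (Finset.univ.filter fun i : Fin n => w i = 1 ∧ (i : ℕ) + 1 ≤ m).card ≤ m / 2 := by
    refine le_trans (Finset.card_le_card ?_) (hii (m / 2 + 1) (by omega))
    intro i hi
    simp only [Finset.mem_filter, Finset.mem_univ, true_and] at hi ⊢
    exact ⟨hi.1, by omega⟩
  constructor
  · have hfull := prefix_le n
    have heq : (Finset.univ.filter fun i : Fin n => w i = 1 ∧ (i : ℕ) + 1 ≤ n)
        = Finset.univ.filter fun i => w i = 1 :=
      Finset.filter_congr fun i _ => and_iff_left i.isLt
    rw [heq, hw.2.1] at hfull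
    omega
  · intro j
    by_contra hlt
    set q : Fin k := ⟨k - 1 - (j : ℕ), by omega⟩ with hq
    have hqr : p q < r j :=
      lt_of_le_of_ne (not_lt.mp hlt) fun h => hrw j (h ▸ hpw q)
    have hones : (j : ℕ) + 1 ≤ ((Finset.Iic (p q)).filter fun i => w i = 1).card := by
      calc (j : ℕ) + 1 = ((Finset.Ici q).image p).card := by
            rw [Finset.card_image_of_injective _ hp.injective, Fin.card_Ici, hq]
            dsimp only
            omega
        _ ≤ _ := by
            refine Finset.card_le_card (Finset.image_subset_iff.mpr fun i hi => ?_)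
            exact Finset.mem_filter.mpr
              ⟨Finset.mem_Iic.mpr (hp.antitone (Finset.mem_Ici.mp hi)), hpw i⟩
    have hothers : ((Finset.Iic (p q)).filter fun i => ¬ w i = 1).card ≤ j := by
      calc _ ≤ ((Finset.Iio j).image r).card := by
            refine Finset.card_le_card fun x hx => ?_
            obtain ⟨hxq, hxw⟩ := Finset.mem_filter.mp hx
            have hxr : x < r j := (Finset.mem_Iic.mp hxq).trans_lt hqr
            obtain ⟨i, rfl⟩ : ∃ i, r i = x := by
              by_contra! h
              exact lt_asymm hxr (hrmin x hxw h j)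
            exact Finset.mem_image_of_mem r (Finset.mem_Iio.mpr (hr.lt_iff_lt.mp hxr))
        _ ≤ (Finset.Iio j).card := Finset.card_image_le
        _ = j := Fin.card_Iio j
    have hsum := Finset.card_filter_add_card_filter_not
      (s := Finset.Iic (p q)) (fun i => w i = 1)
    rw [Fin.card_Iic] at hsum
    have hprefix := prefix_le (p q + 1)
    have heq : (Finset.univ.filter fun i : Fin n => w i = 1 ∧ (i : ℕ) + 1 ≤ p q + 1)
        = (Finset.Iic (p q)).filter fun i => w i = 1 := by
      ext i
      simp only [Finset.mem_filter, Finset.mem_univ, true_and, Finset.mem_Iic, Fin.le_def,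
        Nat.add_le_add_iff_right]
      exact and_comm
    rw [heq] at hprefix
    omega
end

section
/- Let G be a bipartite graph with finite vertex parts A and B, A nonempty, such that every vertex of A has the same degree d_A ≥ 1 and every vertex of B has the same degree d_B ≥ 1 (degrees counted toward the opposite part). Then for every real number α ≥ |B|/|A| and every independent set I ⊆ A ∪ B of G, one has |I ∩ B| + α·|I ∩ A| ≤ α·|A|. -/
/-- If all fibres of `f` on `E` over points of `S` have `d` elements, then the part of `E` lying
over `S` has `|S| * d` elements. -/
theorem card_filter_mem_of_card_fiber_eq {X Y : Type*} [DecidableEq Y] (f : X → Y) (E : Finset X)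
    (S : Finset Y) (d : ℕ) (h : ∀ y ∈ S, (E.filter fun e => f e = y).card = d) :
    (E.filter fun e => f e ∈ S).card = S.card * d := by
  rw [Finset.card_eq_sum_card_fiberwise (f := f) (t := S) (by intro e; simp)]
  refine Finset.sum_const_nat fun y hy => ?_
  rw [← h y hy, Finset.filter_filter]
  congr 1
  ext e
  simp only [Finset.mem_filter]
  grind

/-- Let `G` be a bipartite graph with finite parts `A` (nonempty) and `B` and edge set
`E ⊆ A × B`, in which every vertex of `A` has degree `dA ≥ 1` and every vertex of `B`
has degree `dB ≥ 1`.  Then for every real `α ≥ |B|/|A|` and every independent set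
`I ⊆ A ∪ B` (given by its traces `IA ⊆ A`, `IB ⊆ B`), one has
`|I ∩ B| + α·|I ∩ A| ≤ α·|A|`. -/
theorem stmt_11 {V W : Type*} [DecidableEq V] [DecidableEq W]
    (A : Finset V) (B : Finset W) (E : Finset (V × W)) (hE : E ⊆ A ×ˢ B)
    (hA : A.Nonempty) (dA dB : ℕ) (hdA : 1 ≤ dA) (hdB : 1 ≤ dB)
    (hdegA : ∀ a ∈ A, (E.filter fun e => e.1 = a).card = dA)
    (hdegB : ∀ b ∈ B, (E.filter fun e => e.2 = b).card = dB)
    (α : ℝ) (hα : (B.card : ℝ) / (A.card : ℝ) ≤ α)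
    (IA : Finset V) (IB : Finset W) (hIA : IA ⊆ A) (hIB : IB ⊆ B)
    (hind : ∀ a ∈ IA, ∀ b ∈ IB, (a, b) ∉ E) :
    (IB.card : ℝ) + α * (IA.card : ℝ) ≤ α * (A.card : ℝ) := by
  have hcardA : E.card = A.card * dA := by
    rw [← card_filter_mem_of_card_fiber_eq Prod.fst E A dA hdegA, Finset.filter_true_of_mem]
    exact fun e he => (Finset.mem_product.1 (hE he)).1
  have hcardB : E.card = B.card * dB := by
    rw [← card_filter_mem_of_card_fiber_eq Prod.snd E B dB hdegB, Finset.filter_true_of_mem]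
    exact fun e he => (Finset.mem_product.1 (hE he)).2
  have hdisj : Disjoint (E.filter fun e => e.1 ∈ IA) (E.filter fun e => e.2 ∈ IB) :=
    Finset.disjoint_filter.2 fun e he h1 h2 => hind e.1 h1 e.2 h2 he
  have hedges : IA.card * dA + IB.card * dB ≤ A.card * dA := by
    rw [← card_filter_mem_of_card_fiber_eq Prod.fst E IA dA fun a ha => hdegA a (hIA ha),
      ← card_filter_mem_of_card_fiber_eq Prod.snd E IB dB fun b hb => hdegB b (hIB hb),
      ← Finset.card_union_of_disjoint hdisj, ← hcardA]
    exact Finset.card_le_card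
      (Finset.union_subset (Finset.filter_subset _ _) (Finset.filter_subset _ _))
  have hApos : (0 : ℝ) < A.card := by exact_mod_cast hA.card_pos
  have hdBpos : (0 : ℝ) < dB := by exact_mod_cast hdB
  have hcard : (A.card : ℝ) * dA = B.card * dB := by exact_mod_cast hcardA.symm.trans hcardB
  have hratio : (dA : ℝ) ≤ α * dB := by
    rw [← div_le_iff₀ hdBpos]
    refine le_trans (le_of_eq ?_) hα
    rw [div_eq_div_iff hdBpos.ne' hApos.ne']
    linarith
  have hedges' : (IA.card : ℝ) * dA + IB.card * dB ≤ A.card * dA := by exact_mod_cast hedges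
  have hle : (0 : ℝ) ≤ A.card - IA.card :=
    sub_nonneg.2 (by exact_mod_cast Finset.card_le_card hIA)
  have hscaled : (IB.card : ℝ) * dB ≤ α * (A.card - IA.card) * dB := by
    linarith [mul_le_mul_of_nonneg_left hratio hle]
  linarith [le_of_mul_le_mul_right hscaled hdBpos]
end
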